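/- arXiv:2311.12697 — 2 statements merged into one kernel-verified Lean document; each statement's English description precedes it below -/
import Mathlib

section
/- Let Λ = A_{n,n+1} be the self-injective Nakayama algebra with n simple modules and Loewy length n+1. Then the simple Λ-modules have rigidity degree 2n − 2, and every non-projective indecomposable Λ-module has rigidity degree at most 2n − 2. -/
open CategoryTheory CategoryTheory.Limits Opposite

universe u

namespace Rigidity

variable (Λ : Type u) [Ring Λ]

/-- `X` belongs to `add M`: it is a direct summand of a finite direct sum of copies of `M`. -/
def InAdd (M X : ModuleCat.{u} Λ) : Prop :=
  ∃ (r : ℕ) (Y : ModuleCat.{u} Λ), Nonempty ((X ⊞ Y) ≅ ⨁ (fun _ : Fin r => M))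

/-- An indecomposable object. -/
def Indec (X : ModuleCat.{u} Λ) : Prop :=
  ¬ IsZero X ∧ ∀ A B : ModuleCat.{u} Λ, Nonempty (X ≅ A ⊞ B) → IsZero A ∨ IsZero B

/-- A generator-cogenerator: `add M` contains the regular module and all
finitely generated injective modules. -/
def IsGenCogen (M : ModuleCat.{u} Λ) : Prop :=
  InAdd Λ M (ModuleCat.of Λ Λ) ∧
  ∀ I : ModuleCat.{u} Λ, Module.Finite Λ I → Injective I → InAdd Λ M I

/-- `g : A ⟶ X` is a right minimal `add M`-approximation. -/
def IsRMApprox (M : ModuleCat.{u} Λ) {A X : ModuleCat.{u} Λ} (g : A ⟶ X) : Prop :=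
  InAdd Λ M A ∧
  (∀ T : ModuleCat.{u} Λ, InAdd Λ M T → ∀ f : T ⟶ X, ∃ h : T ⟶ A, h ≫ g = f) ∧
  (∀ h : A ⟶ A, h ≫ g = g → IsIso h)

/-- `IsMSyzygy M X r W` : `W` is an `r`-th `M`-syzygy `Ω_M^r(X)` of `X`. -/
inductive IsMSyzygy (M : ModuleCat.{u} Λ) : ModuleCat.{u} Λ → ℕ → ModuleCat.{u} Λ → Prop
  | zero (X : ModuleCat.{u} Λ) : IsMSyzygy M X 0 X
  | succ (X : ModuleCat.{u} Λ) (r : ℕ) (W A : ModuleCat.{u} Λ) (g : A ⟶ W)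
      (hW : IsMSyzygy M X r W) (hg : IsRMApprox Λ M g) :
      IsMSyzygy M X (r + 1) (kernel g)

/-- The `M`-dimension of `X` is at most `r`. -/
def MdimLE (M X : ModuleCat.{u} Λ) (r : ℕ) : Prop :=
  ∃ W : ModuleCat.{u} Λ, IsMSyzygy Λ M X r W ∧ InAdd Λ M W

/-- projective dimension at most `r`, via a length `r` projective resolution. -/
def ProjDimLE (A : Type u) [Ring A] (N : ModuleCat.{u} A) (r : ℕ) : Prop :=
  ∃ (P : ℕ → ModuleCat.{u} A) (d : ∀ i : ℕ, P (i + 1) ⟶ P i) (f : P 0 ⟶ N),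
    (∀ i, Projective (P i)) ∧ (∀ i, r < i → IsZero (P i)) ∧ Epi f ∧
    (∃ w : d 0 ≫ f = 0, (ShortComplex.mk (d 0) f w).Exact) ∧
    (∀ i, ∃ w : d (i + 1) ≫ d i = 0, (ShortComplex.mk (d (i + 1)) (d i) w).Exact)

/-- global dimension at most `r`. -/
def GldimLE (A : Type u) [Ring A] (r : ℕ) : Prop :=
  ∀ N : ModuleCat.{u} A, ProjDimLE A N r

/-- the global dimension, as an element of `ℕ∞`. -/
noncomputable def gldim (A : Type u) [Ring A] : ℕ∞ :=
  sInf {c : ℕ∞ | ∃ r : ℕ, c = (r : ℕ∞) ∧ GldimLE A r}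

/-- dominant dimension at least `r`: there is an exact sequence
`0 → A → I^0 → ⋯ → I^(r-1)` with all `I^i` projective-injective. -/
def DomdimGE (A : Type u) [Ring A] (r : ℕ) : Prop :=
  ∃ (I : ℕ → ModuleCat.{u} A) (f : ModuleCat.of A A ⟶ I 0) (g : ∀ i : ℕ, I i ⟶ I (i + 1)),
    Mono f ∧ (∀ i, i < r → Injective (I i) ∧ Projective (I i)) ∧
    (2 ≤ r → ∃ w : f ≫ g 0 = 0, (ShortComplex.mk f (g 0) w).Exact) ∧
    (∀ i, i + 3 ≤ r → ∃ w : g i ≫ g (i + 1) = 0, (ShortComplex.mk (g i) (g (i + 1)) w).Exact)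

/-- the dominant dimension, as an element of `ℕ∞`. -/
noncomputable def domdim (A : Type u) [Ring A] : ℕ∞ :=
  sSup {c : ℕ∞ | ∃ r : ℕ, c = (r : ℕ∞) ∧ DomdimGE A r}

/-- the rigidity degree of a module, as an element of `ℕ∞`. -/
noncomputable def rigDeg [HasExt.{u} (ModuleCat.{u} Λ)] (M : ModuleCat.{u} Λ) : ℕ∞ :=
  sSup {c : ℕ∞ | ∃ r : ℕ, c = (r : ℕ∞) ∧ 0 < r ∧
    ∀ i : ℕ, 1 ≤ i → i ≤ r → Subsingleton (Abelian.Ext M M i)}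

/-- the rigidity dimension. -/
noncomputable def rigdim : ℕ∞ :=
  sSup {c : ℕ∞ | ∃ M : ModuleCat.{u} Λ, Module.Finite Λ M ∧ IsGenCogen Λ M ∧
    (∃ r : ℕ, GldimLE (End (op M)) r) ∧ c = domdim (End (op M))}

/-- An Auslander-Reiten (almost split) sequence. -/
def IsARSeq {X Y Z : ModuleCat.{u} Λ} (f : X ⟶ Y) (g : Y ⟶ Z) : Prop :=
  Mono f ∧ Epi g ∧ (∃ w : f ≫ g = 0, (ShortComplex.mk f g w).Exact) ∧
  Indec Λ X ∧ Indec Λ Z ∧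
  (¬ ∃ s : Z ⟶ Y, s ≫ g = 𝟙 Z) ∧
  (∀ (W : ModuleCat.{u} Λ) (h : W ⟶ Z), (¬ ∃ s : Z ⟶ W, s ≫ h = 𝟙 Z) →
    ∃ h' : W ⟶ Y, h' ≫ g = h)

/-- `X` has composition length `t`. -/
def HasCompLength (X : ModuleCat.{u} Λ) (t : ℕ) : Prop :=
  (∃ c : Fin (t + 1) → Submodule Λ X, StrictMono c ∧ c 0 = ⊥ ∧ c (Fin.last t) = ⊤) ∧
  ∀ r : ℕ, (∃ c : Fin (r + 1) → Submodule Λ X, StrictMono c ∧ c 0 = ⊥ ∧ c (Fin.last r) = ⊤) →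
    r ≤ t


/-- powers of the Jacobson radical, as left submodules of `Λ`. -/
def radPow (Λ : Type u) [Ring Λ] : ℕ → Submodule Λ Λ
  | 0 => ⊤
  | r + 1 => Submodule.span Λ
      {x : Λ | ∃ a ∈ Ideal.jacobson (⊥ : Ideal Λ), ∃ b ∈ radPow Λ r, x = a * b}

/-- `Λ` is the connected self-injective Nakayama algebra over `k`
with `n` simple modules and Loewy length `m`. -/
structure IsSelfInjNakayama (k : Type u) (Λ : Type u) [Field k] [Ring Λ] [Algebra k Λ]
    (n m : ℕ) : Prop where
  findim : FiniteDimensional k Λ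
  connected : ∀ e : Λ, IsIdempotentElem e → e ∈ Set.center Λ → e = 0 ∨ e = 1
  selfinj : Injective (ModuleCat.of Λ Λ)
  uniserial : ∀ X : ModuleCat.{u} Λ, Module.Finite Λ X → Indec Λ X →
    ∀ N₁ N₂ : Submodule Λ X, N₁ ≤ N₂ ∨ N₂ ≤ N₁
  simples : ∃ S : Fin n → ModuleCat.{u} Λ, (∀ i, IsSimpleModule Λ (S i)) ∧
    (∀ i j, Nonempty (S i ≅ S j) → i = j) ∧
    ∀ T : ModuleCat.{u} Λ, IsSimpleModule Λ T → ∃ i, Nonempty (T ≅ S i)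
  loewy_top : radPow Λ m = ⊥
  loewy_bot : radPow Λ (m - 1) ≠ ⊥

section Uniserial

variable {Λ} {X Y N : Type*} [AddCommGroup X] [Module Λ X] [AddCommGroup Y] [Module Λ Y]
  [AddCommGroup N] [Module Λ N]

variable (Λ X) in
/-- A module is uniserial if its submodules form a chain. -/
def Uniserial : Prop := ∀ N₁ N₂ : Submodule Λ X, N₁ ≤ N₂ ∨ N₂ ≤ N₁

lemma Uniserial.of_injective (h : Uniserial Λ X) (f : N →ₗ[Λ] X) (hf : Function.Injective f) :
    Uniserial Λ N := fun A B => by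
  simpa [Submodule.map_le_map_iff_of_injective hf] using h (A.map f) (B.map f)

lemma Uniserial.of_surjective (h : Uniserial Λ X) (f : X →ₗ[Λ] Y) (hf : Function.Surjective f) :
    Uniserial Λ Y := fun A B => by
  simpa [Submodule.comap_le_comap_iff_of_surjective hf] using h (A.comap f) (B.comap f)

lemma Uniserial.le_of_isCoatom (h : Uniserial Λ X) {A B : Submodule Λ X} (hA : IsCoatom A)
    (hB : B ≠ ⊤) : B ≤ A := by
  rcases h A B with hAB | hBA
  · exact (hA.le_iff.1 hAB).resolve_left hB |>.le
  · exact hBA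

lemma Uniserial.eq_of_isCoatom (h : Uniserial Λ X) {A B : Submodule Λ X} (hA : IsCoatom A)
    (hB : IsCoatom B) : A = B :=
  le_antisymm (h.le_of_isCoatom hB hA.1) (h.le_of_isCoatom hA hB.1)

/-- A split quotient map from a uniserial module to a nonzero module is injective. -/
lemma Uniserial.injective_of_comp_eq_id (h : Uniserial Λ X) [Nontrivial Y] (g : X →ₗ[Λ] Y)
    (s : Y →ₗ[Λ] X) (hgs : g ∘ₗ s = LinearMap.id) : Function.Injective g := by
  have hgs' : ∀ y, g (s y) = y := fun y => LinearMap.congr_fun hgs y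
  rcases h (LinearMap.ker g) (LinearMap.range s) with hle | hle
  · rw [← LinearMap.ker_eq_bot, eq_bot_iff]
    intro x hx
    obtain ⟨y, rfl⟩ := hle hx
    have : y = 0 := by rw [← hgs' y]; exact hx
    simp [this]
  · obtain ⟨y, hy⟩ := exists_ne (0 : Y)
    exact absurd ((hgs' y).symm.trans (hle ⟨y, rfl⟩)) hy

/-- A nonzero direct summand of a uniserial module is everything. -/
lemma Uniserial.surjective_of_comp_eq_id (h : Uniserial Λ X) [Nontrivial N] (r : X →ₗ[Λ] N)
    (i : N →ₗ[Λ] X) (hri : r ∘ₗ i = LinearMap.id) : Function.Surjective i := fun x =>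
  ⟨r x, h.injective_of_comp_eq_id r i hri (LinearMap.congr_fun hri (r x))⟩

end Uniserial

section Len

variable {Λ} {X Y N : Type*} [AddCommGroup X] [Module Λ X] [AddCommGroup Y] [Module Λ Y]
  [AddCommGroup N] [Module Λ N]

variable (Λ X) in
/-- The composition length of a module of finite length, as a natural number. -/
noncomputable def len : ℕ := (Module.length Λ X).toNat

variable (Λ X) in
lemma coe_len [IsArtinianRing Λ] [Module.Finite Λ X] : (len Λ X : ℕ∞) = Module.length Λ X :=
  ENat.natCast_toNat Module.length_ne_top

lemma len_eq_of_linearEquiv (e : X ≃ₗ[Λ] Y) : len Λ X = len Λ Y := by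
  rw [len, len, e.length_eq]

lemma len_exact [IsArtinianRing Λ] [Module.Finite Λ X] (f : N →ₗ[Λ] X) (g : X →ₗ[Λ] Y)
    (hf : Function.Injective f) (hg : Function.Surjective g) (H : Function.Exact f g) :
    len Λ X = len Λ N + len Λ Y := by
  have : Module.Finite Λ N := Module.Finite.of_injective f hf
  have : Module.Finite Λ Y := Module.Finite.of_surjective g hg
  have := Module.length_eq_add_of_exact f g hf hg H
  rw [← coe_len Λ X, ← coe_len Λ N, ← coe_len Λ Y] at this
  exact_mod_cast this

lemma len_pos [IsArtinianRing Λ] [Module.Finite Λ X] [Nontrivial X] : 0 < len Λ X := by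
  have := Module.length_pos (R := Λ) (M := X)
  rw [← coe_len Λ X] at this
  exact_mod_cast this

lemma subsingleton_of_len [IsArtinianRing Λ] [Module.Finite Λ X] (h : len Λ X = 0) :
    Subsingleton X := by
  by_contra hX
  rw [not_subsingleton_iff_nontrivial] at hX
  exact (len_pos (Λ := Λ) (X := X)).ne' h

lemma len_ker_add_len [IsArtinianRing Λ] [Module.Finite Λ X] (g : X →ₗ[Λ] Y)
    (hg : Function.Surjective g) : len Λ X = len Λ (LinearMap.ker g) + len Λ Y :=
  len_exact _ g (Submodule.subtype_injective _) hg (LinearMap.exact_subtype_ker_map g)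

lemma len_submodule_add_len_quotient [IsArtinianRing Λ] [Module.Finite Λ X] (A : Submodule Λ X) :
    len Λ X = len Λ A + len Λ (X ⧸ A) :=
  len_exact A.subtype A.mkQ (Submodule.subtype_injective _) (Submodule.mkQ_surjective _)
    (LinearMap.exact_subtype_mkQ A)

variable (Λ X) in
lemma len_of_isSimpleModule [IsSimpleModule Λ X] : len Λ X = 1 := by
  simp [len, Module.length_eq_one]

lemma len_eq_add_one_of_isCoatom [IsArtinianRing Λ] [Module.Finite Λ X] {A : Submodule Λ X}
    (hA : IsCoatom A) : len Λ X = len Λ A + 1 := by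
  have := isSimpleModule_iff_isCoatom.2 hA
  rw [len_submodule_add_len_quotient A, len_of_isSimpleModule Λ (X ⧸ A)]

lemma len_le_of_surjective [IsArtinianRing Λ] [Module.Finite Λ X] (g : X →ₗ[Λ] Y)
    (hg : Function.Surjective g) : len Λ Y ≤ len Λ X := by
  rw [len_ker_add_len g hg]; omega

lemma len_le_of_injective [IsArtinianRing Λ] [Module.Finite Λ X] (g : N →ₗ[Λ] X)
    (hg : Function.Injective g) : len Λ N ≤ len Λ X := by
  rw [len_exact g (LinearMap.range g).mkQ hg (Submodule.mkQ_surjective _)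
    (LinearMap.exact_map_mkQ_range g)]; omega

lemma injective_of_len_eq [IsArtinianRing Λ] [Module.Finite Λ X] (g : X →ₗ[Λ] Y)
    (hg : Function.Surjective g) (h : len Λ X = len Λ Y) : Function.Injective g := by
  have h0 : len Λ (LinearMap.ker g) = 0 := by have := len_ker_add_len g hg; omega
  have := subsingleton_of_len h0
  rw [← LinearMap.ker_eq_bot]
  exact Submodule.eq_bot_of_subsingleton

lemma surjective_of_len_eq [IsArtinianRing Λ] [Module.Finite Λ X] (g : N →ₗ[Λ] X)
    (hg : Function.Injective g) (h : len Λ X = len Λ N) : Function.Surjective g := by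
  have h0 : len Λ (X ⧸ LinearMap.range g) = 0 := by
    have := len_exact g (LinearMap.range g).mkQ hg (Submodule.mkQ_surjective _)
      (LinearMap.exact_map_mkQ_range g)
    omega
  have := subsingleton_of_len h0
  rw [← LinearMap.range_eq_top]
  exact Submodule.Quotient.subsingleton_iff.1 this

end Len


section CoverFamily

variable {Λ} {ι : Type*}

/-- The family `P` consists of uniserial projective-injective modules, one for each isomorphism
class of simple modules, which it covers. -/
structure IsCoverFamily (P : ι → ModuleCat.{u} Λ) : Prop where
  projective : ∀ i, Module.Projective Λ (P i)
  injective : ∀ i, Module.Injective Λ (P i)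
  finite : ∀ i, Module.Finite Λ (P i)
  nontrivial : ∀ i, Nontrivial (P i)
  uniserial : ∀ i, Uniserial Λ (P i)
  exists_ne_zero : ∀ (T : Type u) [AddCommGroup T] [Module Λ T], IsSimpleModule Λ T →
    ∃ i, ∃ f : P i →ₗ[Λ] T, f ≠ 0
  eq_of_ne_zero : ∀ (T : Type u) [AddCommGroup T] [Module Λ T], IsSimpleModule Λ T →
    ∀ (i j : ι) (f : P i →ₗ[Λ] T) (g : P j →ₗ[Λ] T), f ≠ 0 → g ≠ 0 → i = j

/-- `X` is a quotient of `P i`. -/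
def HasTop (P : ι → ModuleCat.{u} Λ) (X : Type*) [AddCommGroup X] [Module Λ X] (i : ι) : Prop :=
  ∃ f : P i →ₗ[Λ] X, Function.Surjective f

variable {P : ι → ModuleCat.{u} Λ} {X Y : Type u} [AddCommGroup X] [Module Λ X]
  [AddCommGroup Y] [Module Λ Y]

lemma HasTop.map {i : ι} (h : HasTop P X i) (g : X →ₗ[Λ] Y) (hg : Function.Surjective g) :
    HasTop P Y i := by
  obtain ⟨f, hf⟩ := h
  exact ⟨g ∘ₗ f, hg.comp hf⟩

lemma IsCoverFamily.finite_of_hasTop (hP : IsCoverFamily P) {i : ι} (h : HasTop P X i) :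
    Module.Finite Λ X := by
  obtain ⟨f, hf⟩ := h
  have := hP.finite i
  exact Module.Finite.of_surjective f hf

lemma IsCoverFamily.lift (hP : IsCoverFamily P) {i : ι} (g : X →ₗ[Λ] Y)
    (hg : Function.Surjective g) (f : P i →ₗ[Λ] Y) : ∃ h : P i →ₗ[Λ] X, g ∘ₗ h = f := by
  have := hP.projective i
  exact Module.projective_lifting_property g f hg

lemma IsCoverFamily.extend (hP : IsCoverFamily P) {i : ι} (g : X →ₗ[Λ] Y)
    (hg : Function.Injective g) (f : X →ₗ[Λ] P i) : ∃ h : Y →ₗ[Λ] P i, h ∘ₗ g = f := by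
  have := hP.injective i
  exact Module.Injective.extension_property Λ (P i) X Y g hg f

/-- The members of a cover family detect proper submodules. -/
lemma IsCoverFamily.exists_not_range_le (hP : IsCoverFamily P) {M : Submodule Λ X}
    (hM : IsCoatom M) : ∃ i, ∃ f : P i →ₗ[Λ] X, ¬ LinearMap.range f ≤ M := by
  obtain ⟨i, f, hf⟩ := hP.exists_ne_zero (X ⧸ M) (isSimpleModule_iff_isCoatom.2 hM)
  obtain ⟨g, rfl⟩ := hP.lift M.mkQ (Submodule.mkQ_surjective _) f
  refine ⟨i, g, fun hle => hf ?_⟩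
  ext x
  simpa using hle ⟨x, rfl⟩

lemma exists_isCoatom (Λ) [Ring Λ] (X : Type*) [AddCommGroup X] [Module Λ X] [Module.Finite Λ X]
    [Nontrivial X] : ∃ M : Submodule Λ X, IsCoatom M := by
  obtain ⟨M, hM, -⟩ := (eq_top_or_exists_le_coatom (⊥ : Submodule Λ X)).resolve_left bot_ne_top
  exact ⟨M, hM⟩

lemma IsCoverFamily.exists_hom_ne_zero (hP : IsCoverFamily P) [Module.Finite Λ X] [Nontrivial X] :
    ∃ i, ∃ f : P i →ₗ[Λ] X, f ≠ 0 := by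
  obtain ⟨M, hM⟩ := exists_isCoatom Λ X
  obtain ⟨i, f, hf⟩ := hP.exists_not_range_le hM
  exact ⟨i, f, by rintro rfl; simp at hf⟩

lemma IsCoverFamily.exists_hasTop (hP : IsCoverFamily P) [Module.Finite Λ X] [Nontrivial X]
    (hX : Uniserial Λ X) : ∃ i, HasTop P X i := by
  obtain ⟨M, hM⟩ := exists_isCoatom Λ X
  obtain ⟨i, f, hf⟩ := hP.exists_not_range_le hM
  exact ⟨i, f, LinearMap.range_eq_top.1 (by_contra fun h => hf (hX.le_of_isCoatom hM h))⟩

lemma IsCoverFamily.hasTop_unique (hP : IsCoverFamily P) [Nontrivial X] {i j : ι}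
    (hi : HasTop P X i) (hj : HasTop P X j) : i = j := by
  have := hP.finite_of_hasTop hi
  obtain ⟨M, hM⟩ := exists_isCoatom Λ X
  have hs := isSimpleModule_iff_isCoatom.2 hM
  have := IsSimpleModule.nontrivial Λ (X ⧸ M)
  obtain ⟨f, hf⟩ := hi.map M.mkQ (Submodule.mkQ_surjective _)
  obtain ⟨g, hg⟩ := hj.map M.mkQ (Submodule.mkQ_surjective _)
  refine hP.eq_of_ne_zero (X ⧸ M) hs i j f g ?_ ?_
  · rintro rfl
    obtain ⟨y, hy⟩ := exists_ne (0 : X ⧸ M)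
    obtain ⟨x, hx⟩ := hf y
    exact hy hx.symm
  · rintro rfl
    obtain ⟨y, hy⟩ := exists_ne (0 : X ⧸ M)
    obtain ⟨x, hx⟩ := hg y
    exact hy hx.symm

/-- A simple module onto which `X` maps nontrivially has the same top as `X`. -/
lemma HasTop.of_ne_zero {i : ι} (h : HasTop P X i) [IsSimpleModule Λ Y] (g : X →ₗ[Λ] Y)
    (hg : g ≠ 0) : HasTop P Y i :=
  h.map g (LinearMap.surjective_of_ne_zero hg)

variable (P) in
/-- `π` sends the top of each `P i` to the top of its radical (or fixes it if there is none). -/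
def IsNext (π : ι → ι) : Prop :=
  ∀ (i : ι) (M : Submodule Λ (P i)), IsCoatom M →
    (M = ⊥ → π i = i) ∧ (M ≠ ⊥ → HasTop P M (π i))

lemma IsCoverFamily.exists_isNext [IsArtinianRing Λ] (hP : IsCoverFamily P) :
    ∃ π, IsNext P π := by
  suffices h : ∀ i, ∃ j, ∀ M : Submodule Λ (P i), IsCoatom M →
      (M = ⊥ → j = i) ∧ (M ≠ ⊥ → HasTop P M j) by
    choose π hπ using h
    exact ⟨π, hπ⟩
  intro i
  have := hP.finite i
  have := hP.nontrivial i
  obtain ⟨M, hM⟩ := exists_isCoatom Λ (P i)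
  have huniq : ∀ M', IsCoatom M' → M' = M := fun M' hM' =>
    (hP.uniserial i).eq_of_isCoatom hM' hM
  by_cases h0 : M = ⊥
  · refine ⟨i, fun M' hM' => ⟨fun _ => rfl, fun h => absurd ((huniq M' hM').trans h0) h⟩⟩
  · have : Nontrivial M := Submodule.nontrivial_iff_ne_bot.2 h0
    obtain ⟨j, hj⟩ := hP.exists_hasTop
      ((hP.uniserial i).of_injective M.subtype M.subtype_injective)
    refine ⟨j, fun M' hM' => ?_⟩
    obtain rfl := huniq M' hM'
    exact ⟨fun h => absurd h h0, fun _ => hj⟩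

variable {π : ι → ι}

lemma IsNext.hasTop_of_isCoatom (hπ : IsNext P π) {i : ι} (hX : HasTop P X i)
    {M : Submodule Λ X} (hM : IsCoatom M) (h0 : M ≠ ⊥) : HasTop P M (π i) := by
  obtain ⟨f, hf⟩ := hX
  have hc : IsCoatom (M.comap f) := by
    have := (Submodule.isCoatom_comap_iff hf).2 hM
    exact this
  let g : M.comap f →ₗ[Λ] M := f.restrict fun x hx => hx
  have hg : Function.Surjective g := by
    rintro ⟨y, hy⟩
    obtain ⟨x, rfl⟩ := hf y
    exact ⟨⟨x, hy⟩, rfl⟩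
  refine ((hπ i _ hc).2 fun hb => h0 ?_).map g hg
  rw [← Submodule.map_comap_eq_of_surjective hf M, hb, Submodule.map_bot]

/-- The top of a submodule of colength `a`. -/
lemma IsNext.hasTop_iterate [IsArtinianRing Λ] (hP : IsCoverFamily P) (hπ : IsNext P π) (a : ℕ) :
    ∀ {X Y : Type u} [AddCommGroup X] [Module Λ X] [AddCommGroup Y] [Module Λ Y] {i : ι}
      (_ : HasTop P X i) [Nontrivial Y] (f : Y →ₗ[Λ] X) (_ : Function.Injective f)
      (_ : len Λ X = len Λ Y + a), HasTop P Y (π^[a] i) := by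
  induction a with
  | zero =>
    intro X Y _ _ _ _ i hX _ f hf h
    have := hP.finite_of_hasTop hX
    have hs := surjective_of_len_eq f hf h
    exact hX.map (LinearEquiv.ofBijective f ⟨hf, hs⟩).symm.toLinearMap (LinearEquiv.surjective _)
  | succ a ih =>
    intro X Y _ _ _ _ i hX _ f hf h
    have := hP.finite_of_hasTop hX
    have hne : LinearMap.range f ≠ ⊤ := fun htop => by
      have := len_le_of_surjective (LinearEquiv.ofBijective f
        ⟨hf, LinearMap.range_eq_top.1 htop⟩).symm.toLinearMap (LinearEquiv.surjective _)
      have := len_le_of_injective f hf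
      have := len_eq_of_linearEquiv (LinearEquiv.ofBijective f
        ⟨hf, LinearMap.range_eq_top.1 htop⟩)
      omega
    obtain ⟨M, hM, hle⟩ := (eq_top_or_exists_le_coatom (LinearMap.range f)).resolve_left hne
    have h0 : M ≠ ⊥ := by
      rintro rfl
      obtain ⟨y, hy⟩ := exists_ne (0 : Y)
      have : f y = 0 := hle ⟨y, rfl⟩
      exact hy (hf (this.trans (map_zero f).symm))
    have hlen := len_eq_add_one_of_isCoatom hM
    exact ih (hπ.hasTop_of_isCoatom hX hM h0)
      (f.codRestrict M fun y => hle ⟨y, rfl⟩)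
      (fun a b hab => hf (congrArg Subtype.val hab)) (by omega)

/-- The kernel of the cover of the radical is nonzero. -/
lemma IsCoverFamily.not_injective [IsArtinianRing Λ] (hP : IsCoverFamily P) {i j : ι}
    {M : Submodule Λ (P i)} (hM : IsCoatom M) (f : P j →ₗ[Λ] M) (hf : Function.Surjective f) :
    ¬ Function.Injective f := by
  intro hinj
  let e := LinearEquiv.ofBijective f ⟨hinj, hf⟩
  have := hP.nontrivial j
  have : Nontrivial M := e.symm.toEquiv.nontrivial
  obtain ⟨r, hr⟩ := hP.extend M.subtype M.subtype_injective e.symm.toLinearMap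
  have hs := (hP.uniserial i).surjective_of_comp_eq_id (e.toLinearMap ∘ₗ r) M.subtype (by
    rw [LinearMap.comp_assoc, hr]; ext x; simp)
  exact hM.1 (by rw [← Submodule.range_subtype M, LinearMap.range_eq_top.2 hs])

lemma IsCoverFamily.len_le_next [IsArtinianRing Λ] (hP : IsCoverFamily P) (hπ : IsNext P π)
    (i : ι) : len Λ (P i) ≤ len Λ (P (π i)) := by
  have := hP.finite i
  have := hP.nontrivial i
  have := hP.finite (π i)
  obtain ⟨M, hM⟩ := exists_isCoatom Λ (P i)
  by_cases h0 : M = ⊥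
  · rw [(hπ i M hM).1 h0]
  · obtain ⟨f, hf⟩ := (hπ i M hM).2 h0
    have h1 := hP.not_injective hM f hf
    have h2 := len_le_of_surjective f hf
    have h3 := len_eq_add_one_of_isCoatom hM
    by_contra! hlt
    exact h1 (injective_of_len_eq f hf (by omega))

/-- A surjection between members of a cover family is an equality of indices. -/
lemma IsCoverFamily.eq_of_surjective (hP : IsCoverFamily P) {i j : ι} (f : P i →ₗ[Λ] P j)
    (hf : Function.Surjective f) : i = j := by
  have := hP.nontrivial j
  exact hP.hasTop_unique (X := P j) ⟨f, hf⟩ ⟨LinearMap.id, Function.surjective_id⟩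

lemma IsCoverFamily.eq_of_surjective_coatom (hP : IsCoverFamily P) {i j : ι}
    {M : Submodule Λ (P i)} {N : Submodule Λ (P j)} (hM : IsCoatom M) (hN : IsCoatom N)
    (hM0 : M ≠ ⊥) (h : N →ₗ[Λ] M) (hh : Function.Surjective h) : i = j := by
  obtain ⟨g, hg⟩ := hP.extend N.subtype N.subtype_injective (M.subtype ∘ₗ h)
  have hg' : ∀ x : N, g x = h x := fun x => LinearMap.congr_fun hg x
  by_cases hs : Function.Surjective g
  · exact (hP.eq_of_surjective g hs).symm
  · exfalso
    have hle : LinearMap.range g ≤ M :=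
      (hP.uniserial i).le_of_isCoatom hM fun h => hs (LinearMap.range_eq_top.1 h)
    have htop : N ⊔ LinearMap.ker g = ⊤ := by
      rw [eq_top_iff]
      intro x _
      obtain ⟨y, hy⟩ := hh ⟨g x, hle ⟨x, rfl⟩⟩
      have : g x = g y := by rw [hg', hy]
      rw [← add_sub_cancel (y : P j) x]
      refine Submodule.add_mem_sup y.2 ?_
      rw [LinearMap.mem_ker, map_sub, this, sub_self]
    rcases hP.uniserial j N (LinearMap.ker g) with hNk | hkN
    · rw [sup_eq_right.2 hNk] at htop
      apply hM0
      rw [eq_bot_iff]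
      intro y hy
      obtain ⟨x, hx⟩ := hh ⟨y, hy⟩
      have h1 := hg' x
      rw [hx] at h1
      have h2 : (x : P j) ∈ LinearMap.ker g := htop ▸ Submodule.mem_top
      rw [LinearMap.mem_ker] at h2
      exact h1.symm.trans h2
    · rw [sup_eq_left.2 hkN] at htop
      exact hN.1 htop

lemma IsCoverFamily.next_injective [IsArtinianRing Λ] (hP : IsCoverFamily P) (hπ : IsNext P π) :
    Function.Injective π := by
  have key : ∀ {i j : ι} {M : Submodule Λ (P i)} {N : Submodule Λ (P j)}, IsCoatom M →
      IsCoatom N → M = ⊥ → N ≠ ⊥ → π i ≠ π j := by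
    intro i j M N hM hN hM0 hN0 hij
    have hN' := (hπ j N hN).2 hN0
    rw [← hij, (hπ i M hM).1 hM0] at hN'
    obtain ⟨f, hf⟩ := hN'
    refine hP.not_injective hN f hf ?_
    rw [← LinearMap.ker_eq_bot]
    have hlt : LinearMap.ker f ≠ ⊤ := by
      intro htop
      rw [LinearMap.ker_eq_top] at htop
      subst htop
      apply hN0
      rw [eq_bot_iff]
      intro y hy
      obtain ⟨x, hx⟩ := hf ⟨y, hy⟩
      exact (congrArg Subtype.val hx).symm
    exact eq_bot_iff.2 (hM0 ▸ (hP.uniserial i).le_of_isCoatom hM hlt)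
  intro i j hij
  have := hP.finite i
  have := hP.nontrivial i
  have := hP.finite j
  have := hP.nontrivial j
  obtain ⟨M, hM⟩ := exists_isCoatom Λ (P i)
  obtain ⟨N, hN⟩ := exists_isCoatom Λ (P j)
  by_cases hM0 : M = ⊥ <;> by_cases hN0 : N = ⊥
  · rwa [(hπ i M hM).1 hM0, (hπ j N hN).1 hN0] at hij
  · exact absurd hij (key hM hN hM0 hN0)
  · exact absurd hij.symm (key hN hM hN0 hM0)
  · obtain ⟨f, hf⟩ := (hπ i M hM).2 hM0
    have hN' := (hπ j N hN).2 hN0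
    rw [← hij] at hN'
    obtain ⟨g, hg⟩ := hN'
    have factor : ∀ {A B : Type u} [AddCommGroup A] [Module Λ A] [AddCommGroup B] [Module Λ B]
        (a : P (π i) →ₗ[Λ] A) (b : P (π i) →ₗ[Λ] B), Function.Surjective a →
        Function.Surjective b → LinearMap.ker a ≤ LinearMap.ker b →
        ∃ h : A →ₗ[Λ] B, Function.Surjective h := by
      intro A B _ _ _ _ a b ha hb hab
      refine ⟨(Submodule.liftQ _ b hab) ∘ₗ (a.quotKerEquivOfSurjective ha).symm.toLinearMap, ?_⟩
      rw [LinearMap.coe_comp]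
      refine Function.Surjective.comp ?_ (LinearEquiv.surjective _)
      rw [← LinearMap.range_eq_top, Submodule.range_liftQ, LinearMap.range_eq_top.2 hb]
    rcases hP.uniserial (π i) (LinearMap.ker f) (LinearMap.ker g) with h | h
    · obtain ⟨h, hh⟩ := factor f g hf hg h
      exact (hP.eq_of_surjective_coatom hN hM hN0 h hh).symm
    · obtain ⟨h, hh⟩ := factor g f hg hf h
      exact hP.eq_of_surjective_coatom hM hN hM0 h hh

end CoverFamily


section Connected

variable {Λ} {ι : Type*} {P : ι → ModuleCat.{u} Λ} {X Y : Type u} [AddCommGroup X] [Module Λ X]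
  [AddCommGroup Y] [Module Λ Y]

variable (P) in
/-- No nonzero map from `P j` with `j ∈ I` takes values in `N`. -/
def Avoids (I : Set ι) (N : Submodule Λ X) : Prop :=
  ∀ j ∈ I, ∀ f : P j →ₗ[Λ] X, LinearMap.range f ≤ N → f = 0

lemma Avoids.map (hP : IsCoverFamily P) {I : Set ι} {N : Submodule Λ X} (h : Avoids P I N)
    (g : X →ₗ[Λ] Y) : Avoids P I (N.map g) := by
  intro j hj f hf
  let g' : N →ₗ[Λ] N.map g := g.restrict fun x hx => Submodule.mem_map_of_mem hx
  have hg' : Function.Surjective g' := by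
    rintro ⟨_, x, hx, rfl⟩
    exact ⟨⟨x, hx⟩, rfl⟩
  obtain ⟨l, hl⟩ := hP.lift g' hg' (f.codRestrict _ fun x => hf ⟨x, rfl⟩)
  have h0 : N.subtype ∘ₗ l = 0 := h j hj _ (by
    rintro _ ⟨x, rfl⟩
    exact (l x).2)
  ext x
  have h1 : f x = g (l x) := (congrArg Subtype.val (LinearMap.congr_fun hl x)).symm
  have h2 : (l x : X) = 0 := LinearMap.congr_fun h0 x
  rw [h1, h2, map_zero, LinearMap.zero_apply]

lemma Avoids.sSup (hP : IsCoverFamily P) {I : Set ι} {S : Set (Submodule Λ X)}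
    (h : ∀ N ∈ S, Avoids P I N) : Avoids P I (sSup S) := by
  classical
  intro j hj f hf
  let q : (Π₀ N : S, (N : Submodule Λ X)) →ₗ[Λ] X :=
    DFinsupp.lsum ℕ fun N : S => (N : Submodule Λ X).subtype
  have hq : LinearMap.range q = SupSet.sSup S := by
    rw [sSup_eq_iSup']
    exact (Submodule.iSup_eq_range_dfinsupp_lsum _).symm
  obtain ⟨l, hl⟩ := hP.lift q.rangeRestrict q.surjective_rangeRestrict
    (f.codRestrict _ fun x => hq ▸ hf ⟨x, rfl⟩)
  have hl0 : l = 0 := by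
    ext x N
    have h0 : (N : Submodule Λ X).subtype ∘ₗ DFinsupp.lapply N ∘ₗ l = 0 := by
      refine h N N.2 j hj _ ?_
      rintro _ ⟨x, rfl⟩
      exact (l x N).2
    exact LinearMap.congr_fun h0 x
  ext x
  have h1 : f x = q (l x) := (congrArg Subtype.val (LinearMap.congr_fun hl x)).symm
  rw [h1, hl0, LinearMap.zero_apply, map_zero, LinearMap.zero_apply]

/-- Over a connected ring, a cover family has no nontrivial decomposition into two orthogonal
parts. -/
lemma IsCoverFamily.eq_empty_or_univ [IsArtinianRing Λ] (hP : IsCoverFamily P)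
    (hconn : ∀ e : Λ, IsIdempotentElem e → e ∈ Set.center Λ → e = 0 ∨ e = 1) (I : Set ι)
    (hI : ∀ j ∈ I, ∀ k ∉ I, (∀ f : P j →ₗ[Λ] P k, f = 0) ∧ ∀ f : P k →ₗ[Λ] P j, f = 0) :
    I = ∅ ∨ I = Set.univ := by
  let A : Submodule Λ Λ := sSup {N | Avoids P Iᶜ N}
  let B : Submodule Λ Λ := sSup {N | Avoids P I N}
  have hA : Avoids P Iᶜ A := Avoids.sSup hP fun N hN => hN
  have hB : Avoids P I B := Avoids.sSup hP fun N hN => hN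
  have two_sided : ∀ (J : Set ι) (x r : Λ), x ∈ sSup {N : Submodule Λ Λ | Avoids P J N} →
      x * r ∈ sSup {N : Submodule Λ Λ | Avoids P J N} := by
    intro J x r hx
    have h := (Avoids.sSup hP (I := J) (S := {N : Submodule Λ Λ | Avoids P J N})
      fun N hN => hN).map hP (LinearMap.toSpanSingleton Λ Λ r)
    exact le_sSup (show Submodule.map _ _ ∈ {N : Submodule Λ Λ | Avoids P J N} from h)
      ⟨x, hx, rfl⟩
  have hinf : A ⊓ B = ⊥ := by
    by_contra h0
    have : Nontrivial ↥(A ⊓ B) := Submodule.nontrivial_iff_ne_bot.2 h0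
    obtain ⟨i, f, hf⟩ := hP.exists_hom_ne_zero (X := ↥(A ⊓ B))
    have hr : LinearMap.range ((A ⊓ B).subtype ∘ₗ f) ≤ A ⊓ B := by
      rintro _ ⟨x, rfl⟩
      exact (f x).2
    have h1 : (A ⊓ B).subtype ∘ₗ f = 0 := by
      by_cases hi : i ∈ I
      · exact hB i hi _ (hr.trans inf_le_right)
      · exact hA i hi _ (hr.trans inf_le_left)
    apply hf
    ext x
    exact LinearMap.congr_fun h1 x
  have avoid_range : ∀ (J : Set ι) (i : ι) (f : P i →ₗ[Λ] Λ),
      (∀ k ∈ J, ∀ g : P k →ₗ[Λ] P i, g = 0) → Avoids P J (LinearMap.range f) := by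
    intro J i f h
    have h' : Avoids P J (⊤ : Submodule Λ (P i)) := fun k hk g _ => h k hk g
    rw [LinearMap.range_eq_map]
    exact h'.map hP f
  have hsup : A ⊔ B = ⊤ := by
    by_contra h0
    obtain ⟨M, hM, hle⟩ := (eq_top_or_exists_le_coatom (A ⊔ B)).resolve_left h0
    obtain ⟨i, f, hf⟩ := hP.exists_not_range_le hM
    apply hf
    by_cases hi : i ∈ I
    · exact (le_sSup (show _ ∈ {N | Avoids P Iᶜ N} from
        avoid_range _ i f fun k hk => (hI i hi k hk).2)).trans (le_sup_left.trans hle)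
    · exact (le_sSup (show _ ∈ {N | Avoids P I N} from
        avoid_range _ i f fun k hk => (hI k hk i hi).1)).trans (le_sup_right.trans hle)
  obtain ⟨a, ha, b, hb, hab⟩ := Submodule.mem_sup.1 (hsup ▸ Submodule.mem_top : (1 : Λ) ∈ A ⊔ B)
  have huniq : ∀ x ∈ A, x ∈ B → x = 0 := fun x h1 h2 => by
    have : x ∈ A ⊓ B := ⟨h1, h2⟩
    rwa [hinf] at this
  have hcomm : ∀ x, x * a = a * x := by
    intro x
    have h1 : x * a + x * b = a * x + b * x := by
      rw [← mul_add, ← add_mul, hab, mul_one, one_mul]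
    have h2 : x * a - a * x = b * x - x * b := by
      rw [sub_eq_sub_iff_add_eq_add, h1, add_comm]
    refine sub_eq_zero.1 (huniq _ (A.sub_mem (A.smul_mem x ha) (two_sided _ a x ha)) ?_)
    rw [h2]
    exact B.sub_mem (two_sided _ b x hb) (B.smul_mem x hb)
  have hidem : IsIdempotentElem a := by
    have h1 : a * b = 0 := huniq _ (two_sided _ a b ha) (B.smul_mem a hb)
    calc a * a = a * (a + b) := by rw [mul_add, h1, add_zero]
      _ = a := by rw [hab, mul_one]
  have hall : ∀ J : Set ι, (1 : Λ) ∈ sSup {N : Submodule Λ Λ | Avoids P J N} → J = ∅ := by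
    intro J h1
    rw [Set.eq_empty_iff_forall_notMem]
    intro j hj
    have := hP.nontrivial j
    have := hP.finite j
    obtain ⟨M, hM⟩ := exists_isCoatom Λ (P j)
    obtain ⟨x, hx⟩ : ∃ x, x ∉ M := by
      by_contra! h
      exact hM.1 (eq_top_iff.2 fun x _ => h x)
    have hs := isSimpleModule_iff_isCoatom.2 hM
    have hx0 : M.mkQ x ≠ 0 := by simpa using hx
    obtain ⟨l, hl⟩ := hP.lift (LinearMap.toSpanSingleton Λ _ (M.mkQ x))
      (IsSimpleModule.toSpanSingleton_surjective Λ hx0) M.mkQ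
    have htop : sSup {N : Submodule Λ Λ | Avoids P J N} = ⊤ := (Ideal.eq_top_iff_one _).2 h1
    have hl0 : l = 0 := Avoids.sSup hP (I := J) (S := {N : Submodule Λ Λ | Avoids P J N})
      (fun N hN => hN) j hj l (htop ▸ le_top)
    apply hx0
    rw [← hl, hl0, LinearMap.comp_zero, LinearMap.zero_apply]
  rcases hconn a hidem (Semigroup.mem_center_iff.2 hcomm) with h0 | h1
  · left
    rw [h0, zero_add] at hab
    exact hall I (hab ▸ hb)
  · right
    have := hall Iᶜ (h1 ▸ ha)
    rwa [Set.compl_empty_iff] at this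

variable {σ : Equiv.Perm ι}

lemma IsCoverFamily.sameCycle_of_ne_zero [IsArtinianRing Λ] (hP : IsCoverFamily P)
    (hσ : IsNext P σ) {i j : ι} (f : P i →ₗ[Λ] P j) (hf : f ≠ 0) : σ.SameCycle j i := by
  have := hP.finite j
  have hr0 : LinearMap.range f ≠ ⊥ := fun h => hf (LinearMap.range_eq_bot.1 h)
  have : Nontrivial (LinearMap.range f) := Submodule.nontrivial_iff_ne_bot.2 hr0
  have h1 : HasTop P (LinearMap.range f) i := ⟨f.rangeRestrict, f.surjective_rangeRestrict⟩
  have h2 := hσ.hasTop_iterate hP _ (X := P j) ⟨LinearMap.id, Function.surjective_id⟩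
    (LinearMap.range f).subtype (Submodule.subtype_injective _)
    (len_submodule_add_len_quotient _)
  have h3 := hP.hasTop_unique h1 h2
  refine ⟨(len Λ (P j ⧸ LinearMap.range f) : ℤ), ?_⟩
  rw [zpow_natCast, ← Equiv.Perm.iterate_eq_pow]
  exact h3.symm

lemma IsCoverFamily.sameCycle [IsArtinianRing Λ] (hP : IsCoverFamily P) (hσ : IsNext P σ)
    (hconn : ∀ e : Λ, IsIdempotentElem e → e ∈ Set.center Λ → e = 0 ∨ e = 1) (i j : ι) :
    σ.SameCycle i j := by
  have h := hP.eq_empty_or_univ hconn {j | σ.SameCycle i j} (by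
    refine fun j hj k hk => ⟨fun f => by_contra fun hf => hk ?_,
      fun f => by_contra fun hf => hk ?_⟩
    · exact hj.trans (hP.sameCycle_of_ne_zero hσ f hf).symm
    · exact hj.trans (hP.sameCycle_of_ne_zero hσ f hf))
  rcases h with h | h
  · exact absurd (Equiv.Perm.SameCycle.refl σ i) (Set.eq_empty_iff_forall_notMem.1 h i)
  · exact Set.eq_univ_iff_forall.1 h j

lemma IsCoverFamily.len_eq [IsArtinianRing Λ] [Fintype ι] (hP : IsCoverFamily P) (hσ : IsNext P σ)
    (hconn : ∀ e : Λ, IsIdempotentElem e → e ∈ Set.center Λ → e = 0 ∨ e = 1) (i j : ι) :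
    len Λ (P i) = len Λ (P j) := by
  have step : ∀ i, len Λ (P (σ i)) = len Λ (P i) := by
    have hsum : ∑ i, len Λ (P i) = ∑ i, len Λ (P (σ i)) :=
      (Equiv.sum_comp σ fun i => len Λ (P i)).symm
    have := (Finset.sum_eq_sum_iff_of_le fun i _ => hP.len_le_next hσ i).1 hsum
    exact fun i => (this i (Finset.mem_univ i)).symm
  have hpow : ∀ (a : ℕ) i, len Λ (P ((σ ^ a) i)) = len Λ (P i) := by
    intro a
    induction a with
    | zero => exact fun i => rfl
    | succ a ih => intro i; rw [pow_succ', Equiv.Perm.mul_apply, step, ih]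
  obtain ⟨a, -, ha⟩ := (hP.sameCycle hσ hconn i j).exists_pow_eq'
  rw [← ha, hpow]

end Connected

section Loewy

variable {Λ} {ι : Type*} {P : ι → ModuleCat.{u} Λ}

/-- The `r`-th power of the radical kills every module of length at most `r`. -/
lemma smul_eq_zero_of_mem_radPow [IsArtinianRing Λ] (r : ℕ) :
    ∀ {X : Type u} [AddCommGroup X] [Module Λ X] [Module.Finite Λ X], len Λ X ≤ r →
      ∀ y ∈ radPow Λ r, ∀ x : X, y • x = 0 := by
  induction r with
  | zero =>
    intro X _ _ _ h y _ x
    have := subsingleton_of_len (Nat.le_zero.1 h)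
    exact Subsingleton.elim _ _
  | succ r ih =>
    intro X _ _ _ h y hy x
    rcases subsingleton_or_nontrivial X with hX | hX
    · exact Subsingleton.elim _ _
    obtain ⟨N, hN⟩ := IsAtomic.exists_atom (Submodule Λ X)
    have hs : IsSimpleModule Λ N := isSimpleModule_iff_isAtom.2 hN
    have hl := len_submodule_add_len_quotient N
    rw [len_of_isSimpleModule Λ N] at hl
    rw [radPow] at hy
    induction hy using Submodule.span_induction with
    | mem y hy =>
      obtain ⟨a, ha, b, hb, rfl⟩ := hy
      have h1 := ih (X := X ⧸ N) (by omega) b hb (N.mkQ x)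
      have h2 : b • x ∈ N := by
        rw [← map_smul] at h1
        exact (Submodule.Quotient.mk_eq_zero N).1 h1
      have h3 := Module.mem_annihilator.1 (IsSemisimpleModule.jacobson_le_annihilator Λ N
        (Ideal.jacobson_bot (R := Λ) ▸ ha)) ⟨b • x, h2⟩
      rw [mul_smul]
      exact congrArg Subtype.val h3
    | zero => exact zero_smul _ _
    | add y z _ _ h1 h2 => rw [add_smul, h1, h2, add_zero]
    | smul c y _ h1 => rw [smul_assoc, h1, smul_zero]

variable {X : Type*} [AddCommGroup X] [Module Λ X]

lemma isSemisimpleModule_of_jacobson_le_annihilator [IsArtinianRing Λ]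
    (h : Ring.jacobson Λ ≤ Module.annihilator Λ X) : IsSemisimpleModule Λ X := by
  have h' : Module.IsTorsionBySet Λ X (Ring.jacobson Λ) :=
    (Module.isTorsionBySet_iff_subset_annihilator _ _).2 h
  let _ := h'.module
  exact (h'.semilinearMap.isSemisimpleModule_iff_of_bijective Function.bijective_id).2
    inferInstance

lemma Uniserial.len_le_one [IsSemisimpleModule Λ X] (h : Uniserial Λ X) : len Λ X ≤ 1 := by
  rcases subsingleton_or_nontrivial X with hX | hX
  · simp [len]
  · have : IsSimpleModule Λ X := by
      refine (isSimpleModule_iff Λ X).2 ⟨fun N => ?_⟩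
      obtain ⟨C, hC⟩ := exists_isCompl N
      rcases h N C with hle | hle
      · exact Or.inl (hC.disjoint.eq_bot_of_le hle)
      · have := hC.sup_eq_top
        exact Or.inr (by rwa [sup_eq_left.2 hle] at this)
    rw [len_of_isSimpleModule]

/-- A uniserial module killed by the `r`-th power of the radical has length at most `r`. -/
lemma Uniserial.len_le_of_radPow [IsArtinianRing Λ] (r : ℕ) :
    ∀ {X : Type u} [AddCommGroup X] [Module Λ X] [Module.Finite Λ X], Uniserial Λ X →
      (∀ y ∈ radPow Λ r, ∀ x : X, y • x = 0) → len Λ X ≤ r := by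
  induction r with
  | zero =>
    intro X _ _ _ _ h
    have : Subsingleton X := ⟨fun x y => by
      rw [← one_smul Λ x, ← one_smul Λ y, h 1 Submodule.mem_top, h 1 Submodule.mem_top]⟩
    simp [len]
  | succ r ih =>
    intro X _ _ _ hX h
    let T : Submodule Λ X :=
      { carrier := {x | ∀ a ∈ Ring.jacobson Λ, a • x = 0}
        zero_mem' := fun a _ => smul_zero a
        add_mem' := fun hx hy a ha => by rw [smul_add, hx a ha, hy a ha, add_zero]
        smul_mem' := fun c x hx a ha => by
          rw [← mul_smul]
          exact hx _ (Ideal.mul_mem_right c _ ha) }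
    have : IsSemisimpleModule Λ T := isSemisimpleModule_of_jacobson_le_annihilator fun a ha =>
      Module.mem_annihilator.2 fun x => Subtype.ext (x.2 a ha)
    have h1 := (hX.of_injective T.subtype T.subtype_injective).len_le_one
    have h2 := ih (X := X ⧸ T) (hX.of_surjective T.mkQ T.mkQ_surjective) (by
      intro b hb x
      obtain ⟨x, rfl⟩ := T.mkQ_surjective x
      rw [← map_smul]
      refine (Submodule.Quotient.mk_eq_zero T).2 fun a ha => ?_
      rw [← mul_smul]
      exact h _ (Submodule.subset_span ⟨a, (Ideal.jacobson_bot (R := Λ)).symm ▸ ha, b, hb, rfl⟩) x)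
    have h3 := len_submodule_add_len_quotient T
    omega

/-- If all members of a cover family have length `c`, then `c` is the Loewy length. -/
lemma IsCoverFamily.radPow_eq_bot_iff [IsArtinianRing Λ] [Nonempty ι] (hP : IsCoverFamily P)
    {c : ℕ} (hc : ∀ i, len Λ (P i) = c) (r : ℕ) : radPow Λ r = ⊥ ↔ c ≤ r := by
  constructor
  · intro h
    obtain ⟨i⟩ := ‹Nonempty ι›
    have := hP.finite i
    rw [← hc i]
    refine (hP.uniserial i).len_le_of_radPow r fun y hy x => ?_
    rw [h, Submodule.mem_bot] at hy
    rw [hy, zero_smul]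
  · intro h
    rw [eq_bot_iff]
    intro y hy
    have htop : (⨆ q : Σ i, P i →ₗ[Λ] Λ, LinearMap.range q.2) = ⊤ := by
      by_contra h0
      obtain ⟨M, hM, hle⟩ := (eq_top_or_exists_le_coatom _).resolve_left h0
      obtain ⟨i, f, hf⟩ := hP.exists_not_range_le hM
      exact hf ((le_iSup (fun q : Σ i, P i →ₗ[Λ] Λ => LinearMap.range q.2) ⟨i, f⟩).trans hle)
    have hkill : ∀ x : Λ, y • x = 0 := by
      intro x
      have hx : x ∈ ⨆ q : Σ i, P i →ₗ[Λ] Λ, LinearMap.range q.2 := htop ▸ Submodule.mem_top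
      induction hx using Submodule.iSup_induction' with
      | mem q x hx =>
        obtain ⟨z, rfl⟩ := hx
        have := hP.finite q.1
        rw [← map_smul, smul_eq_zero_of_mem_radPow r ((hc q.1).trans_le h) y hy, map_zero]
      | zero => exact smul_zero y
      | add x z _ _ h1 h2 => rw [smul_add, h1, h2, add_zero]
    simpa using hkill 1

end Loewy


section Existence

variable {Λ} {X Y : Type u} [AddCommGroup X] [Module Λ X] [AddCommGroup Y] [Module Λ Y]

lemma injective_of_retract [Module.Injective Λ X] (i : Y →ₗ[Λ] X) (r : X →ₗ[Λ] Y)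
    (h : r ∘ₗ i = LinearMap.id) : Module.Injective Λ Y where
  out A B _ _ _ _ f hf g := by
    obtain ⟨l, hl⟩ := Module.Injective.extension_property Λ X A B f hf (i ∘ₗ g)
    refine ⟨r ∘ₗ l, fun x => ?_⟩
    have h1 : l (f x) = i (g x) := LinearMap.congr_fun hl x
    rw [LinearMap.comp_apply, h1]
    exact LinearMap.congr_fun h (g x)

/-- Over a self-injective ring, finitely generated projective modules are injective. -/
lemma injective_of_projective [Module.Injective Λ Λ] [Module.Finite Λ X] [Module.Projective Λ X] :
    Module.Injective Λ X := by
  obtain ⟨m, f, hf⟩ := Module.Finite.exists_fin' Λ X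
  obtain ⟨s, hs⟩ := Module.projective_lifting_property f LinearMap.id hf
  have : Module.Injective Λ (Fin m → Λ) := Module.Injective.pi Λ (fun _ => Λ)
  exact injective_of_retract s f hs

/-- A projective module of minimal length with a nonzero map to a fixed module is
indecomposable. -/
lemma indec_of_minimal [IsArtinianRing Λ] {Q : ModuleCat.{u} Λ} [Module.Finite Λ Q]
    [Module.Projective Λ Q] (f : Q →ₗ[Λ] X) (hf : f ≠ 0)
    (hmin : ∀ (A : Type u) [AddCommGroup A] [Module Λ A] [Module.Finite Λ A]
      [Module.Projective Λ A] (g : A →ₗ[Λ] X), g ≠ 0 → len Λ Q ≤ len Λ A) :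
    Indec Λ Q := by
  have key : ∀ {A B : Type u} [AddCommGroup A] [Module Λ A] [AddCommGroup B] [Module Λ B]
      (a : Q →ₗ[Λ] A) (i : A →ₗ[Λ] Q) (b : Q →ₗ[Λ] B) (j : B →ₗ[Λ] Q),
      a ∘ₗ i = LinearMap.id → b ∘ₗ j = LinearMap.id → b ∘ₗ i = 0 → f ∘ₗ i ≠ 0 →
      Subsingleton B := by
    intro A B _ _ _ _ a i b j hai hbj hbi hfi
    have ha : Function.Surjective a := fun x => ⟨i x, LinearMap.congr_fun hai x⟩
    have : Module.Finite Λ A := Module.Finite.of_surjective a ha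
    have : Module.Projective Λ A := Module.Projective.of_split i a hai
    have hinj := injective_of_len_eq a ha
      (le_antisymm (hmin A _ hfi) (len_le_of_surjective a ha))
    have h0 : ∀ y, y = (0 : B) := fun y => by
      have h1 : j y = i (a (j y)) := hinj (LinearMap.congr_fun hai (a (j y))).symm
      have h2 : b (j y) = y := LinearMap.congr_fun hbj y
      rw [← h2, h1]
      exact LinearMap.congr_fun hbi _
    exact ⟨fun x y => (h0 x).trans (h0 y).symm⟩
  refine ⟨fun h => hf ?_, ?_⟩
  · have := ModuleCat.subsingleton_of_isZero h
    exact LinearMap.ext fun x => by rw [Subsingleton.elim x 0, map_zero, map_zero]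
  · rintro A B ⟨e⟩
    have h1 : (e.hom ≫ biprod.fst).hom ∘ₗ (biprod.inl ≫ e.inv).hom = LinearMap.id := by
      rw [← ModuleCat.hom_comp, ← ModuleCat.hom_id]
      simp only [Category.assoc, Iso.inv_hom_id_assoc, biprod.inl_fst]
    have h2 : (e.hom ≫ biprod.snd).hom ∘ₗ (biprod.inr ≫ e.inv).hom = LinearMap.id := by
      rw [← ModuleCat.hom_comp, ← ModuleCat.hom_id]
      simp only [Category.assoc, Iso.inv_hom_id_assoc, biprod.inr_snd]
    have h3 : (e.hom ≫ biprod.snd).hom ∘ₗ (biprod.inl ≫ e.inv).hom = 0 := by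
      rw [← ModuleCat.hom_comp, ← ModuleCat.hom_zero]
      simp only [Category.assoc, Iso.inv_hom_id_assoc, biprod.inl_snd]
    have h4 : (e.hom ≫ biprod.fst).hom ∘ₗ (biprod.inr ≫ e.inv).hom = 0 := by
      rw [← ModuleCat.hom_comp, ← ModuleCat.hom_zero]
      simp only [Category.assoc, Iso.inv_hom_id_assoc, biprod.inr_fst]
    by_cases hA : f ∘ₗ (biprod.inl ≫ e.inv).hom = 0
    · by_cases hB : f ∘ₗ (biprod.inr ≫ e.inv).hom = 0
      · exfalso
        apply hf
        have h5 : e.hom ≫ biprod.fst ≫ biprod.inl ≫ e.inv +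
            e.hom ≫ biprod.snd ≫ biprod.inr ≫ e.inv = 𝟙 Q := by
          have := congrArg (fun t => e.hom ≫ t ≫ e.inv) (biprod.total (X := A) (Y := B))
          simpa only [Preadditive.add_comp, Preadditive.comp_add, Category.assoc, Category.id_comp,
            Iso.hom_inv_id] using this
        ext x
        have h6 := LinearMap.congr_fun (congrArg ModuleCat.Hom.hom h5) x
        have h7 : x = (biprod.inl ≫ e.inv).hom ((e.hom ≫ biprod.fst).hom x) +
            (biprod.inr ≫ e.inv).hom ((e.hom ≫ biprod.snd).hom x) := by
          exact h6.symm
        rw [h7, map_add]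
        have h8 := LinearMap.congr_fun hA ((e.hom ≫ biprod.fst).hom x)
        have h9 := LinearMap.congr_fun hB ((e.hom ≫ biprod.snd).hom x)
        rw [LinearMap.comp_apply] at h8 h9
        rw [h8, h9, LinearMap.zero_apply, LinearMap.zero_apply, LinearMap.zero_apply, add_zero]
      · left
        have := key _ _ _ _ h2 h1 h4 hB
        exact ModuleCat.isZero_of_subsingleton A
    · right
      have := key _ _ _ _ h1 h2 h3 hA
      exact ModuleCat.isZero_of_subsingleton B

/-- Every simple module is covered by an indecomposable projective module. -/
lemma exists_indec_projective [IsArtinianRing Λ] [IsSimpleModule Λ X] :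
    ∃ Q : ModuleCat.{u} Λ, Module.Finite Λ Q ∧ Module.Projective Λ Q ∧ Indec Λ Q ∧
      ∃ f : Q →ₗ[Λ] X, f ≠ 0 := by
  classical
  have hex : ∃ l : ℕ, ∃ Q : ModuleCat.{u} Λ, Module.Finite Λ Q ∧ Module.Projective Λ Q ∧
      (∃ f : Q →ₗ[Λ] X, f ≠ 0) ∧ len Λ Q = l := by
    have := IsSimpleModule.nontrivial Λ X
    obtain ⟨x, hx⟩ := exists_ne (0 : X)
    refine ⟨_, ModuleCat.of Λ Λ, inferInstanceAs (Module.Finite Λ Λ),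
      inferInstanceAs (Module.Projective Λ Λ), ⟨LinearMap.toSpanSingleton Λ X x, fun h => hx ?_⟩,
      rfl⟩
    simpa using LinearMap.congr_fun h (1 : Λ)
  obtain ⟨Q, hfin, hproj, ⟨f, hf⟩, hl⟩ := Nat.find_spec hex
  refine ⟨Q, hfin, hproj, indec_of_minimal f hf ?_, f, hf⟩
  intro A _ _ _ _ g hg
  rw [hl]
  exact Nat.find_min' hex ⟨ModuleCat.of Λ A, ‹_›, ‹_›, ⟨g, hg⟩, rfl⟩

/-- Two simple quotients of a uniserial module are isomorphic. -/
lemma Uniserial.nonempty_linearEquiv {Q : Type*} [AddCommGroup Q] [Module Λ Q]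
    (hQ : Uniserial Λ Q) [IsSimpleModule Λ X] [IsSimpleModule Λ Y] {f : Q →ₗ[Λ] X}
    {g : Q →ₗ[Λ] Y} (hf : f ≠ 0) (hg : g ≠ 0) : Nonempty (X ≃ₗ[Λ] Y) := by
  have hf' := LinearMap.surjective_of_ne_zero hf
  have hg' := LinearMap.surjective_of_ne_zero hg
  have h := hQ.eq_of_isCoatom (LinearMap.isCoatom_ker_of_surjective hf')
    (LinearMap.isCoatom_ker_of_surjective hg')
  exact ⟨(f.quotKerEquivOfSurjective hf').symm ≪≫ₗ Submodule.quotEquivOfEq _ _ h ≪≫ₗ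
    g.quotKerEquivOfSurjective hg'⟩

lemma IsSelfInjNakayama.isArtinianRing {k : Type u} [Field k] [Algebra k Λ] {n m : ℕ}
    (hΛ : IsSelfInjNakayama k Λ n m) : IsArtinianRing Λ := by
  have := hΛ.findim
  exact IsArtinianRing.of_finite k Λ

lemma IsSelfInjNakayama.exists_isCoverFamily {k : Type u} [Field k] [Algebra k Λ] {n m : ℕ}
    (hΛ : IsSelfInjNakayama k Λ n m) : ∃ P : Fin n → ModuleCat.{u} Λ, IsCoverFamily P := by
  have := hΛ.isArtinianRing
  have hinj : Module.Injective Λ Λ :=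
    have := hΛ.selfinj
    Module.injective_module_of_injective_object Λ Λ
  obtain ⟨S, hS, hSinj, hSsurj⟩ := hΛ.simples
  choose P hfin hproj hindec f hf using fun i =>
    have := hS i
    exists_indec_projective (Λ := Λ) (X := S i)
  have huni : ∀ i, Uniserial Λ (P i) := fun i => hΛ.uniserial _ (hfin i) (hindec i)
  refine ⟨P, ⟨hproj, fun i => ?_, hfin, fun i => ?_, huni, ?_, ?_⟩⟩
  · have := hfin i
    have := hproj i
    exact injective_of_projective
  · by_contra h
    rw [not_nontrivial_iff_subsingleton] at h
    exact (hindec i).1 (ModuleCat.isZero_of_subsingleton _)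
  · intro T _ _ hT
    obtain ⟨i, ⟨e⟩⟩ := hSsurj (ModuleCat.of Λ T) hT
    refine ⟨i, e.toLinearEquiv.symm.toLinearMap ∘ₗ f i, fun h => hf i ?_⟩
    ext x
    have h1 := LinearMap.congr_fun h x
    exact e.toLinearEquiv.symm.injective (h1.trans (map_zero _).symm)
  · intro T _ _ hT i j a b ha hb
    have := hS i
    have := hS j
    obtain ⟨e₁⟩ := (huni i).nonempty_linearEquiv (hf i) ha
    obtain ⟨e₂⟩ := (huni j).nonempty_linearEquiv (hf j) hb
    exact hSinj i j ⟨(e₁ ≪≫ₗ e₂.symm).toModuleIso⟩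

end Existence

section Ext

variable {C : Type*} [Category C] [Abelian C] [HasExt.{u} C]

/-- Dimension shifting along a projective presentation. -/
lemma subsingleton_ext_shift {S : ShortComplex C} (hS : S.ShortExact) [Projective S.X₂] (Y : C)
    (r : ℕ) : Subsingleton (Abelian.Ext S.X₃ Y (r + 2)) ↔
      Subsingleton (Abelian.Ext S.X₁ Y (r + 1)) := by
  constructor
  · intro h
    refine subsingleton_of_forall_eq 0 fun x => ?_
    obtain ⟨y, rfl⟩ := Abelian.Ext.contravariant_sequence_exact₁ hS Y x
      (by omega : 1 + (r + 1) = r + 2) (Subsingleton.elim _ _)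
    rw [Abelian.Ext.eq_zero_of_projective y, Abelian.Ext.comp_zero]
  · intro h
    refine subsingleton_of_forall_eq 0 fun x => ?_
    obtain ⟨y, rfl⟩ := Abelian.Ext.contravariant_sequence_exact₃ hS Y x
      (Abelian.Ext.eq_zero_of_projective _) (by omega : 1 + (r + 1) = r + 2)
    rw [Subsingleton.elim y 0, Abelian.Ext.comp_zero]

lemma exists_extension_of_subsingleton_ext {S : ShortComplex C} (hS : S.ShortExact) {Y : C}
    (h : Subsingleton (Abelian.Ext S.X₃ Y 1)) (f : S.X₁ ⟶ Y) : ∃ g : S.X₂ ⟶ Y, S.f ≫ g = f := by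
  obtain ⟨y, hy⟩ := Abelian.Ext.contravariant_sequence_exact₁ hS Y (Abelian.Ext.mk₀ f)
      (by omega : 1 + 0 = 1) (Subsingleton.elim _ _)
  obtain ⟨g, rfl⟩ := (Abelian.Ext.mk₀_bijective _ _).2 y
  rw [Abelian.Ext.mk₀_comp_mk₀] at hy
  exact ⟨g, (Abelian.Ext.mk₀_bijective _ _).1 hy⟩

lemma subsingleton_ext_one {S : ShortComplex C} (hS : S.ShortExact) [Projective S.X₂] {Y : C}
    (h : ∀ f : S.X₁ ⟶ Y, f = 0) : Subsingleton (Abelian.Ext S.X₃ Y 1) := by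
  refine subsingleton_of_forall_eq 0 fun x => ?_
  obtain ⟨y, rfl⟩ := Abelian.Ext.contravariant_sequence_exact₃ hS Y x
    (Abelian.Ext.eq_zero_of_projective _) (by omega : 1 + 0 = 1)
  obtain ⟨f, rfl⟩ := (Abelian.Ext.mk₀_bijective _ _).2 y
  rw [h f, Abelian.Ext.mk₀_zero, Abelian.Ext.comp_zero]

end Ext

section Syzygy

variable {Λ} {ι : Type*} {P : ι → ModuleCat.{u} Λ} {σ : Equiv.Perm ι} {c : ℕ}
  {X Y S : ModuleCat.{u} Λ}

lemma IsCoverFamily.projective_obj (hP : IsCoverFamily P) (i : ι) : Projective (P i) :=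
  have := hP.projective i
  ModuleCat.projective_of_categoryTheory_projective (P i)

/-- The syzygy of a nonprojective module with top `i`. -/
lemma IsCoverFamily.exists_syzygy [IsArtinianRing Λ] (hP : IsCoverFamily P) (hσ : IsNext P σ)
    (hc : ∀ i, len Λ (P i) = c) {i : ι} (hX : HasTop P X i) (hlt : len Λ X < c) :
    ∃ (K : ModuleCat.{u} Λ) (a : K ⟶ P i) (b : P i ⟶ X) (w : a ≫ b = 0),
      (ShortComplex.mk a b w).ShortExact ∧ Nontrivial K ∧
        HasTop P K ((σ ^ len Λ X) i) ∧ len Λ K = c - len Λ X := by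
  obtain ⟨f, hf⟩ := hX
  have := hP.finite i
  have hl := len_ker_add_len f hf
  rw [hc i] at hl
  have : Nontrivial (LinearMap.ker f) := by
    by_contra h
    rw [not_nontrivial_iff_subsingleton] at h
    have : len Λ (LinearMap.ker f) = 0 := by simp [len]
    omega
  refine ⟨ModuleCat.of Λ (LinearMap.ker f), ModuleCat.ofHom (LinearMap.ker f).subtype,
    ModuleCat.ofHom f, f.shortComplexKer.zero, LinearMap.shortExact_shortComplexKer hf, this,
    ?_, ?_⟩
  · rw [← Equiv.Perm.iterate_eq_pow]
    exact hσ.hasTop_iterate hP _ (X := P i) ⟨LinearMap.id, Function.surjective_id⟩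
      (LinearMap.ker f).subtype (Submodule.subtype_injective _) (by rw [hc i]; exact hl)
  · change len Λ (LinearMap.ker f) = _
    omega

/-- A nonzero module maps nontrivially to a simple module with the same top. -/
lemma IsCoverFamily.exists_hom_of_hasTop (hP : IsCoverFamily P) {i : ι} {A B : Type u}
    [AddCommGroup A] [Module Λ A] [AddCommGroup B] [Module Λ B] [Nontrivial A]
    [IsSimpleModule Λ B] (hA : HasTop P A i) (hB : HasTop P B i) :
    ∃ f : A →ₗ[Λ] B, f ≠ 0 := by
  have := hP.finite_of_hasTop hA
  obtain ⟨M, hM⟩ := exists_isCoatom Λ A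
  have hs := isSimpleModule_iff_isCoatom.2 hM
  have := IsSimpleModule.nontrivial Λ (A ⧸ M)
  have := IsSimpleModule.nontrivial Λ B
  have ne_zero : ∀ {T : Type u} [AddCommGroup T] [Module Λ T] [Nontrivial T]
      (f : P i →ₗ[Λ] T), Function.Surjective f → f ≠ 0 := by
    rintro T _ _ _ f hf rfl
    obtain ⟨y, hy⟩ := exists_ne (0 : T)
    obtain ⟨x, hx⟩ := hf y
    exact hy hx.symm
  obtain ⟨f, hf⟩ := hA.map M.mkQ M.mkQ_surjective
  obtain ⟨g, hg⟩ := hB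
  obtain ⟨e⟩ := (hP.uniserial i).nonempty_linearEquiv (ne_zero f hf) (ne_zero g hg)
  refine ⟨e.toLinearMap ∘ₗ M.mkQ, ?_⟩
  rintro h
  obtain ⟨y, hy⟩ := exists_ne (0 : B)
  obtain ⟨x, rfl⟩ := e.surjective y
  obtain ⟨x, rfl⟩ := M.mkQ_surjective x
  exact hy (LinearMap.congr_fun h x)

variable [HasExt.{u} (ModuleCat.{u} Λ)]

/-- The even syzygies of a nonprojective module with top `i`, when taking two syzygies
shifts the top by one step. -/
lemma IsCoverFamily.exists_even_syzygy [IsArtinianRing Λ] (hP : IsCoverFamily P)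
    (hσ : IsNext P σ) (hc : ∀ i, len Λ (P i) = c) (hσc : ∀ i, (σ ^ c) i = σ i) {i : ι}
    (hX : HasTop P X i) (h0 : 0 < len Λ X) (hlt : len Λ X < c) (j : ℕ) :
    ∃ K : ModuleCat.{u} Λ, HasTop P K ((σ ^ j) i) ∧ len Λ K = len Λ X ∧
      ∀ (Y : ModuleCat.{u} Λ) (r : ℕ), Subsingleton (Abelian.Ext X Y (r + 1 + 2 * j)) ↔
        Subsingleton (Abelian.Ext K Y (r + 1)) := by
  induction j with
  | zero => exact ⟨X, hX, rfl, fun Y r => Iff.rfl⟩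
  | succ j ih =>
    obtain ⟨K, hK, hKl, hKe⟩ := ih
    obtain ⟨L, a, b, w, hS, -, hL, hLl⟩ := hP.exists_syzygy hσ hc hK (by omega)
    obtain ⟨M, a', b', w', hS', -, hM, hMl⟩ := hP.exists_syzygy hσ hc hL (by omega)
    refine ⟨M, ?_, by omega, fun Y r => ?_⟩
    · rw [hLl, ← Equiv.Perm.mul_apply, ← pow_add, Nat.sub_add_cancel (by omega), hσc,
        ← Equiv.Perm.mul_apply, ← pow_succ'] at hM
      exact hM
    · have : Projective (ShortComplex.mk a b w).X₂ := hP.projective_obj _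
      have : Projective (ShortComplex.mk a' b' w').X₂ := hP.projective_obj _
      have h1 := hKe Y (r + 2)
      have h2 := subsingleton_ext_shift hS Y (r + 1)
      have h3 := subsingleton_ext_shift hS' Y r
      rw [show r + 1 + 2 * (j + 1) = r + 2 + 1 + 2 * j by omega]
      exact h1.trans (h2.trans h3)

/-- First extensions by a simple module that is not the top of the syzygy vanish. -/
lemma IsCoverFamily.subsingleton_ext_one [IsArtinianRing Λ] (hP : IsCoverFamily P)
    (hσ : IsNext P σ) (hc : ∀ i, len Λ (P i) = c) {i j : ι} [IsSimpleModule Λ S]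
    (hS : HasTop P S i) (hY : HasTop P Y j) (hlt : len Λ Y < c)
    (hij : (σ ^ len Λ Y) j ≠ i) : Subsingleton (Abelian.Ext Y S 1) := by
  obtain ⟨K, a, b, w, hE, -, hK, -⟩ := hP.exists_syzygy hσ hc hY hlt
  have : Projective (ShortComplex.mk a b w).X₂ := hP.projective_obj _
  have := IsSimpleModule.nontrivial Λ S
  refine Rigidity.subsingleton_ext_one hE fun f => by_contra fun hf => hij ?_
  exact hP.hasTop_unique (hK.of_ne_zero f.hom fun h => hf (ModuleCat.hom_ext h)) hS

/-- A first extension that does not vanish: the socle of `X` is the top of the syzygy of `Y`. -/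
lemma IsCoverFamily.not_subsingleton_ext_one [IsArtinianRing Λ] (hP : IsCoverFamily P)
    (hσ : IsNext P σ) (hc : ∀ i, len Λ (P i) = c) {j : ι} (hX : HasTop P X (σ j))
    (hY : HasTop P Y j) (hlen : len Λ Y = len Λ X) (h0 : 0 < len Λ X) (hlt : len Λ X < c) :
    ¬ Subsingleton (Abelian.Ext Y X 1) := by
  intro hE
  obtain ⟨K, a, b, w, hS, hKnt, hK, hKl⟩ := hP.exists_syzygy hσ hc hY (by omega)
  have := hP.finite j
  have := hP.finite_of_hasTop hX
  have hXnt : Nontrivial X := by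
    by_contra h
    rw [not_nontrivial_iff_subsingleton] at h
    have : len Λ X = 0 := by simp [len]
    omega
  obtain ⟨N, hN⟩ := IsAtomic.exists_atom (Submodule Λ X)
  have : IsSimpleModule Λ N := isSimpleModule_iff_isAtom.2 hN
  have := IsSimpleModule.nontrivial Λ N
  have hNl := len_submodule_add_len_quotient N
  rw [len_of_isSimpleModule Λ N] at hNl
  have hNt := hσ.hasTop_iterate hP (len Λ (X ⧸ N)) hX N.subtype N.subtype_injective
    (by rw [len_of_isSimpleModule Λ N, hNl])
  rw [← Function.iterate_succ_apply, Equiv.Perm.iterate_eq_pow,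
    show (len Λ (X ⧸ N)).succ = len Λ Y by omega] at hNt
  obtain ⟨f, hf⟩ := hP.exists_hom_of_hasTop hK hNt
  obtain ⟨g, hg⟩ : ∃ g : P j ⟶ X, a ≫ g = ModuleCat.ofHom (N.subtype ∘ₗ f) :=
    exists_extension_of_subsingleton_ext hS hE _
  have hg' : ∀ x : K, g.hom (a.hom x) = f x := fun x =>
    LinearMap.congr_fun (congrArg ModuleCat.Hom.hom hg) x
  have ha : Function.Injective a.hom := hS.moduleCat_injective_f
  have hra : len Λ (LinearMap.range a.hom) = len Λ K :=
    (len_eq_of_linearEquiv (LinearEquiv.ofInjective a.hom ha)).symm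
  have h1 := len_ker_add_len g.hom.rangeRestrict g.hom.surjective_rangeRestrict
  have h2 := len_le_of_injective (LinearMap.range g.hom).subtype (Submodule.subtype_injective _)
  have h3 := hc j
  rw [LinearMap.ker_rangeRestrict] at h1
  have hnot : ¬ LinearMap.range a.hom ≤ LinearMap.ker g.hom := by
    intro hle
    apply hf
    ext x
    exact (hg' x).symm.trans (hle ⟨x, rfl⟩)
  have hle := (hP.uniserial j (LinearMap.range a.hom) (LinearMap.ker g.hom)).resolve_left hnot
  have := Module.Finite.of_injective (LinearMap.range a.hom).subtype
    (Submodule.subtype_injective _)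
  have hi := Submodule.inclusion_injective hle
  have h4 := len_le_of_injective _ hi
  refine hnot fun x hx => ?_
  obtain ⟨y, hy⟩ := surjective_of_len_eq _ hi (by omega) ⟨x, hx⟩
  have := y.2
  rwa [show (y : P j) = x from congrArg Subtype.val hy] at this

end Syzygy

section Nakayama

variable {Λ} {k : Type u} [Field k] [Algebra k Λ] {n m : ℕ}

/-- The indecomposable projective modules of a connected self-injective Nakayama algebra are
cyclically ordered, and all have length equal to the Loewy length. -/
lemma IsSelfInjNakayama.exists_cyclic (hΛ : IsSelfInjNakayama k Λ n m) (hn : 0 < n)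
    (hm : 0 < m) :
    ∃ (P : Fin n → ModuleCat.{u} Λ) (σ : Equiv.Perm (Fin n)), IsCoverFamily P ∧ IsNext P σ ∧
      (∀ i, len Λ (P i) = m) ∧ ∀ i a, (σ ^ a) i = i ↔ n ∣ a := by
  have := hΛ.isArtinianRing
  obtain ⟨P, hP⟩ := hΛ.exists_isCoverFamily
  obtain ⟨π, hπ⟩ := hP.exists_isNext
  have : Nonempty (Fin n) := ⟨⟨0, hn⟩⟩
  let σ : Equiv.Perm (Fin n) :=
    Equiv.ofBijective π (Finite.injective_iff_bijective.1 (hP.next_injective hπ))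
  have hσ : IsNext P σ := hπ
  refine ⟨P, σ, hP, hσ, ?_, fun i a => ?_⟩
  · have hc : ∀ i, len Λ (P i) = len Λ (P ⟨0, hn⟩) := fun i => hP.len_eq hσ hΛ.connected i _
    have h1 := (hP.radPow_eq_bot_iff hc m).1 hΛ.loewy_top
    have h2 := mt (hP.radPow_eq_bot_iff hc (m - 1)).2 hΛ.loewy_bot
    intro i
    rw [hc i]
    omega
  · have hcyc : σ.IsCycleOn (Finset.univ : Finset (Fin n)) :=
      ⟨by simp,
        fun i _ j _ => hP.sameCycle hσ hΛ.connected i j⟩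
    simpa using hcyc.pow_apply_eq (Finset.mem_univ i) (n := a)

end Nakayama

section RigidityDegree

variable {Λ} [HasExt.{u} (ModuleCat.{u} Λ)] {n : ℕ} {P : Fin n → ModuleCat.{u} Λ}
  {σ : Equiv.Perm (Fin n)} {X S : ModuleCat.{u} Λ}

lemma rigDeg_le_of_not_subsingleton {r : ℕ} (h : ¬ Subsingleton (Abelian.Ext X X (r + 1))) :
    rigDeg Λ X ≤ (r : ℕ∞) := by
  refine sSup_le ?_
  rintro _ ⟨s, rfl, -, hs⟩
  by_contra! hlt
  have hlt' : r < s := by exact_mod_cast hlt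
  exact h (hs (r + 1) (by omega) hlt')

lemma le_rigDeg {r : ℕ} (h : ∀ i, 1 ≤ i → i ≤ r → Subsingleton (Abelian.Ext X X i)) :
    (r : ℕ∞) ≤ rigDeg Λ X := by
  rcases Nat.eq_zero_or_pos r with rfl | hr
  · simp
  · exact le_sSup ⟨r, rfl, hr, h⟩

lemma IsCoverFamily.rigDeg_le [IsArtinianRing Λ] (hP : IsCoverFamily P) (hσ : IsNext P σ)
    (hc : ∀ i, len Λ (P i) = n + 1) (hn : 0 < n) (hord : ∀ i a, (σ ^ a) i = i ↔ n ∣ a)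
    {i : Fin n} (hX : HasTop P X i) (h0 : 0 < len Λ X) (hlt : len Λ X < n + 1) :
    rigDeg Λ X ≤ ((2 * n - 2 : ℕ) : ℕ∞) := by
  have hσn : ∀ i, (σ ^ n) i = i := fun i => (hord i n).2 dvd_rfl
  have hσc : ∀ i, (σ ^ (n + 1)) i = σ i := fun i => by
    rw [pow_succ, Equiv.Perm.mul_apply, hσn]
  refine rigDeg_le_of_not_subsingleton ?_
  obtain ⟨K, hK, hKl, hKe⟩ := hP.exists_even_syzygy hσ hc hσc hX h0 hlt (n - 1)
  rw [show 2 * n - 2 + 1 = 0 + 1 + 2 * (n - 1) by omega, hKe]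
  refine hP.not_subsingleton_ext_one hσ hc ?_ hK hKl h0 hlt
  rwa [← Equiv.Perm.mul_apply, ← pow_succ', Nat.sub_add_cancel hn, hσn]

lemma IsCoverFamily.subsingleton_ext_simple [IsArtinianRing Λ] (hP : IsCoverFamily P)
    (hσ : IsNext P σ) (hc : ∀ i, len Λ (P i) = n + 1)
    (hord : ∀ i a, (σ ^ a) i = i ↔ n ∣ a) [IsSimpleModule Λ S] {i : Fin n} (hS : HasTop P S i)
    {r : ℕ} (h1 : 1 ≤ r) (hr : r ≤ 2 * n - 2) : Subsingleton (Abelian.Ext S S r) := by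
  have hσn : ∀ i, (σ ^ n) i = i := fun i => (hord i n).2 dvd_rfl
  have hσc : ∀ i, (σ ^ (n + 1)) i = σ i := fun i => by
    rw [pow_succ, Equiv.Perm.mul_apply, hσn]
  have hSl := len_of_isSimpleModule Λ S
  have hne : ∀ j, j + 1 < n → (σ ^ (j + 1)) i ≠ i := fun j hj h =>
    absurd (Nat.le_of_dvd (by omega) ((hord i _).1 h)) (by omega)
  obtain ⟨j, rfl | rfl⟩ : ∃ j, r = 0 + 1 + 2 * j ∨ r = 1 + 1 + 2 * j :=
    ⟨(r - 1) / 2, by omega⟩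
  · obtain ⟨K, hK, hKl, hKe⟩ := hP.exists_even_syzygy hσ hc hσc hS (by omega) (by omega) j
    rw [hKe]
    refine hP.subsingleton_ext_one hσ hc hS hK (by omega) ?_
    rw [hKl, hSl, ← Equiv.Perm.mul_apply, ← pow_add, add_comm]
    exact hne j (by omega)
  · obtain ⟨K, hK, hKl, hKe⟩ := hP.exists_even_syzygy hσ hc hσc hS (by omega) (by omega) j
    rw [hKe]
    obtain ⟨L, a, b, w, hE, -, hL, hLl⟩ := hP.exists_syzygy hσ hc hK (by omega)
    have : Projective (ShortComplex.mk a b w).X₂ := hP.projective_obj _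
    refine (subsingleton_ext_shift hE S 0).2 ?_
    have hlt : len Λ L < n + 1 := by omega
    refine hP.subsingleton_ext_one hσ hc hS hL hlt ?_
    rw [hLl, ← Equiv.Perm.mul_apply, ← pow_add, Nat.sub_add_cancel (by omega), hσc,
      ← Equiv.Perm.mul_apply, ← pow_succ']
    exact hne j (by omega)

end RigidityDegree

/-- for `Λ = A_{n,n+1}`, the simple modules have rigidity degree `2n - 2`,
and every non-projective indecomposable has rigidity degree at most `2n - 2`. -/
theorem statement9 (k : Type u) [Field k] (Λ : Type u) [Ring Λ] [Algebra k Λ]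
    (n : ℕ) (hn : 0 < n)
    (hΛ : IsSelfInjNakayama k Λ n (n + 1))
    [HasExt.{u} (ModuleCat.{u} Λ)] :
    (∀ S : ModuleCat.{u} Λ, Module.Finite Λ S → IsSimpleModule Λ S →
      rigDeg Λ S = ((2 * n - 2 : ℕ) : ℕ∞)) ∧
    (∀ X : ModuleCat.{u} Λ, Module.Finite Λ X → Indec Λ X → ¬ Projective X →
      rigDeg Λ X ≤ ((2 * n - 2 : ℕ) : ℕ∞)) := by
  have := hΛ.isArtinianRing
  obtain ⟨P, σ, hP, hσ, hc, hord⟩ := hΛ.exists_cyclic hn (Nat.succ_pos n)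
  refine ⟨fun S hfin hS => ?_, fun X hfin hX hproj => ?_⟩
  · have hSl := len_of_isSimpleModule Λ S
    obtain ⟨i, f, hf⟩ := hP.exists_ne_zero S hS
    have hi : HasTop P S i := ⟨f, LinearMap.surjective_of_ne_zero hf⟩
    refine le_antisymm (hP.rigDeg_le hσ hc hn hord hi (by omega) (by omega)) (le_rigDeg ?_)
    exact fun r h1 hr => hP.subsingleton_ext_simple hσ hc hord hi h1 hr
  · have hnt : Nontrivial X := by
      by_contra h
      rw [not_nontrivial_iff_subsingleton] at h
      exact hX.1 (ModuleCat.isZero_of_subsingleton X)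
    obtain ⟨i, hi⟩ := hP.exists_hasTop (hΛ.uniserial X hfin hX)
    refine hP.rigDeg_le hσ hc hn hord hi len_pos ?_
    obtain ⟨f, hf⟩ := hi
    have := hP.finite i
    by_contra hlt
    have hinj := injective_of_len_eq f hf
      (le_antisymm (by rw [hc i]; omega) (len_le_of_surjective f hf))
    have hPi := hP.projective_obj i
    exact hproj (Projective.of_iso (LinearEquiv.ofBijective f ⟨hinj, hf⟩).toModuleIso hPi)

end Rigidity
end

section
/- Let Λ be a non-simple indecomposable self-injective algebra of finite representation type and M a generator-cogenerator of Λ. If add(M) contains a complete slice of the stable Auslander-Reiten quiver of Λ, then End_Λ(M) has finite global dimension. -/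
open CategoryTheory CategoryTheory.Limits Opposite

universe u

namespace Rigidity

variable (Λ : Type u) [Ring Λ]

/-- `A` and `B` lie in the same `τ`-orbit of the stable Auslander-Reiten quiver:
equivalence closure of "being the ends of an Auslander-Reiten sequence". -/
def SameTauOrbit (A B : ModuleCat.{u} Λ) : Prop :=
  Relation.EqvGen (fun X Z : ModuleCat.{u} Λ =>
    Nonempty (X ≅ Z) ∨ ∃ (Y : ModuleCat.{u} Λ) (f : X ⟶ Y) (g : Y ⟶ Z), IsARSeq Λ f g) A B

def IsSplitMonoMap {X Y : ModuleCat.{u} Λ} (f : X ⟶ Y) : Prop := ∃ r : Y ⟶ X, f ≫ r = 𝟙 X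

def IsSplitEpiMap {X Y : ModuleCat.{u} Λ} (f : X ⟶ Y) : Prop := ∃ s : Y ⟶ X, s ≫ f = 𝟙 Y

/-- An irreducible map. -/
def IsIrred {X Y : ModuleCat.{u} Λ} (f : X ⟶ Y) : Prop :=
  ¬ IsSplitMonoMap Λ f ∧ ¬ IsSplitEpiMap Λ f ∧
  ∀ (W : ModuleCat.{u} Λ) (g : X ⟶ W) (h : W ⟶ Y), g ≫ h = f →
    IsSplitMonoMap Λ g ∨ IsSplitEpiMap Λ h

/-- A complete slice of the stable Auslander-Reiten quiver: a set of non-projective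
indecomposables meeting every `τ`-orbit in exactly one isomorphism class, closed
sectionally under irreducible maps. -/
def IsCompleteSlice (S : Set (ModuleCat.{u} Λ)) : Prop :=
  (∀ X ∈ S, Module.Finite Λ X ∧ Indec Λ X ∧ ¬ Projective X) ∧
  (∀ X : ModuleCat.{u} Λ, Module.Finite Λ X → Indec Λ X → ¬ Projective X →
    ∃ Y ∈ S, SameTauOrbit Λ X Y) ∧
  (∀ Y₁ ∈ S, ∀ Y₂ ∈ S, SameTauOrbit Λ Y₁ Y₂ → Nonempty (Y₁ ≅ Y₂)) ∧
  (∀ X ∈ S, ∀ Y : ModuleCat.{u} Λ, Module.Finite Λ Y → Indec Λ Y → ¬ Projective Y →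
    (∃ f : X ⟶ Y, IsIrred Λ f) →
      ((∃ Y' ∈ S, Nonempty (Y ≅ Y')) ∨
        ∃ Z ∈ S, ∃ (E : ModuleCat.{u} Λ) (f : Z ⟶ E) (g : E ⟶ Y), IsARSeq Λ f g))

section Indecomposable

variable {Λ : Type u} [Ring Λ]

lemma Indec.of_iso {X Y : ModuleCat.{u} Λ} (hX : Indec Λ X) (e : X ≅ Y) : Indec Λ Y :=
  ⟨fun h => hX.1 (h.of_iso e), fun A B ⟨e'⟩ => hX.2 A B ⟨e ≪≫ e'⟩⟩

lemma Indec.isIso_of_comp_eq_id {A X : ModuleCat.{u} Λ} (hX : Indec Λ X) (hA : ¬ IsZero A)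
    (i : A ⟶ X) (p : X ⟶ A) (h : i ≫ p = 𝟙 A) : IsIso i ∧ IsIso p := by
  let σ : (ShortComplex.mk (kernel.ι p) p (kernel.condition p)).Splitting :=
    ShortComplex.Splitting.ofExactOfSection _ (ShortComplex.exact_kernel p) i h inferInstance
  have hz : IsZero (kernel p) :=
    (hX.2 _ _ ⟨σ.isoBinaryBiproduct⟩).resolve_right hA
  have hm : Mono p := Preadditive.mono_of_isZero_kernel p hz
  have : IsSplitEpi p := ⟨⟨⟨i, h⟩⟩⟩
  have hp : IsIso p := isIso_of_mono_of_isSplitEpi p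
  refine ⟨?_, hp⟩
  have : i = inv p := by rw [← cancel_mono p]; simp [h]
  rw [this]; infer_instance

lemma Indec.eq_bot_or_eq_bot_of_isCompl {X : ModuleCat.{u} Λ} (hX : Indec Λ X)
    {p q : Submodule Λ X} (h : IsCompl p q) : p = ⊥ ∨ q = ⊥ := by
  have e : X ≅ ModuleCat.of Λ p ⊞ ModuleCat.of Λ q :=
    ((p.prodEquivOfIsCompl q h).toModuleIso).symm ≪≫
      (ModuleCat.biprodIsoProd (ModuleCat.of Λ p) (ModuleCat.of Λ q)).symm
  rcases hX.2 _ _ ⟨e⟩ with h | h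
  · left
    rw [ModuleCat.isZero_iff_subsingleton] at h
    exact (Submodule.subsingleton_iff_eq_bot).1 h
  · right
    rw [ModuleCat.isZero_iff_subsingleton] at h
    exact (Submodule.subsingleton_iff_eq_bot).1 h

/-- The `n`-fold composite of an endomorphism with itself. -/
def iterate {X : ModuleCat.{u} Λ} (v : X ⟶ X) : ℕ → (X ⟶ X)
  | 0 => 𝟙 X
  | n + 1 => iterate v n ≫ v

lemma comp_iterate {X Y : ModuleCat.{u} Λ} {f : X ⟶ Y} {v : X ⟶ X} {w : Y ⟶ Y}
    (h : f ≫ w = v ≫ f) (n : ℕ) : f ≫ iterate w n = iterate v n ≫ f := by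
  induction n with
  | zero => simp [iterate]
  | succ n ih => simp only [iterate, Category.assoc, ← h]; rw [← Category.assoc, ih, Category.assoc]

lemma iterate_id {X : ModuleCat.{u} Λ} (n : ℕ) : iterate (𝟙 X) n = 𝟙 X := by
  induction n with
  | zero => rfl
  | succ n ih => simp [iterate, ih]

lemma hom_iterate {X : ModuleCat.{u} Λ} (v : X ⟶ X) (n : ℕ) :
    (iterate v n).hom = (v.hom : Module.End Λ X) ^ n := by
  induction n with
  | zero => rfl
  | succ n ih => rw [pow_succ', ← ih]; rfl

lemma Indec.isIso_or_iterate_eq_zero [IsArtinianRing Λ] {X : ModuleCat.{u} Λ} (hX : Indec Λ X)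
    (hf : Module.Finite Λ X) (v : X ⟶ X) : IsIso v ∨ ∃ n, iterate v n = 0 := by
  obtain ⟨n, hn⟩ := Filter.eventually_atTop.1
    (LinearMap.eventually_isCompl_ker_pow_range_pow (v.hom : Module.End Λ X))
  have hc := hn (n + 1) (by omega)
  rcases hX.eq_bot_or_eq_bot_of_isCompl hc with h | h
  · left
    have h2 : LinearMap.range ((v.hom : Module.End Λ X) ^ (n + 1)) = ⊤ := by
      have := hc.sup_eq_top; rwa [h, bot_sup_eq] at this
    have inj : Function.Injective v.hom := by
      have := LinearMap.ker_eq_bot.1 h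
      rw [pow_succ] at this
      exact Function.Injective.of_comp (f := ⇑(v.hom ^ n)) this
    have surj : Function.Surjective v.hom := by
      have := LinearMap.range_eq_top.1 h2
      rw [pow_succ'] at this
      exact Function.Surjective.of_comp (g := ⇑(v.hom ^ n)) this
    rw [ConcreteCategory.isIso_iff_bijective]
    exact ⟨inj, surj⟩
  · right
    refine ⟨n + 1, ?_⟩
    apply ModuleCat.hom_ext
    rw [hom_iterate]
    exact LinearMap.range_eq_bot.1 h

/-- A property of finitely generated modules which is stable under isomorphisms and biproducts
holds for all of them as soon as it holds for zero and indecomposable modules. -/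
lemma finite_induction [IsArtinianRing Λ] (P : ModuleCat.{u} Λ → Prop)
    (iso : ∀ X Y : ModuleCat.{u} Λ, (X ≅ Y) → P X → P Y)
    (zero : ∀ X, IsZero X → P X)
    (sum : ∀ X Y : ModuleCat.{u} Λ, Module.Finite Λ X → Module.Finite Λ Y → P X → P Y → P (X ⊞ Y))
    (indec : ∀ X : ModuleCat.{u} Λ, Module.Finite Λ X → Indec Λ X → P X)
    (X : ModuleCat.{u} Λ) (hX : Module.Finite Λ X) : P X := by
  have key : ∀ p : Submodule Λ X, P (ModuleCat.of Λ p) := by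
    intro p
    induction p using WellFoundedLT.induction with
    | ind p ih =>
      by_cases hz : IsZero (ModuleCat.of Λ p)
      · exact zero _ hz
      by_cases hi : Indec Λ (ModuleCat.of Λ p)
      · exact indec _ inferInstance hi
      · simp only [Indec, hz, not_false_eq_true, true_and, not_forall, not_or] at hi
        obtain ⟨A, B, ⟨e⟩, hA, hB⟩ := hi
        have aux : ∀ (C D : ModuleCat.{u} Λ) (i : C ⟶ ModuleCat.of Λ p)
            (d : ModuleCat.of Λ p ⟶ C) (j : D ⟶ ModuleCat.of Λ p), i ≫ d = 𝟙 C → j ≫ d = 0 →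
            Mono j → ¬ IsZero D → P C ∧ Module.Finite Λ C := by
          intro C D i d j hid hjd hj hD
          have hinj : Function.Injective i.hom := by
            have : Mono i := mono_of_mono_fac hid
            exact (ModuleCat.mono_iff_injective i).1 this
          let φ : C →ₗ[Λ] X := p.subtype ∘ₗ i.hom
          have hφ : Function.Injective φ := p.injective_subtype.comp hinj
          let e' := LinearEquiv.ofInjective φ hφ
          have hlt : LinearMap.range φ < p := by
            refine lt_of_le_of_ne ?_ ?_
            · rintro _ ⟨c, rfl⟩; exact (i.hom c).2
            · intro he
              apply hD
              rw [IsZero.iff_id_eq_zero, ← cancel_mono j]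
              ext y
              have : (p.subtype (j.hom y)) ∈ LinearMap.range φ := by rw [he]; exact (j.hom y).2
              obtain ⟨c, hc⟩ := this
              have hc' : i.hom c = j.hom y := Subtype.ext hc
              have h1 : d.hom (i.hom c) = c := by
                rw [← LinearMap.comp_apply, ← ModuleCat.hom_comp, hid]; rfl
              have h2 : d.hom (j.hom y) = 0 := by
                rw [← LinearMap.comp_apply, ← ModuleCat.hom_comp, hjd]; rfl
              rw [hc', h2] at h1
              rw [← h1, map_zero] at hc'
              simp [← hc']
          refine ⟨iso _ _ e'.toModuleIso.symm (ih _ hlt), ?_⟩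
          exact Module.Finite.equiv e'.symm
        obtain ⟨pA, fA⟩ := aux A B (biprod.inl ≫ e.inv) (e.hom ≫ biprod.fst) (biprod.inr ≫ e.inv)
          (by simp) (by simp) inferInstance hB
        obtain ⟨pB, fB⟩ := aux B A (biprod.inr ≫ e.inv) (e.hom ≫ biprod.snd) (biprod.inl ≫ e.inv)
          (by simp) (by simp) inferInstance hA
        exact iso _ _ e.symm (sum A B fA fB pA pB)
  exact iso _ _ (LinearEquiv.ofTop (⊤ : Submodule Λ X) rfl).toModuleIso (key ⊤)

end Indecomposable

section AuslanderReiten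

variable {Λ : Type u} [Ring Λ]

/-- `f` and `g` are the maps of a short exact sequence. -/
def IsShortExact {X Y Z : ModuleCat.{u} Λ} (f : X ⟶ Y) (g : Y ⟶ Z) : Prop :=
  Mono f ∧ Epi g ∧ ∃ w : f ≫ g = 0, (ShortComplex.mk f g w).Exact

namespace IsShortExact

variable {X Y Z : ModuleCat.{u} Λ} {f : X ⟶ Y} {g : Y ⟶ Z}

lemma zero (h : IsShortExact f g) : f ≫ g = 0 := h.2.2.1

lemma exists_lift (h : IsShortExact f g) {T : ModuleCat.{u} Λ} (k : T ⟶ Y) (hk : k ≫ g = 0) :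
    ∃ l : T ⟶ X, l ≫ f = k := by
  obtain ⟨hf, hg, w, he⟩ := h
  exact ⟨_, he.lift_f k hk⟩

lemma exists_desc (h : IsShortExact f g) {T : ModuleCat.{u} Λ} (k : Y ⟶ T) (hk : f ≫ k = 0) :
    ∃ l : Z ⟶ T, g ≫ l = k := by
  obtain ⟨hf, hg, w, he⟩ := h
  exact ⟨_, he.g_desc k hk⟩

lemma exists_retraction (h : IsShortExact f g) {s : Z ⟶ Y} (hs : s ≫ g = 𝟙 Z) :
    ∃ r : Y ⟶ X, f ≫ r = 𝟙 X := by
  have := h.1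
  obtain ⟨r, hr⟩ := h.exists_lift (𝟙 Y - g ≫ s) (by simp [hs])
  refine ⟨r, ?_⟩
  rw [← cancel_mono f, Category.assoc, hr, Preadditive.comp_sub, ← Category.assoc, h.zero]
  simp

lemma exists_section (h : IsShortExact f g) {r : Y ⟶ X} (hr : f ≫ r = 𝟙 X) :
    ∃ s : Z ⟶ Y, s ≫ g = 𝟙 Z := by
  have := h.2.1
  obtain ⟨s, hs⟩ := h.exists_desc (𝟙 Y - r ≫ f) (by simp [reassoc_of% hr])
  refine ⟨s, ?_⟩
  rw [← cancel_epi g, ← Category.assoc, hs, Preadditive.sub_comp, Category.assoc, h.zero]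
  simp

lemma exists_section_of_iterate_eq_zero (h : IsShortExact f g) {φ : Y ⟶ Y} {v : X ⟶ X}
    (h₁ : f ≫ φ = v ≫ f) (h₂ : φ ≫ g = g) {n : ℕ} (hn : iterate v n = 0) :
    ∃ s : Z ⟶ Y, s ≫ g = 𝟙 Z := by
  have := h.2.1
  obtain ⟨s, hs⟩ := h.exists_desc (iterate φ n) (by rw [comp_iterate h₁, hn, zero_comp])
  refine ⟨s, ?_⟩
  rw [← cancel_epi g, ← Category.assoc, hs,
    ← comp_iterate (w := 𝟙 Z) (f := g) (by simp [h₂]), iterate_id]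

lemma exists_retraction_of_iterate_eq_zero (h : IsShortExact f g) {φ : Y ⟶ Y} {v : Z ⟶ Z}
    (h₁ : f ≫ φ = f) (h₂ : φ ≫ g = g ≫ v) {n : ℕ} (hn : iterate v n = 0) :
    ∃ r : Y ⟶ X, f ≫ r = 𝟙 X := by
  have := h.1
  obtain ⟨r, hr⟩ := h.exists_lift (iterate φ n)
    (by rw [← comp_iterate h₂.symm, hn, comp_zero])
  refine ⟨r, ?_⟩
  rw [← cancel_mono f, Category.assoc, hr,
    comp_iterate (v := 𝟙 X) (f := f) (by simp [h₁]), iterate_id]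

lemma isIso_of_isIso (h : IsShortExact f g) {φ : Y ⟶ Y} {v : X ⟶ X} {w : Z ⟶ Z}
    (h₁ : f ≫ φ = v ≫ f) (h₂ : φ ≫ g = g ≫ w) [IsIso v] [IsIso w] : IsIso φ := by
  obtain ⟨hf, hg, z, he⟩ := h
  let S := ShortComplex.mk f g z
  let Φ : S ⟶ S := { τ₁ := v, τ₂ := φ, τ₃ := w, comm₁₂ := h₁.symm, comm₂₃ := h₂ }
  have hS : S.ShortExact := { exact := he, mono_f := hf, epi_g := hg }
  have : IsIso Φ.τ₁ := ‹IsIso v›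
  have : IsIso Φ.τ₃ := ‹IsIso w›
  exact ShortComplex.isIso₂_of_shortExact_of_isIso₁₃ Φ hS hS

lemma exists_pushout (h : IsShortExact f g) {W : ModuleCat.{u} Λ} (k : X ⟶ W) :
    ∃ (P : ModuleCat.{u} Λ) (i : W ⟶ P) (j : Y ⟶ P) (q : P ⟶ Z),
      IsShortExact i q ∧ f ≫ j = k ≫ i ∧ j ≫ q = g := by
  have hf := h.1
  have hg := h.2.1
  have hw : f ≫ g = k ≫ (0 : W ⟶ Z) := by rw [h.zero, comp_zero]
  have hq : pushout.inl f k ≫ pushout.desc g (0 : W ⟶ Z) hw = g := pushout.inl_desc ..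
  have hq0 : pushout.inr f k ≫ pushout.desc g (0 : W ⟶ Z) hw = 0 := pushout.inr_desc ..
  have he : Epi (pushout.desc g (0 : W ⟶ Z) hw : pushout f k ⟶ Z) :=
    epi_of_epi_fac hq
  refine ⟨pushout f k, pushout.inr f k, pushout.inl f k, pushout.desc g 0 hw,
    ⟨inferInstance, he, hq0, ?_⟩, pushout.condition, hq⟩
  apply ShortComplex.exact_of_g_is_cokernel
  refine CokernelCofork.IsColimit.ofπ' _ _ fun {T} t ht => ?_
  have hex := h.exists_desc (pushout.inl f k ≫ t)
    (by rw [pushout.condition_assoc, show pushout.inr f k ≫ t = 0 from ht, comp_zero])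
  refine ⟨hex.choose, ?_⟩
  apply pushout.hom_ext
  · exact ((Category.assoc ..).symm.trans (congrArg (· ≫ hex.choose) hq)).trans hex.choose_spec
  · rw [show pushout.inr f k ≫ t = 0 from ht, ← Category.assoc]
    erw [hq0]
    exact zero_comp

end IsShortExact

namespace IsARSeq

variable {X Y Z : ModuleCat.{u} Λ} {f : X ⟶ Y} {g : Y ⟶ Z}

lemma isShortExact (h : IsARSeq Λ f g) : IsShortExact f g := ⟨h.1, h.2.1, h.2.2.1⟩

lemma indec_left (h : IsARSeq Λ f g) : Indec Λ X := h.2.2.2.1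

lemma indec_right (h : IsARSeq Λ f g) : Indec Λ Z := h.2.2.2.2.1

lemma not_section (h : IsARSeq Λ f g) : ¬ ∃ s : Z ⟶ Y, s ≫ g = 𝟙 Z := h.2.2.2.2.2.1

lemma exists_fac (h : IsARSeq Λ f g) {W : ModuleCat.{u} Λ} (k : W ⟶ Z)
    (hk : ¬ ∃ s : Z ⟶ W, s ≫ k = 𝟙 Z) : ∃ k' : W ⟶ Y, k' ≫ g = k := h.2.2.2.2.2.2 W k hk

lemma not_retraction (h : IsARSeq Λ f g) : ¬ ∃ r : Y ⟶ X, f ≫ r = 𝟙 X :=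
  fun ⟨_, hr⟩ => h.not_section (h.isShortExact.exists_section hr)

lemma not_projective (h : IsARSeq Λ f g) : ¬ Projective Z := fun _ =>
  have := h.2.1
  h.not_section ⟨Projective.factorThru (𝟙 Z) g, by simp⟩

lemma not_injective (h : IsARSeq Λ f g) : ¬ Injective X := fun _ =>
  have := h.1
  h.not_retraction ⟨Injective.factorThru (𝟙 X) f, by simp⟩

lemma of_iso_right (h : IsARSeq Λ f g) {Z' : ModuleCat.{u} Λ} (e : Z ≅ Z') :
    IsARSeq Λ f (g ≫ e.hom) := by
  have hf := h.1
  have hg := h.2.1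
  obtain ⟨w, he⟩ := h.2.2.1
  refine ⟨hf, inferInstance, ⟨by rw [reassoc_of% w, zero_comp], ?_⟩, h.indec_left,
    h.indec_right.of_iso e, ?_, ?_⟩
  · refine (ShortComplex.exact_iff_of_iso (ShortComplex.isoMk (S₁ := ShortComplex.mk f g w)
      (S₂ := ShortComplex.mk f (g ≫ e.hom) (by rw [reassoc_of% w, zero_comp]))
      (Iso.refl _) (Iso.refl _) e ?_ ?_)).1 he
    · simp
    · simp
  · rintro ⟨s, hs⟩
    exact h.not_section ⟨e.hom ≫ s, by
      rw [← cancel_mono e.hom, Category.assoc, Category.assoc, hs]; simp⟩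
  · intro W k hk
    obtain ⟨k', hk'⟩ := h.exists_fac (k ≫ e.inv) fun ⟨s, hs⟩ => hk ⟨e.inv ≫ s, by
      rw [← cancel_mono e.inv, Category.assoc, Category.assoc, hs]; simp⟩
    exact ⟨k', by rw [← Category.assoc, hk']; simp⟩

lemma of_iso_left (h : IsARSeq Λ f g) {X' : ModuleCat.{u} Λ} (e : X' ≅ X) :
    IsARSeq Λ (e.hom ≫ f) g := by
  have hf := h.1
  have hg := h.2.1
  obtain ⟨w, he⟩ := h.2.2.1
  refine ⟨inferInstance, hg, ⟨by rw [Category.assoc, w, comp_zero], ?_⟩,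
    h.indec_left.of_iso e.symm, h.indec_right, h.not_section, fun W k hk => h.exists_fac k hk⟩
  refine (ShortComplex.exact_iff_of_iso
    (ShortComplex.isoMk (S₁ := ShortComplex.mk f g w)
      (S₂ := ShortComplex.mk (e.hom ≫ f) g (by rw [Category.assoc, w, comp_zero]))
      e.symm (Iso.refl _) (Iso.refl _) ?_ ?_)).1 he
  · simp
  · simp

/-- The source of an irreducible map to the right end of an almost split sequence is a direct
summand of the middle term. -/
lemma exists_retract_of_isIrred (h : IsARSeq Λ f g) {A : ModuleCat.{u} Λ} {a : A ⟶ Z}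
    (ha : IsIrred Λ a) : ∃ (i : A ⟶ Y) (p : Y ⟶ A), i ≫ p = 𝟙 A := by
  obtain ⟨i, hi⟩ := h.exists_fac a ha.2.1
  obtain ⟨p, hp⟩ := (ha.2.2 _ i g hi).resolve_right h.not_section
  exact ⟨i, p, hp⟩

variable [IsArtinianRing Λ]

/-- An endomorphism of the left end of an almost split sequence which extends to an endomorphism
of the sequence over the identity of the right end is an isomorphism. -/
lemma isIso_left (h : IsARSeq Λ f g) (hX : Module.Finite Λ X) {φ : Y ⟶ Y} {v : X ⟶ X}
    (h₁ : f ≫ φ = v ≫ f) (h₂ : φ ≫ g = g) : IsIso v :=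
  (h.indec_left.isIso_or_iterate_eq_zero hX v).resolve_right fun ⟨_, hn⟩ =>
    h.not_section (h.isShortExact.exists_section_of_iterate_eq_zero h₁ h₂ hn)

lemma isIso_right (h : IsARSeq Λ f g) (hZ : Module.Finite Λ Z) {φ : Y ⟶ Y} {v : Z ⟶ Z}
    (h₁ : f ≫ φ = f) (h₂ : φ ≫ g = g ≫ v) : IsIso v :=
  (h.indec_right.isIso_or_iterate_eq_zero hZ v).resolve_right fun ⟨_, hn⟩ =>
    h.not_retraction (h.isShortExact.exists_retraction_of_iterate_eq_zero h₁ h₂ hn)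

/-- The left map of an almost split sequence is left minimal. -/
lemma isIso_of_comp_eq (h : IsARSeq Λ f g) (hZ : Module.Finite Λ Z) {φ : Y ⟶ Y}
    (h₁ : f ≫ φ = f) : IsIso φ := by
  obtain ⟨v, hv⟩ := h.isShortExact.exists_desc (φ ≫ g)
    (by rw [← Category.assoc, h₁, h.isShortExact.zero])
  have := h.isIso_right hZ h₁ hv.symm
  exact h.isShortExact.isIso_of_isIso (v := 𝟙 X) (by simpa using h₁) hv.symm

/-- The left map of an almost split sequence is left almost split. -/
lemma exists_extension (h : IsARSeq Λ f g) (hX : Module.Finite Λ X) {W : ModuleCat.{u} Λ}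
    (k : X ⟶ W) (hk : ¬ ∃ r : W ⟶ X, k ≫ r = 𝟙 X) : ∃ k' : Y ⟶ W, f ≫ k' = k := by
  obtain ⟨P, i, j, q, hP, hfj, hjq⟩ := h.isShortExact.exists_pushout k
  have hi := hP.1
  have hf := h.1
  by_cases hs : ∃ s : Z ⟶ P, s ≫ q = 𝟙 Z
  · obtain ⟨s, hs⟩ := hs
    obtain ⟨r, hr⟩ := hP.exists_retraction hs
    exact ⟨j ≫ r, by rw [reassoc_of% hfj, hr, Category.comp_id]⟩
  · exfalso
    obtain ⟨q', hq'⟩ := h.exists_fac q hs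
    obtain ⟨v, hv⟩ := h.isShortExact.exists_lift (i ≫ q') (by rw [Category.assoc, hq', hP.zero])
    have := h.isIso_left hX (φ := j ≫ q') (v := k ≫ v)
      (by rw [reassoc_of% hfj, Category.assoc, hv]) (by rw [Category.assoc, hq', hjq])
    exact hk ⟨v ≫ inv (k ≫ v), by rw [← Category.assoc, IsIso.hom_inv_id]⟩

lemma nonempty_iso_left {X' Y' : ModuleCat.{u} Λ} {f' : X' ⟶ Y'} {g' : Y' ⟶ Z}
    (h : IsARSeq Λ f g) (hX : Module.Finite Λ X) (h' : IsARSeq Λ f' g') : Nonempty (X ≅ X') := by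
  have hf := h.1
  have hf' := h'.1
  obtain ⟨a, ha⟩ := h'.exists_fac g h.not_section
  obtain ⟨b, hb⟩ := h.exists_fac g' h'.not_section
  obtain ⟨a₁, ha₁⟩ := h'.isShortExact.exists_lift (f ≫ a)
    (by rw [Category.assoc, ha, h.isShortExact.zero])
  obtain ⟨b₁, hb₁⟩ := h.isShortExact.exists_lift (f' ≫ b)
    (by rw [Category.assoc, hb, h'.isShortExact.zero])
  have := h.isIso_left hX (φ := a ≫ b) (v := a₁ ≫ b₁)
    (by rw [Category.assoc, hb₁, ← Category.assoc, ← Category.assoc, ha₁])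
    (by rw [Category.assoc, hb, ha])
  have := (h'.indec_left.isIso_of_comp_eq_id h.indec_left.1 a₁ (b₁ ≫ inv (a₁ ≫ b₁))
    (by rw [← Category.assoc, IsIso.hom_inv_id])).1
  exact ⟨asIso a₁⟩

lemma nonempty_iso_right {Y' Z' : ModuleCat.{u} Λ} {f' : X ⟶ Y'} {g' : Y' ⟶ Z'}
    (h : IsARSeq Λ f g) (hX : Module.Finite Λ X) (hZ : Module.Finite Λ Z)
    (h' : IsARSeq Λ f' g') : Nonempty (Z ≅ Z') := by
  have hg := h.2.1
  have hg' := h'.2.1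
  obtain ⟨a, ha⟩ := h.exists_extension hX f' h'.not_retraction
  obtain ⟨b, hb⟩ := h'.exists_extension hX f h.not_retraction
  obtain ⟨a₁, ha₁⟩ := h.isShortExact.exists_desc (a ≫ g')
    (by rw [← Category.assoc, ha, h'.isShortExact.zero])
  obtain ⟨b₁, hb₁⟩ := h'.isShortExact.exists_desc (b ≫ g)
    (by rw [← Category.assoc, hb, h.isShortExact.zero])
  have := h.isIso_right hZ (φ := a ≫ b) (v := a₁ ≫ b₁)
    (by rw [← Category.assoc, ha, hb])
    (by rw [Category.assoc, ← hb₁, ← Category.assoc, ← ha₁, Category.assoc])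
  have := (h'.indec_right.isIso_of_comp_eq_id h.indec_right.1 a₁ (b₁ ≫ inv (a₁ ≫ b₁))
    (by rw [← Category.assoc, IsIso.hom_inv_id])).1
  exact ⟨asIso a₁⟩

/-- The components of the left map of an almost split sequence are irreducible. -/
lemma isIrred_comp (h : IsARSeq Λ f g) (hX : Module.Finite Λ X) (hZ : Module.Finite Λ Z)
    {B : ModuleCat.{u} Λ} (hB : ¬ IsZero B) {i : B ⟶ Y} {p : Y ⟶ B} (hip : i ≫ p = 𝟙 B) :
    IsIrred Λ (f ≫ p) := by
  refine ⟨?_, ?_, ?_⟩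
  · rintro ⟨r, hr⟩
    exact h.not_retraction ⟨p ≫ r, by rw [← hr, Category.assoc]⟩
  · rintro ⟨s, hs⟩
    have := (h.indec_left.isIso_of_comp_eq_id hB s (f ≫ p) hs).2
    exact h.not_retraction ⟨p ≫ inv (f ≫ p), by rw [← Category.assoc, IsIso.hom_inv_id]⟩
  · intro W a b hab
    by_cases ha : IsSplitMonoMap Λ a
    · exact Or.inl ha
    · right
      obtain ⟨t, ht⟩ := h.exists_extension hX a ha
      have hφ : IsIso (𝟙 Y - p ≫ i + t ≫ b ≫ i) := by
        apply h.isIso_of_comp_eq hZ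
        simp only [Preadditive.comp_add, Preadditive.comp_sub, Category.comp_id]
        rw [reassoc_of% ht, reassoc_of% hab]
        simp
      have hφp : (𝟙 Y - p ≫ i + t ≫ b ≫ i) ≫ p = t ≫ b := by
        simp [hip]
      refine ⟨i ≫ inv (𝟙 Y - p ≫ i + t ≫ b ≫ i) ≫ t, ?_⟩
      rw [Category.assoc, Category.assoc, ← hφp, IsIso.inv_hom_id_assoc, hip]

end IsARSeq

lemma IsIrred.iso_comp {A B C : ModuleCat.{u} Λ} {a : B ⟶ C} (ha : IsIrred Λ a) (e : A ≅ B) :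
    IsIrred Λ (e.hom ≫ a) := by
  refine ⟨fun ⟨r, hr⟩ => ha.1 ⟨r ≫ e.hom, ?_⟩, fun ⟨s, hs⟩ => ha.2.1 ⟨s ≫ e.hom, by simpa using hs⟩,
    fun W b c hbc => ?_⟩
  · rw [← cancel_epi e.hom, ← Category.assoc, ← Category.assoc, hr]; simp
  · rcases ha.2.2 W (e.inv ≫ b) c (by simp [hbc]) with ⟨r, hr⟩ | h
    · left
      refine ⟨r ≫ e.inv, ?_⟩
      rw [← cancel_epi e.inv, ← Category.assoc, ← Category.assoc, hr]; simp
    · exact Or.inr h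

end AuslanderReiten

section PureInjective

/-- A system of linear equations for a linear functional is solvable as soon as all its finite
subsystems are. -/
lemma exists_dual_of_finite {k V ι : Type*} [Field k] [AddCommGroup V] [Module k V]
    (v : ι → V) (c : ι → k)
    (h : ∀ s : Finset ι, ∃ x : Module.Dual k V, ∀ i ∈ s, x (v i) = c i) :
    ∃ x : Module.Dual k V, ∀ i, x (v i) = c i := by
  have hθ : Finsupp.linearCombination k c ∈
      LinearMap.range (Finsupp.linearCombination k v).dualMap := by
    rw [LinearMap.range_dualMap_eq_dualAnnihilator_ker, Submodule.mem_dualAnnihilator]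
    intro a ha
    obtain ⟨x, hx⟩ := h a.support
    have hxa : x (Finsupp.linearCombination k v a) = 0 := by
      rw [LinearMap.mem_ker.1 ha, map_zero]
    rw [← hxa, Finsupp.linearCombination_apply, Finsupp.linearCombination_apply, Finsupp.sum,
      Finsupp.sum, map_sum]
    exact Finset.sum_congr rfl fun i hi => by rw [map_smul, hx i hi]
  obtain ⟨x, hx⟩ := hθ
  refine ⟨x, fun i => ?_⟩
  have := LinearMap.congr_fun hx (Finsupp.single i 1)
  simpa using this

variable {k Λ : Type*} [Field k] [Ring Λ] [Algebra k Λ]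

/-- A map of modules lifts through a map between finite dimensional modules as soon as all its
restrictions to finitely generated submodules do. -/
lemma exists_lift_of_fg {W E X : Type*} [AddCommGroup W] [Module k W] [Module Λ W]
    [IsScalarTower k Λ W] [AddCommGroup E] [Module k E] [Module Λ E] [IsScalarTower k Λ E]
    [FiniteDimensional k E] [AddCommGroup X] [Module k X] [Module Λ X] [IsScalarTower k Λ X]
    (g : E →ₗ[Λ] X) (h : W →ₗ[Λ] X)
    (H : ∀ U : Submodule Λ W, U.FG → ∃ r : U →ₗ[Λ] E, g ∘ₗ r = h ∘ₗ U.subtype) :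
    ∃ r : W →ₗ[Λ] E, g ∘ₗ r = h := by
  let act : Λ → E →ₗ[k] E := fun l => DistribSMul.toLinearMap k E l
  let v : (Λ × W × Module.Dual k E) ⊕ (W × Module.Dual k X) →
      TensorProduct k W (Module.Dual k E) :=
    Sum.elim (fun a => (a.1 • a.2.1) ⊗ₜ a.2.2 - a.2.1 ⊗ₜ (a.2.2 ∘ₗ act a.1))
      fun b => b.1 ⊗ₜ (b.2 ∘ₗ g.restrictScalars k)
  let c : (Λ × W × Module.Dual k E) ⊕ (W × Module.Dual k X) → k :=
    Sum.elim (fun _ => 0) fun b => b.2 (h b.1)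
  obtain ⟨x, hx⟩ := exists_dual_of_finite v c fun s => by
    let pt : (Λ × W × Module.Dual k E) ⊕ (W × Module.Dual k X) → W :=
      Sum.elim (fun a => a.2.1) fun b => b.1
    classical
    obtain ⟨r, hr⟩ := H (Submodule.span Λ (s.image pt : Finset W)) ⟨_, rfl⟩
    obtain ⟨r', hr'⟩ := LinearMap.exists_extend
      (p := (Submodule.span Λ (s.image pt : Set W)).restrictScalars k) (r.restrictScalars k)
    have hr'' : ∀ w (hw : w ∈ Submodule.span Λ (s.image pt : Set W)), r' w = r ⟨w, hw⟩ :=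
      fun w hw => LinearMap.congr_fun hr' ⟨w, hw⟩
    refine ⟨TensorProduct.lift ((Module.Dual.eval k E) ∘ₗ r'), ?_⟩
    intro i hi
    have hpt : pt i ∈ Submodule.span Λ (s.image pt : Set W) :=
      Submodule.subset_span (Finset.mem_coe.2 (Finset.mem_image_of_mem pt hi))
    rcases i with ⟨l, w, e⟩ | ⟨w, χ⟩
    · have hw : w ∈ Submodule.span Λ (s.image pt : Set W) := hpt
      have := r.map_smul l ⟨w, hw⟩
      simp only [v, c, Sum.elim_inl, map_sub, TensorProduct.lift.tmul, LinearMap.comp_apply,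
        Module.Dual.eval_apply]
      rw [hr'' w hw, hr'' _ (Submodule.smul_mem _ l hw), sub_eq_zero]
      exact congrArg e this
    · have hw : w ∈ Submodule.span Λ (s.image pt : Set W) := hpt
      have := LinearMap.congr_fun hr ⟨w, hw⟩
      simp only [v, c, Sum.elim_inr, TensorProduct.lift.tmul, LinearMap.comp_apply,
        Module.Dual.eval_apply]
      rw [hr'' w hw]
      exact congrArg χ this
  let r : W →ₗ[k] E := (Module.evalEquiv k E).symm.toLinearMap ∘ₗ
    (TensorProduct.lift.equiv (.id k) W (Module.Dual k E) k).symm x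
  have hr : ∀ w (e : Module.Dual k E), e (r w) = x (w ⊗ₜ e) := fun w e => by
    simp [r]
  refine ⟨{ toFun := r, map_add' := r.map_add, map_smul' := fun l w => ?_ }, ?_⟩
  · rw [← sub_eq_zero, ← Module.forall_dual_apply_eq_zero_iff k]
    intro e
    have := hx (Sum.inl (l, w, e))
    simp only [v, c, Sum.elim_inl, map_sub] at this
    rw [map_sub, hr, ← this, ← hr w]
    rfl
  · ext w
    rw [← sub_eq_zero, ← Module.forall_dual_apply_eq_zero_iff k]
    intro χ
    have := hx (Sum.inr (w, χ))
    simp only [v, c, Sum.elim_inr] at this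
    rw [← hr] at this
    rw [map_sub, ← this, sub_eq_zero]
    rfl

end PureInjective

section Existence

open scoped ModuleCat

variable {Λ : Type u} [Ring Λ]

lemma Indec.isIso_or_isIso_of_add_eq_id [IsArtinianRing Λ] {X : ModuleCat.{u} Λ} (hX : Indec Λ X)
    (hf : Module.Finite Λ X) {a b : X ⟶ X} (h : a + b = 𝟙 X) : IsIso a ∨ IsIso b := by
  rcases hX.isIso_or_iterate_eq_zero hf a with ha | ⟨n, hn⟩
  · exact Or.inl ha
  · right
    have hb : b.hom = (1 : Module.End Λ X) - a.hom := by
      rw [eq_sub_iff_add_eq, add_comm, ← ModuleCat.hom_add, h]; rfl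
    have hnil : IsNilpotent (a.hom : Module.End Λ X) :=
      ⟨n, by rw [← hom_iterate, hn]; rfl⟩
    have hu := hnil.isUnit_one_sub
    rw [← hb] at hu
    rw [ConcreteCategory.isIso_iff_bijective]
    exact (Module.End.isUnit_iff _).1 hu

lemma Indec.not_section_desc [IsArtinianRing Λ] {Z A B : ModuleCat.{u} Λ} (hZ : Indec Λ Z)
    (hf : Module.Finite Λ Z) {a : A ⟶ Z} {b : B ⟶ Z} (ha : ¬ ∃ s : Z ⟶ A, s ≫ a = 𝟙 Z)
    (hb : ¬ ∃ s : Z ⟶ B, s ≫ b = 𝟙 Z) : ¬ ∃ s : Z ⟶ A ⊞ B, s ≫ biprod.desc a b = 𝟙 Z := by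
  rintro ⟨s, hs⟩
  have h : (s ≫ biprod.fst) ≫ a + (s ≫ biprod.snd) ≫ b = 𝟙 Z := by
    rw [← hs, biprod.desc_eq]; simp
  rcases hZ.isIso_or_isIso_of_add_eq_id hf h with h | h
  · exact ha ⟨inv ((s ≫ biprod.fst) ≫ a) ≫ s ≫ biprod.fst, by
      rw [Category.assoc, IsIso.inv_hom_id]⟩
  · exact hb ⟨inv ((s ≫ biprod.snd) ≫ b) ≫ s ≫ biprod.snd, by
      rw [Category.assoc, IsIso.inv_hom_id]⟩

lemma finite_biprod {A B : ModuleCat.{u} Λ} (hA : Module.Finite Λ A) (hB : Module.Finite Λ B) :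
    Module.Finite Λ ↑(A ⊞ B) :=
  Module.Finite.equiv (ModuleCat.biprodIsoProd A B).symm.toLinearEquiv

/-- A right almost split map in the category of finitely generated modules. -/
def IsRightAlmostSplit {E Z : ModuleCat.{u} Λ} (g : E ⟶ Z) : Prop :=
  (¬ ∃ s : Z ⟶ E, s ≫ g = 𝟙 Z) ∧ ∀ W : ModuleCat.{u} Λ, Module.Finite Λ W → ∀ k : W ⟶ Z,
    (¬ ∃ s : Z ⟶ W, s ≫ k = 𝟙 Z) → ∃ k' : W ⟶ E, k' ≫ g = k

lemma Indec.exists_fac_list [IsArtinianRing Λ] {Z : ModuleCat.{u} Λ} (hZ : Indec Λ Z)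
    (hf : Module.Finite Λ Z) (l : List (Σ W : ModuleCat.{u} Λ, W ⟶ Z))
    (hl : ∀ x ∈ l, Module.Finite Λ x.1 ∧ ¬ ∃ s : Z ⟶ x.1, s ≫ x.2 = 𝟙 Z) :
    ∃ (E : ModuleCat.{u} Λ) (g : E ⟶ Z), Module.Finite Λ E ∧ (¬ ∃ s : Z ⟶ E, s ≫ g = 𝟙 Z) ∧
      ∀ x ∈ l, ∃ k : x.1 ⟶ E, k ≫ g = x.2 := by
  induction l with
  | nil =>
    refine ⟨ModuleCat.of Λ PUnit, 0, inferInstance, ?_, by simp⟩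
    rintro ⟨s, hs⟩
    exact hZ.1 ((IsZero.iff_id_eq_zero Z).2 (by rw [← hs, comp_zero]))
  | cons x l ih =>
    obtain ⟨E, g, hE, hg, h⟩ := ih fun y hy => hl y (List.mem_cons_of_mem _ hy)
    obtain ⟨hx, hx'⟩ := hl x List.mem_cons_self
    refine ⟨x.1 ⊞ E, biprod.desc x.2 g, finite_biprod hx hE, hZ.not_section_desc hf hx' hg, ?_⟩
    intro y hy
    rcases List.mem_cons.1 hy with rfl | hy
    · exact ⟨biprod.inl, by simp⟩
    · obtain ⟨k, hk⟩ := h y hy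
      exact ⟨k ≫ biprod.inr, by simpa using hk⟩

lemma finiteDimensional_hom (k : Type u) [Field k] [Algebra k Λ] [FiniteDimensional k Λ]
    (X Z : ModuleCat.{u} Λ) [Module.Finite Λ X] [Module.Finite Λ Z] :
    FiniteDimensional k (X ⟶ Z) := by
  have : FiniteDimensional k X := Module.Finite.trans Λ X
  have : FiniteDimensional k Z := Module.Finite.trans Λ Z
  let φ : (X ⟶ Z) →ₗ[k] (X →ₗ[k] Z) :=
    { toFun := fun f => f.hom.restrictScalars k
      map_add' := fun _ _ => rfl
      map_smul' := fun _ _ => rfl }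
  refine Module.Finite.of_injective φ fun f g hfg => ?_
  apply ModuleCat.hom_ext
  exact LinearMap.restrictScalars_injective k hfg

/-- The module `Z` is finitely generated and indecomposable. -/
def IsFinIndec (Z : ModuleCat.{u} Λ) : Prop := Module.Finite Λ Z ∧ Indec Λ Z

/-- There are finitely many finitely generated indecomposable modules up to isomorphism. -/
def IsRepFinite (Λ : Type u) [Ring Λ] : Prop :=
  ∃ (I : Type) (_ : Finite I) (X : I → ModuleCat.{u} Λ), (∀ i, IsFinIndec (X i)) ∧
    ∀ Y : ModuleCat.{u} Λ, IsFinIndec Y → ∃ i, Nonempty (Y ≅ X i)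

lemma exists_isRightAlmostSplit (k : Type u) [Field k] [Algebra k Λ] [FiniteDimensional k Λ]
    (hΛ : IsRepFinite Λ) {Z : ModuleCat.{u} Λ} (hZ : IsFinIndec Z) :
    ∃ (E : ModuleCat.{u} Λ) (g : E ⟶ Z), Module.Finite Λ E ∧ IsRightAlmostSplit g := by
  have : IsArtinianRing Λ := IsArtinianRing.of_finite k Λ
  obtain ⟨I, _, X, hX, hcov⟩ := hΛ
  have hZf := hZ.1
  have hgen : ∀ i, ∃ s : Finset (X i ⟶ Z), (∀ x ∈ s, ¬ ∃ t : Z ⟶ X i, t ≫ x = 𝟙 Z) ∧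
      ∀ x : X i ⟶ Z, (¬ ∃ t : Z ⟶ X i, t ≫ x = 𝟙 Z) → x ∈ Submodule.span k (s : Set _) := by
    intro i
    have := (hX i).1
    have := finiteDimensional_hom k (X i) Z
    obtain ⟨s, hs, hspan⟩ := (Submodule.fg_span_iff_fg_span_finset_subset (R := k)
      {x : X i ⟶ Z | ¬ ∃ t : Z ⟶ X i, t ≫ x = 𝟙 Z}).1 (IsNoetherian.noetherian _)
    exact ⟨s, fun x hx => hs hx, fun x hx => hspan ▸ Submodule.subset_span hx⟩
  choose s hs hspan using hgen
  have hfin : Set.Finite {x : Σ W : ModuleCat.{u} Λ, W ⟶ Z | ∃ i, ∃ y ∈ s i, x = ⟨X i, y⟩} := by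
    have : {x : Σ W : ModuleCat.{u} Λ, W ⟶ Z | ∃ i, ∃ y ∈ s i, x = ⟨X i, y⟩} =
        ⋃ i, (fun y => (⟨X i, y⟩ : Σ W : ModuleCat.{u} Λ, W ⟶ Z)) '' (s i : Set (X i ⟶ Z)) := by
      ext x
      simp [eq_comm]
    rw [this]
    exact Set.finite_iUnion fun i => (s i).finite_toSet.image _
  obtain ⟨E, g, hE, hg, hfac⟩ := hZ.2.exists_fac_list hZf hfin.toFinset.toList (by
    intro x hx
    rw [Finset.mem_toList, Set.Finite.mem_toFinset] at hx
    obtain ⟨i, y, hy, rfl⟩ := hx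
    exact ⟨(hX i).1, hs i y hy⟩)
  refine ⟨E, g, hE, hg, fun W hW => ?_⟩
  refine finite_induction (Λ := Λ) (fun W => ∀ k : W ⟶ Z, (¬ ∃ s : Z ⟶ W, s ≫ k = 𝟙 Z) →
    ∃ k' : W ⟶ E, k' ≫ g = k) ?_ ?_ ?_ ?_ W hW
  · intro A B e h x hx
    obtain ⟨x', hx'⟩ := h (e.hom ≫ x) fun ⟨t, ht⟩ => hx ⟨t ≫ e.hom, by simpa using ht⟩
    exact ⟨e.inv ≫ x', by rw [Category.assoc, hx']; simp⟩
  · intro A hA x _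
    exact ⟨0, hA.eq_of_src _ _⟩
  · intro A B _ _ hA hB x hx
    obtain ⟨a, ha⟩ := hA (biprod.inl ≫ x) fun ⟨t, ht⟩ => hx ⟨t ≫ biprod.inl, by simpa using ht⟩
    obtain ⟨b, hb⟩ := hB (biprod.inr ≫ x) fun ⟨t, ht⟩ => hx ⟨t ≫ biprod.inr, by simpa using ht⟩
    refine ⟨biprod.desc a b, ?_⟩
    apply biprod.hom_ext'
    · simp [ha]
    · simp [hb]
  · intro A hA hA' x hx
    obtain ⟨i, ⟨e⟩⟩ := hcov A ⟨hA, hA'⟩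
    have hmem := hspan i (e.inv ≫ x) fun ⟨t, ht⟩ => hx ⟨t ≫ e.inv, by simpa using ht⟩
    have key : Submodule.span k (s i : Set (X i ⟶ Z)) ≤
        LinearMap.range (Linear.rightComp k (X i) g) := by
      rw [Submodule.span_le]
      intro y hy
      obtain ⟨z, hz⟩ := hfac ⟨X i, y⟩ (by
        rw [Finset.mem_toList, Set.Finite.mem_toFinset]
        exact ⟨i, y, hy, rfl⟩)
      exact ⟨z, hz⟩
    obtain ⟨z, hz⟩ := key hmem
    refine ⟨e.hom ≫ z, ?_⟩
    rw [Category.assoc, show z ≫ g = e.inv ≫ x from hz]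
    simp

lemma exists_minimal_isRightAlmostSplit (k : Type u) [Field k] [Algebra k Λ] [FiniteDimensional k Λ]
    (hΛ : IsRepFinite Λ) {Z : ModuleCat.{u} Λ}
    (hZ : IsFinIndec Z) :
    ∃ (E : ModuleCat.{u} Λ) (g : E ⟶ Z), Module.Finite Λ E ∧ IsRightAlmostSplit g ∧
      ∀ φ : E ⟶ E, φ ≫ g = g → IsIso φ := by
  have hne : ∃ n, ∃ (E : ModuleCat.{u} Λ) (g : E ⟶ Z), Module.Finite Λ E ∧
      IsRightAlmostSplit g ∧ Module.finrank k E = n := by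
    obtain ⟨E, g, hE, hg⟩ := exists_isRightAlmostSplit k hΛ hZ
    exact ⟨_, E, g, hE, hg, rfl⟩
  classical
  obtain ⟨E, g, hE, hg, hn⟩ := Nat.find_spec hne
  refine ⟨E, g, hE, hg, fun φ hφ => ?_⟩
  have : FiniteDimensional k E := Module.Finite.trans Λ E
  let E' := ModuleCat.of Λ (LinearMap.range φ.hom)
  let i : E' ⟶ E := ModuleCat.ofHom (LinearMap.range φ.hom).subtype
  let p : E ⟶ E' := ModuleCat.ofHom φ.hom.rangeRestrict
  have hpi : p ≫ i = φ := rfl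
  have hE' : Module.Finite Λ E' := Module.Finite.range φ.hom
  have hg' : IsRightAlmostSplit (i ≫ g) := by
    refine ⟨fun ⟨s, hs⟩ => hg.1 ⟨s ≫ i, by rw [Category.assoc, hs]⟩, fun W hW x hx => ?_⟩
    obtain ⟨x', hx'⟩ := hg.2 W hW x hx
    exact ⟨x' ≫ p, by rw [Category.assoc, ← Category.assoc p, hpi, hφ, hx']⟩
  have hle : Module.finrank k E ≤ Module.finrank k E' := by
    rw [hn]
    exact Nat.find_min' hne ⟨E', i ≫ g, hE', hg', rfl⟩
  have hsurj : Function.Surjective φ.hom := by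
    have h1 : Module.finrank k E ≤
        Module.finrank k (LinearMap.range (φ.hom.restrictScalars k)) := hle
    have h2 := Submodule.eq_top_of_finrank_eq
      (le_antisymm (Submodule.finrank_le (LinearMap.range (φ.hom.restrictScalars k))) h1)
    have h3 : Function.Surjective (φ.hom.restrictScalars k) := LinearMap.range_eq_top.1 h2
    exact h3
  have hinj : Function.Injective φ.hom :=
    (LinearMap.injective_iff_surjective (f := φ.hom.restrictScalars k)).2 hsurj
  rw [ConcreteCategory.isIso_iff_bijective]
  exact ⟨hinj, hsurj⟩

lemma IsRightAlmostSplit.exists_fac (k : Type u) [Field k] [Algebra k Λ] [FiniteDimensional k Λ]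
    {E Z : ModuleCat.{u} Λ} {g : E ⟶ Z}
    (hg : IsRightAlmostSplit g) (hE : Module.Finite Λ E) {W : ModuleCat.{u} Λ} (x : W ⟶ Z)
    (hx : ¬ ∃ s : Z ⟶ W, s ≫ x = 𝟙 Z) : ∃ x' : W ⟶ E, x' ≫ g = x := by
  have : FiniteDimensional k E := Module.Finite.trans Λ E
  obtain ⟨r, hr⟩ := exists_lift_of_fg (k := k) g.hom x.hom fun U hU => by
    let u : ModuleCat.of Λ U ⟶ W := ModuleCat.ofHom U.subtype
    obtain ⟨y, hy⟩ := hg.2 (ModuleCat.of Λ U) (Module.Finite.iff_fg.2 hU) (u ≫ x)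
      fun ⟨s, hs⟩ => hx ⟨s ≫ u, by rw [Category.assoc, hs]⟩
    exact ⟨y.hom, congrArg ModuleCat.Hom.hom hy⟩
  exact ⟨ModuleCat.ofHom r, ModuleCat.hom_ext hr⟩

/-- Existence of almost split sequences over an algebra of finite representation type. -/
theorem exists_isARSeq (k : Type u) [Field k] [Algebra k Λ] [FiniteDimensional k Λ]
    (hΛ : IsRepFinite Λ) {Z : ModuleCat.{u} Λ} (hZ : IsFinIndec Z)
    (hZp : ¬ Projective Z) :
    ∃ (K E : ModuleCat.{u} Λ) (f : K ⟶ E) (g : E ⟶ Z), Module.Finite Λ K ∧ Module.Finite Λ E ∧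
      IsARSeq Λ f g := by
  have : IsNoetherianRing Λ := IsNoetherianRing.of_finite k Λ
  obtain ⟨E, g, hE, hg, hmin⟩ := exists_minimal_isRightAlmostSplit k hΛ hZ
  have hfac : ∀ (W : ModuleCat.{u} Λ) (x : W ⟶ Z), (¬ ∃ s : Z ⟶ W, s ≫ x = 𝟙 Z) →
      ∃ x' : W ⟶ E, x' ≫ g = x := fun W x hx => hg.exists_fac k hE x hx
  have hepi : Epi g := by
    have hns : ¬ ∃ s : Z ⟶ Projective.over Z, s ≫ Projective.π Z = 𝟙 Z := fun ⟨s, hs⟩ =>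
      hZp (Retract.projective ⟨s, Projective.π Z, hs⟩)
    obtain ⟨x, hx⟩ := hfac _ _ hns
    exact epi_of_epi_fac hx
  let K := ModuleCat.of Λ (LinearMap.ker g.hom)
  let f : K ⟶ E := ModuleCat.ofHom (LinearMap.ker g.hom).subtype
  have hf : Mono f := (ModuleCat.mono_iff_injective f).2 (LinearMap.ker g.hom).injective_subtype
  have hw : f ≫ g = 0 := by
    ext x
    exact x.2
  have hex : (ShortComplex.mk f g hw).Exact := by
    rw [ShortComplex.moduleCat_exact_iff_range_eq_ker]
    exact Submodule.range_subtype _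
  have hS : IsShortExact f g := ⟨hf, hepi, hw, hex⟩
  have hmono : ∀ (A : ModuleCat.{u} Λ) (p : K ⟶ A), (¬ ∃ a : E ⟶ A, f ≫ a = p) → Mono p := by
    intro A p hp
    obtain ⟨P, i, j, q, hP, hfj, hjq⟩ := hS.exists_pushout p
    obtain ⟨q', hq'⟩ := hfac P q fun ⟨s, hs⟩ => by
      obtain ⟨r, hr⟩ := hP.exists_retraction hs
      exact hp ⟨j ≫ r, by rw [reassoc_of% hfj, hr, Category.comp_id]⟩
    have := hmin (j ≫ q') (by rw [Category.assoc, hq', hjq])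
    have hm : Mono (f ≫ j ≫ q') := inferInstance
    rw [reassoc_of% hfj] at hm
    exact mono_of_mono p (i ≫ q')
  refine ⟨K, E, f, g, inferInstanceAs (Module.Finite Λ (LinearMap.ker g.hom)), hE,
    hf, hepi, ⟨hw, hex⟩, ⟨?_, ?_⟩, hZ.2, hg.1, hfac⟩
  · intro hK
    obtain ⟨s, hs⟩ := hS.exists_section (r := 0) (hK.eq_of_src _ _)
    exact hg.1 ⟨s, hs⟩
  · rintro A B ⟨e⟩
    by_cases ha : ∃ a : E ⟶ A, f ≫ a = e.hom ≫ biprod.fst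
    · by_cases hb : ∃ b : E ⟶ B, f ≫ b = e.hom ≫ biprod.snd
      · exfalso
        obtain ⟨a, ha⟩ := ha
        obtain ⟨b, hb⟩ := hb
        refine hg.1 (hS.exists_section (r := biprod.lift a b ≫ e.inv) ?_)
        rw [← Category.assoc, ← cancel_mono e.hom]
        apply biprod.hom_ext <;> simp [ha, hb]
      · left
        have := hmono _ _ hb
        have hm : Mono (biprod.snd : A ⊞ B ⟶ B) := by
          rw [show (biprod.snd : A ⊞ B ⟶ B) = e.inv ≫ e.hom ≫ biprod.snd by simp]
          infer_instance
        have : (biprod.inl : A ⟶ A ⊞ B) = 0 := by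
          rw [← cancel_mono (biprod.snd : A ⊞ B ⟶ B)]; simp
        rw [IsZero.iff_id_eq_zero, ← biprod.inl_fst (X := A) (Y := B), this, zero_comp]
    · right
      have := hmono _ _ ha
      have hm : Mono (biprod.fst : A ⊞ B ⟶ A) := by
        rw [show (biprod.fst : A ⊞ B ⟶ A) = e.inv ≫ e.hom ≫ biprod.fst by simp]
        infer_instance
      have : (biprod.inr : B ⟶ A ⊞ B) = 0 := by
        rw [← cancel_mono (biprod.fst : A ⊞ B ⟶ A)]; simp
      rw [IsZero.iff_id_eq_zero, ← biprod.inr_snd (X := A) (Y := B), this, zero_comp]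

end Existence

section Translation

variable {Λ : Type u} [Ring Λ]

lemma isRepFinite_of_exists_fin
    (h : ∃ (N : ℕ) (ind : Fin N → ModuleCat.{u} Λ),
      ∀ X : ModuleCat.{u} Λ, Module.Finite Λ X → Indec Λ X → ∃ i, Nonempty (X ≅ ind i)) :
    IsRepFinite Λ := by
  obtain ⟨N, ind, h⟩ := h
  refine ⟨{i : Fin N // IsFinIndec (ind i)}, inferInstance, fun i => ind i, fun i => i.2, ?_⟩
  intro Y hY
  obtain ⟨i, ⟨e⟩⟩ := h Y hY.1 hY.2
  have hYf := hY.1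
  exact ⟨⟨i, Module.Finite.equiv e.toLinearEquiv, hY.2.of_iso e⟩, ⟨e⟩⟩

lemma injective_of_finite_projective (hΛ : Injective (ModuleCat.of Λ Λ)) {P : ModuleCat.{u} Λ}
    (hP : Module.Finite Λ P) (hP' : Projective P) : Injective P := by
  obtain ⟨n, π, hπ⟩ := Module.Finite.exists_fin' Λ P
  let q : ModuleCat.of Λ (Fin n → Λ) ⟶ P := ModuleCat.ofHom π
  have hq : Epi q := (ModuleCat.epi_iff_surjective q).2 hπ
  have hinj : Injective (ModuleCat.of Λ (Fin n → Λ)) :=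
    Injective.of_iso (ModuleCat.biproductIsoPi fun _ : Fin n => ModuleCat.of Λ Λ) inferInstance
  exact Retract.injective ⟨Projective.factorThru (𝟙 P) q, q, by simp⟩

/-- Representatives of the isomorphism classes of finitely generated non-projective indecomposable
modules, together with the almost split sequences ending at them and the Auslander-Reiten
translation. -/
structure AlmostSplitSystem (Λ : Type u) [Ring Λ] where
  /-- the index set -/
  J : Type
  finite : Finite J
  /-- the representatives -/
  X : J → ModuleCat.{u} Λ
  isFinIndec : ∀ j, IsFinIndec (X j)
  not_projective : ∀ j, ¬ Projective (X j)
  eq_of_iso : ∀ i j, Nonempty (X i ≅ X j) → i = j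
  exists_iso : ∀ Y : ModuleCat.{u} Λ, IsFinIndec Y → ¬ Projective Y → ∃ j, Nonempty (Y ≅ X j)
  /-- the Auslander-Reiten translation -/
  τ : Equiv.Perm J
  /-- the middle terms -/
  E : J → ModuleCat.{u} Λ
  finite_E : ∀ j, Module.Finite Λ (E j)
  /-- the left almost split maps -/
  f : ∀ j, X (τ j) ⟶ E j
  /-- the right almost split maps -/
  g : ∀ j, E j ⟶ X j
  isARSeq : ∀ j, IsARSeq Λ (f j) (g j)

theorem nonempty_almostSplitSystem (k : Type u) [Field k] [Algebra k Λ] [FiniteDimensional k Λ]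
    (hΛ : IsRepFinite Λ) (hinj : Injective (ModuleCat.of Λ Λ)) :
    Nonempty (AlmostSplitSystem Λ) := by
  have : IsArtinianRing Λ := IsArtinianRing.of_finite k Λ
  obtain ⟨I, _, X₀, hX₀, hcov⟩ := id hΛ
  let s : Setoid {i : I // ¬ Projective (X₀ i)} :=
    { r := fun i j => Nonempty (X₀ i ≅ X₀ j)
      iseqv := ⟨fun _ => ⟨Iso.refl _⟩, fun ⟨e⟩ => ⟨e.symm⟩, fun ⟨e⟩ ⟨e'⟩ => ⟨e ≪≫ e'⟩⟩ }
  let J := Quotient s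
  let X : J → ModuleCat.{u} Λ := fun j => X₀ j.out
  have hX : ∀ j, IsFinIndec (X j) := fun j => hX₀ _
  have hXp : ∀ j, ¬ Projective (X j) := fun j => j.out.2
  have heq : ∀ i j, Nonempty (X i ≅ X j) → i = j := fun i j h => Quotient.out_equiv_out.1 h
  have hex : ∀ Y : ModuleCat.{u} Λ, IsFinIndec Y → ¬ Projective Y →
      ∃ j, Nonempty (Y ≅ X j) := by
    intro Y hY hYp
    obtain ⟨i, ⟨e⟩⟩ := hcov Y hY
    have hi : ¬ Projective (X₀ i) := fun h => hYp (Projective.of_iso e.symm h)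
    obtain ⟨e'⟩ : Nonempty (X₀ i ≅ X (Quotient.mk s ⟨i, hi⟩)) :=
      Setoid.symm (Quotient.mk_out (s := s) ⟨i, hi⟩)
    exact ⟨_, ⟨e ≪≫ e'⟩⟩
  have hAR : ∀ j, ∃ (i : J) (E : ModuleCat.{u} Λ) (f : X i ⟶ E) (g : E ⟶ X j),
      Module.Finite Λ E ∧ IsARSeq Λ f g := by
    intro j
    obtain ⟨K, E, f, g, hK, hE, h⟩ := exists_isARSeq k hΛ (hX j) (hXp j)
    obtain ⟨i, ⟨e⟩⟩ := hex K ⟨hK, h.indec_left⟩ fun hp =>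
      h.not_injective (injective_of_finite_projective hinj hK hp)
    exact ⟨i, E, e.symm.hom ≫ f, g, hE, h.of_iso_left e.symm⟩
  choose σ E f g hE hfg using hAR
  have hσ : Function.Injective σ := by
    intro i j hij
    have hi := hfg i
    revert hi
    generalize f i = fi
    revert fi
    rw [hij]
    intro fi hi
    exact heq _ _ (hi.nonempty_iso_right (hX _).1 (hX _).1 (hfg j))
  exact ⟨{ J := J
           finite := inferInstance
           X := X
           isFinIndec := hX
           not_projective := hXp
           eq_of_iso := heq
           exists_iso := hex
           τ := Equiv.ofBijective σ (Finite.injective_iff_bijective.1 hσ)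
           E := E
           finite_E := hE
           f := f
           g := g
           isARSeq := hfg }⟩

namespace AlmostSplitSystem

variable (D : AlmostSplitSystem Λ)

lemma sameCycle_of_sameTauOrbit [IsArtinianRing Λ] {A B : ModuleCat.{u} Λ}
    (h : SameTauOrbit Λ A B) :
    (∀ i, Nonempty (A ≅ D.X i) → ∃ j, Nonempty (B ≅ D.X j) ∧ D.τ.SameCycle i j) ∧
      ∀ j, Nonempty (B ≅ D.X j) → ∃ i, Nonempty (A ≅ D.X i) ∧ D.τ.SameCycle i j := by
  induction h with
  | rel A B h =>
    rcases h with ⟨⟨e⟩⟩ | ⟨Y, f, g, h⟩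
    · exact ⟨fun i ⟨e'⟩ => ⟨i, ⟨e.symm ≪≫ e'⟩, .refl _ _⟩,
        fun i ⟨e'⟩ => ⟨i, ⟨e ≪≫ e'⟩, .refl _ _⟩⟩
    · constructor
      · rintro i ⟨e⟩
        obtain ⟨j, rfl⟩ := D.τ.surjective i
        obtain ⟨e'⟩ := (D.isARSeq j).nonempty_iso_right (D.isFinIndec _).1 (D.isFinIndec _).1
          (h.of_iso_left e.symm)
        exact ⟨j, ⟨e'.symm⟩, Equiv.Perm.sameCycle_apply_left.2 (.refl _ _)⟩
      · rintro j ⟨e⟩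
        obtain ⟨e'⟩ := (D.isARSeq j).nonempty_iso_left (D.isFinIndec _).1 (h.of_iso_right e)
        exact ⟨D.τ j, ⟨e'.symm⟩, Equiv.Perm.sameCycle_apply_left.2 (.refl _ _)⟩
  | refl A => exact ⟨fun i h => ⟨i, h, .refl _ _⟩, fun i h => ⟨i, h, .refl _ _⟩⟩
  | symm A B _ ih =>
    refine ⟨fun i h => ?_, fun i h => ?_⟩
    · obtain ⟨j, hj, hij⟩ := ih.2 i h
      exact ⟨j, hj, hij.symm⟩
    · obtain ⟨j, hj, hij⟩ := ih.1 i h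
      exact ⟨j, hj, hij.symm⟩
  | trans A B C _ _ ih₁ ih₂ =>
    refine ⟨fun i h => ?_, fun i h => ?_⟩
    · obtain ⟨j, hj, hij⟩ := ih₁.1 i h
      obtain ⟨l, hl, hjl⟩ := ih₂.1 j hj
      exact ⟨l, hl, hij.trans hjl⟩
    · obtain ⟨j, hj, hij⟩ := ih₂.2 i h
      obtain ⟨l, hl, hjl⟩ := ih₁.2 j hj
      exact ⟨l, hl, hjl.trans hij⟩

/-- The `n`-th translate of `X j` belongs to `S`. -/
def Layer (S : Set (ModuleCat.{u} Λ)) (n : ℕ) (j : D.J) : Prop :=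
  ∃ Y ∈ S, Nonempty (D.X ((D.τ ^ n) j) ≅ Y)

lemma layer_succ_iff (S : Set (ModuleCat.{u} Λ)) (n : ℕ) (j : D.J) :
    D.Layer S (n + 1) j ↔ D.Layer S n (D.τ j) := by
  rw [Layer, Layer, pow_succ, Equiv.Perm.mul_apply]

lemma exists_layer [IsArtinianRing Λ] {S : Set (ModuleCat.{u} Λ)} (hS : IsCompleteSlice Λ S)
    (j : D.J) : ∃ n, D.Layer S n j := by
  have := D.finite
  obtain ⟨Y, hY, h⟩ := hS.2.1 _ (D.isFinIndec j).1 (D.isFinIndec j).2 (D.not_projective j)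
  obtain ⟨i, ⟨e⟩, hi⟩ := (D.sameCycle_of_sameTauOrbit h).1 j ⟨Iso.refl _⟩
  obtain ⟨n, hn⟩ := hi.exists_nat_pow_eq
  exact ⟨n, Y, hY, ⟨by rw [hn]; exact e.symm⟩⟩

/-- `X a` is a direct summand of the middle term of the almost split sequence ending at `X j`. -/
def Arrow (a j : D.J) : Prop := ∃ (i : D.X a ⟶ D.E j) (p : D.E j ⟶ D.X a), i ≫ p = 𝟙 (D.X a)

variable {D}

lemma Arrow.exists_isIrred [IsArtinianRing Λ] {a j : D.J} (h : D.Arrow a j) :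
    ∃ u : D.X (D.τ j) ⟶ D.X a, IsIrred Λ u := by
  obtain ⟨i, p, hip⟩ := h
  exact ⟨_, (D.isARSeq j).isIrred_comp (D.isFinIndec _).1 (D.isFinIndec _).1
    (D.isFinIndec a).2.1 hip⟩

lemma Arrow.rotate [IsArtinianRing Λ] {a j : D.J} (h : D.Arrow a j) : D.Arrow (D.τ j) a := by
  obtain ⟨u, hu⟩ := h.exists_isIrred
  exact (D.isARSeq a).exists_retract_of_isIrred hu

lemma Arrow.translate [IsArtinianRing Λ] {a j : D.J} (h : D.Arrow a j) (n : ℕ) :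
    D.Arrow ((D.τ ^ n) a) ((D.τ ^ n) j) := by
  induction n with
  | zero => exact h
  | succ n ih => rw [pow_succ']; exact ih.rotate.rotate

lemma Arrow.layer [IsArtinianRing Λ] {S : Set (ModuleCat.{u} Λ)} (hS : IsCompleteSlice Λ S)
    {a j : D.J} (h : D.Arrow a j) {n : ℕ} (hj : D.Layer S (n + 1) j) :
    D.Layer S n a ∨ D.Layer S (n + 1) a := by
  obtain ⟨u, hu⟩ := (h.translate n).exists_isIrred
  obtain ⟨Y, hY, ⟨e⟩⟩ := hj
  rw [pow_succ', Equiv.Perm.mul_apply] at e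
  rcases hS.2.2.2 Y hY _ (D.isFinIndec ((D.τ ^ n) a)).1 (D.isFinIndec _).2 (D.not_projective _)
    ⟨_, hu.iso_comp e.symm⟩ with h' | ⟨Z, hZ, E, f, g, h'⟩
  · exact Or.inl h'
  · right
    obtain ⟨e'⟩ := (D.isARSeq ((D.τ ^ n) a)).nonempty_iso_left (D.isFinIndec _).1 h'
    refine ⟨Z, hZ, ⟨?_⟩⟩
    rw [pow_succ', Equiv.Perm.mul_apply]
    exact e'

end AlmostSplitSystem

end Translation

section HomFunctor

open scoped ModuleCat

variable {Λ : Type u} [Ring Λ]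

/-- The functor `Hom(M, -)` with values in modules over the endomorphism ring of `M`. -/
noncomputable def homFunctor (M : ModuleCat.{u} Λ) :
    ModuleCat.{u} Λ ⥤ ModuleCat.{u} (End (op M)) :=
  opOp (ModuleCat.{u} Λ) ⋙ preadditiveYonedaObj (op M)

variable (M : ModuleCat.{u} Λ)

instance : (homFunctor M).Additive where
  map_add {X Y f g} := by
    apply ModuleCat.hom_ext
    ext x
    exact Preadditive.add_comp (op Y) (op X) (op M) f.op g.op x

variable {M}

lemma homFunctor_map_injective {X Y : ModuleCat.{u} Λ} (f : X ⟶ Y) [Mono f] :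
    Function.Injective ((homFunctor M).map f).hom := by
  intro x y hxy
  exact (cancel_epi f.op).1 hxy

lemma homFunctor_map_exact {X Y Z : ModuleCat.{u} Λ} {f : X ⟶ Y} {g : Y ⟶ Z}
    (h : IsShortExact f g) :
    Function.Exact ((homFunctor M).map f).hom ((homFunctor M).map g).hom := by
  intro y
  constructor
  · intro hy
    have hy' : (show op Y ⟶ op M from y).unop ≫ g = 0 := congrArg Quiver.Hom.unop hy
    obtain ⟨x, hx⟩ := h.exists_lift _ hy'
    exact ⟨x.op, congrArg Quiver.Hom.op hx⟩
  · rintro ⟨x, rfl⟩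
    change g.op ≫ f.op ≫ (show op X ⟶ op M from x) = 0
    rw [← Category.assoc, ← op_comp, h.zero, op_zero, zero_comp]

lemma homFunctor_shortExact {X Y Z : ModuleCat.{u} Λ} {f : X ⟶ Y} {g : Y ⟶ Z}
    (h : IsShortExact f g) (hM : ∀ x : M ⟶ Z, ∃ y : M ⟶ Y, y ≫ g = x) :
    ∃ w : (homFunctor M).map f ≫ (homFunctor M).map g = 0,
      (ShortComplex.mk ((homFunctor M).map f) ((homFunctor M).map g) w).ShortExact := by
  have := h.1
  refine ⟨by rw [← Functor.map_comp, h.zero, Functor.map_zero],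
    ModuleCat.shortComplex_shortExact _ (homFunctor_map_exact h) (homFunctor_map_injective f) ?_⟩
  intro x
  obtain ⟨y, hy⟩ := hM (show op Z ⟶ op M from x).unop
  exact ⟨y.op, congrArg Quiver.Hom.op hy⟩

lemma projective_homFunctor_self : Projective ((homFunctor M).obj M) :=
  (IsProjective.iff_projective (R := End (op M)) (End (op M))).1 inferInstance

lemma projective_homFunctor_biproduct {X : ModuleCat.{u} Λ}
    (hX : Projective ((homFunctor M).obj X)) (r : ℕ) :
    Projective ((homFunctor M).obj (⨁ fun _ : Fin r => X)) := by
  have : Projective (⨁ fun _ : Fin r => (homFunctor M).obj X) := ⟨fun f e _ =>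
    ⟨biproduct.desc fun b => Projective.factorThru
      (biproduct.ι (fun _ : Fin r => (homFunctor M).obj X) b ≫ f) e, by
      apply biproduct.hom_ext'
      simp⟩⟩
  exact Projective.of_iso ((homFunctor M).mapBiproduct fun _ : Fin r => X).symm this

lemma InAdd.projective_homFunctor {X : ModuleCat.{u} Λ} (hX : InAdd Λ M X) :
    Projective ((homFunctor M).obj X) := by
  obtain ⟨r, Y, ⟨e⟩⟩ := hX
  have := projective_homFunctor_biproduct (projective_homFunctor_self (M := M)) r
  have : Projective ((homFunctor M).obj (X ⊞ Y)) :=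
    Projective.of_iso ((homFunctor M).mapIso e).symm inferInstance
  exact Retract.projective ((⟨biprod.inl, biprod.fst, by simp⟩ : Retract X (X ⊞ Y)).map _)

lemma projective_homFunctor_of_projective (hM : InAdd Λ M (ModuleCat.of Λ Λ))
    {P : ModuleCat.{u} Λ} (hP : Module.Finite Λ P) (hP' : Projective P) :
    Projective ((homFunctor M).obj P) := by
  obtain ⟨n, π, hπ⟩ := Module.Finite.exists_fin' Λ P
  let q : ModuleCat.of Λ (Fin n → Λ) ⟶ P := ModuleCat.ofHom π
  have hq : Epi q := (ModuleCat.epi_iff_surjective q).2 hπ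
  have := projective_homFunctor_biproduct hM.projective_homFunctor n
  have : Projective ((homFunctor M).obj (ModuleCat.of Λ (Fin n → Λ))) :=
    Projective.of_iso ((homFunctor M).mapIso
      (ModuleCat.biproductIsoPi fun _ : Fin n => ModuleCat.of Λ Λ)) inferInstance
  exact Retract.projective
    ((⟨Projective.factorThru (𝟙 P) q, q, by simp⟩ : Retract P _).map (homFunctor M))

/-- If `Hom(M, Z)` is not projective, then every map from `M` to `Z` factors through the almost
split map ending at `Z`. -/
lemma IsARSeq.exists_fac_of_not_projective {X Y Z : ModuleCat.{u} Λ} {f : X ⟶ Y} {g : Y ⟶ Z}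
    (h : IsARSeq Λ f g) (hZ : ¬ Projective ((homFunctor M).obj Z)) (x : M ⟶ Z) :
    ∃ y : M ⟶ Y, y ≫ g = x := by
  refine h.exists_fac x fun ⟨s, hs⟩ => hZ ?_
  have := projective_homFunctor_self (M := M)
  exact Retract.projective ((⟨s, x, hs⟩ : Retract Z M).map (homFunctor M))

/-- An endomorphism of `M`, as an element of the endomorphism ring of `op M`. -/
def opEnd (x : M ⟶ M) : End (op M) := x.op

lemma opEnd_smul (k : Type u) [Field k] [Algebra k Λ] (c : k) (x : M ⟶ M) :
    opEnd (c • x) = opEnd (c • 𝟙 M) * opEnd x := by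
  change (c • x).op = x.op ≫ (c • 𝟙 M).op
  rw [← op_comp]
  simp

variable (M) in
lemma isNoetherianRing_end (k : Type u) [Field k] [Algebra k Λ] [FiniteDimensional k Λ]
    [Module.Finite Λ M] : IsNoetherianRing (End (op M)) := by
  rw [isNoetherianRing_iff_ideal_fg]
  intro I
  have := finiteDimensional_hom k M M
  let V : Submodule k (M ⟶ M) :=
    { carrier := {x | opEnd x ∈ I}
      add_mem' := fun {a b} ha hb => I.add_mem ha hb
      zero_mem' := I.zero_mem
      smul_mem' := fun c x hx => by
        change opEnd (c • x) ∈ I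
        rw [opEnd_smul]
        exact I.mul_mem_left _ hx }
  obtain ⟨s, hs⟩ := IsNoetherian.noetherian V
  classical
  refine ⟨s.image opEnd, le_antisymm ?_ ?_⟩
  · rw [Submodule.span_le]
    intro y hy
    obtain ⟨x, hx, rfl⟩ := Finset.mem_image.1 (Finset.mem_coe.1 hy)
    have : x ∈ V := hs ▸ Submodule.subset_span hx
    exact this
  · intro y hy
    have hyV : y.unop ∈ Submodule.span k (s : Set (M ⟶ M)) := by rw [hs]; exact hy
    have key : ∀ z ∈ Submodule.span k (s : Set (M ⟶ M)),
        opEnd z ∈ Submodule.span (End (op M)) (s.image opEnd : Set (End (op M))) := by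
      intro z hz
      induction hz using Submodule.span_induction with
      | mem x hx => exact Submodule.subset_span (Finset.mem_coe.2 (Finset.mem_image_of_mem _ hx))
      | zero => exact Submodule.zero_mem _
      | add x y _ _ hx hy => exact Submodule.add_mem _ hx hy
      | smul c x _ hx =>
        rw [opEnd_smul]
        exact Submodule.smul_mem _ _ hx
    exact key _ hyV

end HomFunctor

section HaradaSai

open scoped ModuleCat

variable {Λ : Type u} [Ring Λ]

/-- Maps which are composed of `2 ^ m - 1` non-isomorphisms between objects satisfying `C`. -/
inductive IsLongComposite (C : ModuleCat.{u} Λ → Prop) :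
    ℕ → ∀ {A B : ModuleCat.{u} Λ}, (A ⟶ B) → Prop
  | id (A : ModuleCat.{u} Λ) (hA : C A) : IsLongComposite C 0 (𝟙 A)
  | comp (m : ℕ) {A B X Y : ModuleCat.{u} Λ} (p : A ⟶ X) (h : X ⟶ Y) (q : Y ⟶ B)
      (hp : IsLongComposite C m p) (hq : IsLongComposite C m q) (hX : C X) (hY : C Y)
      (hh : ¬ IsIso h) : IsLongComposite C (m + 1) (p ≫ h ≫ q)

lemma apply_eq_zero_and_exists_of_finrank_le {k U V W : Type*} [Field k] [AddCommGroup U]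
    [Module k U] [AddCommGroup V] [Module k V] [AddCommGroup W] [Module k W]
    [FiniteDimensional k U] [FiniteDimensional k V] {r : ℕ} (A : U →ₗ[k] V) (B : V →ₗ[k] W)
    (h : r ≤ Module.finrank k (LinearMap.range (B ∘ₗ A)))
    (hA : Module.finrank k (LinearMap.range A) ≤ r)
    (hB : Module.finrank k (LinearMap.range B) ≤ r) :
    (∀ u, B (A u) = 0 → A u = 0) ∧ ∀ v, ∃ u, B v = B (A u) := by
  constructor
  · have h1 := LinearMap.finrank_range_add_finrank_ker (B.domRestrict (LinearMap.range A))
    have h2 : LinearMap.range (B.domRestrict (LinearMap.range A)) = LinearMap.range (B ∘ₗ A) := by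
      ext w
      simp
    rw [h2] at h1
    have h3 : LinearMap.ker (B.domRestrict (LinearMap.range A)) = ⊥ :=
      Submodule.finrank_eq_zero.1 (by omega)
    intro u hu
    have h4 : (⟨A u, u, rfl⟩ : LinearMap.range A) ∈
        LinearMap.ker (B.domRestrict (LinearMap.range A)) := hu
    rw [h3, Submodule.mem_bot] at h4
    exact congrArg Subtype.val h4
  · have h1 : LinearMap.range (B ∘ₗ A) = LinearMap.range B :=
      Submodule.eq_of_le_of_finrank_le (LinearMap.range_comp_le_range A B) (hB.trans h)
    intro v
    have h2 : B v ∈ LinearMap.range (B ∘ₗ A) := h1 ▸ ⟨v, rfl⟩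
    obtain ⟨u, hu⟩ := h2
    exact ⟨u, hu.symm⟩

/-- The dimension of the image of a map of modules over an algebra. -/
noncomputable def imageDim (k : Type u) [Field k] [Algebra k Λ] {A B : ModuleCat.{u} Λ}
    (g : A ⟶ B) : ℕ :=
  Module.finrank k (LinearMap.range (g.hom.restrictScalars k))

variable (k : Type u) [Field k] [Algebra k Λ]

lemma imageDim_comp_le_left {A B X : ModuleCat.{u} Λ} [FiniteDimensional k A] (g : A ⟶ B)
    (h : B ⟶ X) : imageDim k (g ≫ h) ≤ imageDim k g := by
  unfold imageDim
  change Module.finrank k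
    (LinearMap.range (h.hom.restrictScalars k ∘ₗ g.hom.restrictScalars k)) ≤ _
  rw [LinearMap.range_comp]
  exact Submodule.finrank_map_le _ _

lemma imageDim_comp_le_right {A B X : ModuleCat.{u} Λ} [FiniteDimensional k B] (g : A ⟶ B)
    (h : B ⟶ X) : imageDim k (g ≫ h) ≤ imageDim k h :=
  Submodule.finrank_mono (LinearMap.range_comp_le_range (g.hom.restrictScalars k)
    (h.hom.restrictScalars k))

variable {k} in
lemma Indec.injective_and_surjective_of_imageDim {A B X : ModuleCat.{u} Λ} (hB : Indec Λ B)
    [FiniteDimensional k A] [FiniteDimensional k B] {r : ℕ} (hr : 0 < r) {g : A ⟶ B} {h : B ⟶ X}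
    (hgh : r ≤ imageDim k (g ≫ h)) (hg : imageDim k g ≤ r) (hh : imageDim k h ≤ r) :
    Function.Injective h.hom ∧ Function.Surjective g.hom := by
  obtain ⟨h1, h2⟩ := apply_eq_zero_and_exists_of_finrank_le (g.hom.restrictScalars k)
    (h.hom.restrictScalars k) hgh hg hh
  have hc : IsCompl (LinearMap.range g.hom) (LinearMap.ker h.hom) := by
    constructor
    · rw [Submodule.disjoint_def]
      rintro _ ⟨a, rfl⟩ ha
      exact h1 a ha
    · rw [codisjoint_iff, eq_top_iff]
      intro b _
      obtain ⟨a, ha⟩ := h2 b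
      rw [← add_sub_cancel (g.hom a) b]
      refine Submodule.add_mem_sup ⟨a, rfl⟩ ?_
      rw [LinearMap.mem_ker, map_sub, sub_eq_zero]
      exact ha
  rcases hB.eq_bot_or_eq_bot_of_isCompl hc with h0 | h0
  · exfalso
    have hg0 : g.hom = 0 := LinearMap.range_eq_bot.1 h0
    have : imageDim k (g ≫ h) = 0 := by
      have h' : LinearMap.range ((g ≫ h).hom.restrictScalars k) = ⊥ :=
        LinearMap.range_eq_bot.2 (LinearMap.ext fun x => by
          change h.hom (g.hom x) = 0
          rw [hg0, LinearMap.zero_apply, map_zero])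
      exact Submodule.finrank_eq_zero.2 h'
    omega
  · refine ⟨LinearMap.ker_eq_bot.1 h0, LinearMap.range_eq_top.1 ?_⟩
    rw [← hc.sup_eq_top, h0, sup_bot_eq]

/-- The lemma of Harada and Sai. -/
theorem IsLongComposite.imageDim_le [FiniteDimensional k Λ] (b : ℕ) {m : ℕ}
    {A B : ModuleCat.{u} Λ} {g : A ⟶ B}
    (hg : IsLongComposite (fun X => IsFinIndec X ∧ Module.finrank k X ≤ b) m g) :
    Module.Finite Λ A ∧ Module.Finite Λ B ∧ imageDim k g ≤ b - m := by
  induction hg with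
  | id A hA =>
    have := hA.1.1
    have : FiniteDimensional k A := Module.Finite.trans Λ A
    exact ⟨hA.1.1, hA.1.1, (Submodule.finrank_le _).trans hA.2⟩
  | @comp m A B X Y p h q _ _ hX hY hh ihp ihq =>
    refine ⟨ihp.1, ihq.2.1, ?_⟩
    by_contra hlt
    have := ihp.1
    have := ihq.2.1
    have := hX.1.1
    have := hY.1.1
    have : FiniteDimensional k A := Module.Finite.trans Λ A
    have : FiniteDimensional k B := Module.Finite.trans Λ B
    have : FiniteDimensional k X := Module.Finite.trans Λ X
    have : FiniteDimensional k Y := Module.Finite.trans Λ Y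
    have hr : 0 < b - m := by
      have h1 := imageDim_comp_le_left k p (h ≫ q)
      have h2 := ihp.2.2
      omega
    have h1 := hX.1.2.injective_and_surjective_of_imageDim (k := k) hr (g := p) (h := h ≫ q)
      (by omega) ihp.2.2 ((imageDim_comp_le_right k h q).trans ihq.2.2)
    have h2 := hY.1.2.injective_and_surjective_of_imageDim (k := k) hr (g := p ≫ h) (h := q)
      (by rw [Category.assoc]; omega) ((imageDim_comp_le_left k p h).trans ihp.2.2) ihq.2.2
    refine hh ((ConcreteCategory.isIso_iff_bijective h).2 ⟨?_, ?_⟩)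
    · exact Function.Injective.of_comp (f := ⇑q.hom) h1.1
    · exact Function.Surjective.of_comp (g := ⇑p.hom) h2.2

lemma IsLongComposite.eq_zero [FiniteDimensional k Λ] {b : ℕ} {A B : ModuleCat.{u} Λ} {g : A ⟶ B}
    (hg : IsLongComposite (fun X => IsFinIndec X ∧ Module.finrank k X ≤ b) b g) : g = 0 := by
  obtain ⟨_, hB, h⟩ := hg.imageDim_le k b
  have : FiniteDimensional k B := Module.Finite.trans Λ B
  have h0 : LinearMap.range (g.hom.restrictScalars k) = ⊥ :=
    Submodule.finrank_eq_zero.1 (by unfold imageDim at h; omega)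
  have h1 := LinearMap.range_eq_bot.1 h0
  apply ModuleCat.hom_ext
  ext x
  exact LinearMap.congr_fun h1 x

end HaradaSai

section LayerDimension

open scoped ModuleCat

variable {Λ : Type u} [Ring Λ] {M : ModuleCat.{u} Λ}

/-- The action of a map `f` on `Ext` groups of modules of the form `Hom(M, -)`. -/
noncomputable def extPullback {X Y : ModuleCat.{u} Λ} (f : X ⟶ Y)
    {N : ModuleCat.{u} (End (op M))} {m : ℕ} (α : Abelian.Ext ((homFunctor M).obj Y) N m) :
    Abelian.Ext ((homFunctor M).obj X) N m :=
  (Abelian.Ext.mk₀ ((homFunctor M).map f)).comp α (zero_add m)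

variable {N : ModuleCat.{u} (End (op M))} {m : ℕ}

lemma extPullback_comp {X Y Z : ModuleCat.{u} Λ} (f : X ⟶ Y) (g : Y ⟶ Z)
    (α : Abelian.Ext ((homFunctor M).obj Z) N m) :
    extPullback (f ≫ g) α = extPullback f (extPullback g α) := by
  unfold extPullback
  rw [Abelian.Ext.mk₀_comp_mk₀_assoc, Functor.map_comp]

lemma extPullback_id {X : ModuleCat.{u} Λ} (α : Abelian.Ext ((homFunctor M).obj X) N m) :
    extPullback (𝟙 X) α = α := by
  unfold extPullback
  rw [CategoryTheory.Functor.map_id, Abelian.Ext.mk₀_id_comp]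

lemma extPullback_zero {X Y : ModuleCat.{u} Λ} (α : Abelian.Ext ((homFunctor M).obj Y) N m) :
    extPullback (0 : X ⟶ Y) α = 0 := by
  unfold extPullback
  rw [Functor.map_zero, Abelian.Ext.mk₀_zero, Abelian.Ext.zero_comp]

lemma extPullback_map_zero {X Y : ModuleCat.{u} Λ} (f : X ⟶ Y) :
    extPullback f (0 : Abelian.Ext ((homFunctor M).obj Y) N m) = 0 := by
  unfold extPullback
  rw [Abelian.Ext.comp_zero]

lemma extPullback_add {X Y : ModuleCat.{u} Λ} (f g : X ⟶ Y)
    (α : Abelian.Ext ((homFunctor M).obj Y) N m) :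
    extPullback (f + g) α = extPullback f α + extPullback g α := by
  unfold extPullback
  rw [Functor.map_add, Abelian.Ext.mk₀_add, Abelian.Ext.add_comp]

lemma exists_summand_of_ne_zero [IsArtinianRing Λ] {W : ModuleCat.{u} Λ} (hW : Module.Finite Λ W)
    {α : Abelian.Ext ((homFunctor M).obj W) N m} (hα : α ≠ 0) :
    ∃ (A : ModuleCat.{u} Λ) (i : A ⟶ W) (p : W ⟶ A), IsFinIndec A ∧ i ≫ p = 𝟙 A ∧
      extPullback i α ≠ 0 := by
  revert α
  refine finite_induction (fun W => ∀ {α : Abelian.Ext ((homFunctor M).obj W) N m}, α ≠ 0 →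
    ∃ (A : ModuleCat.{u} Λ) (i : A ⟶ W) (p : W ⟶ A), IsFinIndec A ∧ i ≫ p = 𝟙 A ∧
      extPullback i α ≠ 0) ?_ ?_ ?_ ?_ W hW
  · intro X Y e hX α hα
    have : extPullback e.hom α ≠ 0 := fun h => hα <| by
      rw [← extPullback_id α, ← e.inv_hom_id, extPullback_comp, h, extPullback_map_zero]
    obtain ⟨A, i, p, hA, hip, h⟩ := hX this
    exact ⟨A, i ≫ e.hom, e.inv ≫ p, hA, by simpa using hip, by rwa [extPullback_comp]⟩
  · intro X hX α hα
    refine (hα ?_).elim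
    rw [← extPullback_id α, hX.eq_of_src (𝟙 X) 0, extPullback_zero]
  · intro X Y _ _ hX hY α hα
    by_cases h : extPullback biprod.inl α = 0
    · have : extPullback biprod.inr α ≠ 0 := fun h' => hα <| by
        rw [← extPullback_id α, ← biprod.total, extPullback_add, extPullback_comp,
          extPullback_comp, h, h', extPullback_map_zero, extPullback_map_zero, add_zero]
      obtain ⟨A, i, p, hA, hip, h⟩ := hY this
      exact ⟨A, i ≫ biprod.inr, biprod.snd ≫ p, hA, by simpa using hip, by
        rwa [extPullback_comp]⟩
    · obtain ⟨A, i, p, hA, hip, h⟩ := hX h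
      exact ⟨A, i ≫ biprod.inl, biprod.fst ≫ p, hA, by simpa using hip, by
        rwa [extPullback_comp]⟩
  · intro X hX hX' α hα
    exact ⟨X, 𝟙 X, 𝟙 X, ⟨hX, hX'⟩, by simp, by rwa [extPullback_id]⟩

lemma eq_zero_of_projective {P : ModuleCat.{u} (End (op M))} (hP : Projective P) (hm : 1 ≤ m)
    (α : Abelian.Ext P N m) : α = 0 :=
  have := projective_iff_hasProjectiveDimensionLT_one.1 hP
  α.eq_zero_of_hasProjectiveDimensionLT 1 hm

namespace AlmostSplitSystem

variable (D : AlmostSplitSystem Λ) [IsArtinianRing Λ] {S : Set (ModuleCat.{u} Λ)}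

lemma exists_arrow_of_ne_zero (hM : InAdd Λ M (ModuleCat.of Λ Λ)) (hS : IsCompleteSlice Λ S) {n : ℕ}
    (ih : ∀ j, D.Layer S n j → HasProjectiveDimensionLT ((homFunctor M).obj (D.X j)) (n + 1))
    {j : D.J} (hj : D.Layer S (n + 1) j) (hm : n + 2 ≤ m)
    {α : Abelian.Ext ((homFunctor M).obj (D.X j)) N m} (hα : α ≠ 0) :
    ∃ (a : D.J) (v : D.X a ⟶ D.X j), D.Layer S (n + 1) a ∧ ¬ IsIso v ∧ extPullback v α ≠ 0 := by
  have hAR := D.isARSeq j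
  have hβ : extPullback (D.g j) α ≠ 0 := by
    intro h0
    have hp : ¬ Projective ((homFunctor M).obj (D.X j)) := fun hp =>
      hα (eq_zero_of_projective hp (by omega) α)
    obtain ⟨w, hw⟩ := homFunctor_shortExact hAR.isShortExact (hAR.exists_fac_of_not_projective hp)
    obtain ⟨m, rfl⟩ : ∃ m', m = 1 + m' := ⟨m - 1, by omega⟩
    obtain ⟨x, rfl⟩ := Abelian.Ext.contravariant_sequence_exact₃ hw N α h0 (n₀ := m) rfl
    have := ih _ ((D.layer_succ_iff S n j).1 hj)
    refine hα ?_
    rw [x.eq_zero_of_hasProjectiveDimensionLT (n + 1) (by omega), Abelian.Ext.comp_zero]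
  obtain ⟨A, i, p, hA, hip, h⟩ := exists_summand_of_ne_zero (D.finite_E j) hβ
  have hAp : ¬ Projective A := fun hp => h (eq_zero_of_projective
    (projective_homFunctor_of_projective hM hA.1 hp) (by omega) _)
  obtain ⟨a, ⟨e⟩⟩ := D.exists_iso A hA hAp
  have hγ : extPullback (e.inv ≫ i) (extPullback (D.g j) α) ≠ 0 := fun h0 => h <| by
    rw [← Category.id_comp i, ← e.hom_inv_id, Category.assoc, extPullback_comp, h0,
      extPullback_map_zero]
  have harr : D.Arrow a j := ⟨e.inv ≫ i, p ≫ e.hom, by simp [reassoc_of% hip]⟩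
  refine ⟨a, (e.inv ≫ i) ≫ D.g j, ?_, ?_, by rwa [extPullback_comp]⟩
  · refine (harr.layer hS hj).resolve_left fun hn => hγ ?_
    have := ih a hn
    exact Abelian.Ext.eq_zero_of_hasProjectiveDimensionLT _ (n + 1) (by omega)
  · intro hiso
    exact hAR.not_section ⟨inv ((e.inv ≫ i) ≫ D.g j) ≫ e.inv ≫ i, by simp⟩

lemma exists_isLongComposite_of_ne_zero (hM : InAdd Λ M (ModuleCat.of Λ Λ))
    (hS : IsCompleteSlice Λ S) {n : ℕ}
    (ih : ∀ j, D.Layer S n j → HasProjectiveDimensionLT ((homFunctor M).obj (D.X j)) (n + 1))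
    (hm : n + 2 ≤ m) {C : ModuleCat.{u} Λ → Prop} (hC : ∀ j, C (D.X j)) (r : ℕ) {j : D.J}
    (hj : D.Layer S (n + 1) j) {α : Abelian.Ext ((homFunctor M).obj (D.X j)) N m} (hα : α ≠ 0) :
    ∃ (a : D.J) (v : D.X a ⟶ D.X j), D.Layer S (n + 1) a ∧ IsLongComposite C r v ∧
      extPullback v α ≠ 0 := by
  induction r generalizing j with
  | zero => exact ⟨j, 𝟙 _, hj, .id _ (hC j), by rwa [extPullback_id]⟩
  | succ r ih' =>
    obtain ⟨b, q, hb, hq, h⟩ := ih' hj hα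
    obtain ⟨c, v, hc, hv, h⟩ := D.exists_arrow_of_ne_zero hM hS ih hb hm h
    obtain ⟨a, p, ha, hp, h⟩ := ih' hc h
    exact ⟨a, p ≫ v ≫ q, ha, .comp r p v q hp hq (hC c) (hC b) hv, by
      rwa [extPullback_comp, extPullback_comp]⟩

theorem hasProjectiveDimensionLT_of_layer (k : Type u) [Field k] [Algebra k Λ]
    [FiniteDimensional k Λ] (hM : InAdd Λ M (ModuleCat.of Λ Λ)) (hS : IsCompleteSlice Λ S)
    (hSM : ∀ X ∈ S, InAdd Λ M X) (n : ℕ) (j : D.J) (hj : D.Layer S n j) :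
    HasProjectiveDimensionLT ((homFunctor M).obj (D.X j)) (n + 1) := by
  have := D.finite
  obtain ⟨b, hb⟩ : ∃ b, ∀ j, Module.finrank k (D.X j) ≤ b := by
    obtain ⟨b, hb⟩ := (Set.finite_range fun j => Module.finrank k (D.X j)).bddAbove
    exact ⟨b, fun j => hb ⟨j, rfl⟩⟩
  induction n generalizing j with
  | zero =>
    obtain ⟨Y, hY, ⟨e⟩⟩ := hj
    exact projective_iff_hasProjectiveDimensionLT_one.1
      (Projective.of_iso ((homFunctor M).mapIso e).symm (hSM Y hY).projective_homFunctor)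
  | succ n ih =>
    rw [hasProjectiveDimensionLT_iff]
    intro m hm N α
    by_contra hα
    obtain ⟨a, v, -, hv, h⟩ := D.exists_isLongComposite_of_ne_zero hM hS ih hm
      (C := fun X => IsFinIndec X ∧ Module.finrank k X ≤ b) (fun j => ⟨D.isFinIndec j, hb j⟩)
      b hj hα
    exact h (by rw [hv.eq_zero k, extPullback_zero])

end AlmostSplitSystem

/-- If `add M` contains a complete slice, then the projective dimensions of the modules
`Hom(M, X)` are bounded. -/
theorem exists_hasProjectiveDimensionLT_homFunctor (k : Type u) [Field k] [Algebra k Λ]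
    [FiniteDimensional k Λ] (hΛ : IsRepFinite Λ) (hinj : Injective (ModuleCat.of Λ Λ))
    (hM : InAdd Λ M (ModuleCat.of Λ Λ)) {S : Set (ModuleCat.{u} Λ)} (hS : IsCompleteSlice Λ S)
    (hSM : ∀ X ∈ S, InAdd Λ M X) :
    ∃ d, ∀ X : ModuleCat.{u} Λ, Module.Finite Λ X →
      HasProjectiveDimensionLT ((homFunctor M).obj X) d := by
  have : IsArtinianRing Λ := IsArtinianRing.of_finite k Λ
  obtain ⟨D⟩ := nonempty_almostSplitSystem k hΛ hinj
  have := D.finite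
  choose n hn using D.exists_layer hS
  obtain ⟨b, hb⟩ := (Set.finite_range n).bddAbove
  refine ⟨b + 1, finite_induction _ ?_ ?_ ?_ ?_⟩
  · intro X Y e _
    exact hasProjectiveDimensionLT_of_iso ((homFunctor M).mapIso e) _
  · intro X hX
    rw [hasProjectiveDimensionLT_iff]
    intro m _ N α
    rw [← extPullback_id α, hX.eq_of_src (𝟙 X) 0, extPullback_zero]
  · intro X Y _ _ hX hY
    rw [hasProjectiveDimensionLT_iff]
    intro m hm N α
    rw [← extPullback_id α, ← biprod.total, extPullback_add, extPullback_comp, extPullback_comp,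
      (extPullback biprod.inl α).eq_zero_of_hasProjectiveDimensionLT _ hm,
      (extPullback biprod.inr α).eq_zero_of_hasProjectiveDimensionLT _ hm,
      extPullback_map_zero, extPullback_map_zero, add_zero]
  · intro X hX hX'
    by_cases hp : Projective X
    · have := projective_iff_hasProjectiveDimensionLT_one.1
        (projective_homFunctor_of_projective hM hX hp)
      exact hasProjectiveDimensionLT_of_ge _ 1 _ (by omega)
    · obtain ⟨j, ⟨e⟩⟩ := D.exists_iso X ⟨hX, hX'⟩ hp
      have := D.hasProjectiveDimensionLT_of_layer k hM hS hSM _ _ (hn j)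
      have : HasProjectiveDimensionLT ((homFunctor M).obj (D.X j)) (b + 1) :=
        hasProjectiveDimensionLT_of_ge _ (n j + 1) _ (by have := hb ⟨j, rfl⟩; omega)
      exact hasProjectiveDimensionLT_of_iso ((homFunctor M).mapIso e.symm) _

end LayerDimension

section GlobalDimension

variable {A : Type u} [Ring A]

lemma shortExact_quotient (I : Ideal A) :
    ∃ w : ModuleCat.ofHom I.subtype ≫ ModuleCat.ofHom (Submodule.mkQ I) = 0,
      (ShortComplex.mk (ModuleCat.ofHom I.subtype) (ModuleCat.ofHom (Submodule.mkQ I))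
        w).ShortExact := by
  refine ⟨?_, ModuleCat.shortComplex_shortExact _ ?_ ?_ ?_⟩
  · apply ModuleCat.hom_ext
    ext x
    simp
  · exact LinearMap.exact_subtype_mkQ I
  · exact Subtype.val_injective
  · exact Submodule.mkQ_surjective I

lemma injective_of_ext_quotient_eq_zero {N : ModuleCat.{u} A}
    (h : ∀ (I : Ideal A) (α : Abelian.Ext (ModuleCat.of A (A ⧸ I)) N 1), α = 0) :
    Injective N := by
  rw [← Module.injective_iff_injective_object, ← Module.Baer.iff_injective]
  intro I g
  obtain ⟨w, hw⟩ := shortExact_quotient I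
  let g' : ModuleCat.of A I ⟶ N := ModuleCat.ofHom g
  obtain ⟨y, hy⟩ := Abelian.Ext.contravariant_sequence_exact₁ hw N (Abelian.Ext.mk₀ g')
    (n₁ := 1) rfl (h I _)
  obtain ⟨v, rfl⟩ := (Abelian.Ext.mk₀_bijective _ _).2 y
  rw [Abelian.Ext.mk₀_comp_mk₀] at hy
  have hv := (Abelian.Ext.mk₀_bijective _ _).1 hy
  refine ⟨v.hom, fun x hx => ?_⟩
  exact LinearMap.congr_fun (congrArg ModuleCat.Hom.hom hv) ⟨x, hx⟩

lemma hasInjectiveDimensionLT_of_ext_quotient_eq_zero (d : ℕ) {N : ModuleCat.{u} A}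
    (h : ∀ (I : Ideal A) (α : Abelian.Ext (ModuleCat.of A (A ⧸ I)) N (d + 1)), α = 0) :
    HasInjectiveDimensionLT N (d + 1) := by
  induction d generalizing N with
  | zero => exact injective_iff_hasInjectiveDimensionLT_one.1 (injective_of_ext_quotient_eq_zero h)
  | succ d ih =>
    have hS : (ShortComplex.mk (Injective.ι N) (cokernel.π (Injective.ι N))
        (cokernel.condition _)).ShortExact :=
      { exact := ShortComplex.exact_cokernel _ }
    refine (hS.hasInjectiveDimensionLT_X₃_iff d inferInstance).1 (ih fun I α => ?_)
    obtain ⟨x, rfl⟩ := Abelian.Ext.covariant_sequence_exact₃ _ hS α rfl (h I _)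
    rw [x.eq_zero_of_injective, Abelian.Ext.zero_comp]

/-- The projective dimensions of all modules are bounded by those of the cyclic modules. -/
theorem hasProjectiveDimensionLT_of_quotient {d : ℕ}
    (h : ∀ I : Ideal A, HasProjectiveDimensionLT (ModuleCat.of A (A ⧸ I)) (d + 1))
    (N : ModuleCat.{u} A) : HasProjectiveDimensionLT N (d + 1) := by
  rw [hasProjectiveDimensionLT_iff]
  intro m hm Y α
  have : HasInjectiveDimensionLT Y (d + 1) :=
    hasInjectiveDimensionLT_of_ext_quotient_eq_zero d fun I β =>
      have := h I
      β.eq_zero_of_hasProjectiveDimensionLT (d + 1) le_rfl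
  exact α.eq_zero_of_hasInjectiveDimensionLT (d + 1) hm

theorem projDimLE_of_hasProjectiveDimensionLT (r : ℕ) {N : ModuleCat.{u} A}
    (h : HasProjectiveDimensionLT N (r + 1)) : ProjDimLE A N r := by
  induction r generalizing N with
  | zero =>
    have hN := projective_iff_hasProjectiveDimensionLT_one.2 h
    refine ⟨fun i => match i with
      | 0 => N
      | _ + 1 => ModuleCat.of A PUnit, fun _ => 0, 𝟙 N, ?_, ?_, inferInstance, ?_, ?_⟩
    · rintro (_ | i)
      · exact hN
      · exact (ModuleCat.isZero_of_subsingleton _).projective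
    · rintro (_ | i) hi
      · omega
      · exact ModuleCat.isZero_of_subsingleton _
    · refine ⟨zero_comp, ?_⟩
      rw [ShortComplex.exact_iff_mono _ rfl]
      infer_instance
    · exact fun i => ⟨zero_comp,
        ShortComplex.exact_of_isZero_X₂ _ (ModuleCat.isZero_of_subsingleton _)⟩
  | succ r ih =>
    have hS : (ShortComplex.mk (kernel.ι (Projective.π N)) (Projective.π N)
        (kernel.condition _)).ShortExact :=
      { exact := ShortComplex.exact_kernel _ }
    obtain ⟨P, d, f, hP, hP0, hf, ⟨w, hw⟩, hd⟩ := ih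
      ((hS.hasProjectiveDimensionLT_X₃_iff r inferInstance).1 h)
    refine ⟨fun i => match i with
      | 0 => Projective.over N
      | i + 1 => P i, fun i => match i with
      | 0 => f ≫ kernel.ι (Projective.π N)
      | i + 1 => d i, Projective.π N, ?_, ?_, inferInstance, ?_, ?_⟩
    · rintro (_ | i)
      · exact Projective.projective_over N
      · exact hP i
    · rintro (_ | i) hi
      · omega
      · exact hP0 i (by omega)
    · refine ⟨by simp, ?_⟩
      let φ : ShortComplex.mk (f ≫ kernel.ι (Projective.π N)) (Projective.π N) (by simp) ⟶
          ShortComplex.mk (kernel.ι (Projective.π N)) (Projective.π N) (kernel.condition _) :=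
        { τ₁ := f, τ₂ := 𝟙 _, τ₃ := 𝟙 _ }
      have : Epi φ.τ₁ := hf
      have : IsIso φ.τ₂ := IsIso.id _
      have : Mono φ.τ₃ := instMonoId _
      exact (ShortComplex.exact_iff_of_epi_of_isIso_of_mono φ).2 hS.exact
    · rintro (_ | i)
      · refine ⟨by simp [reassoc_of% w], ?_⟩
        let φ : ShortComplex.mk (d 0) f w ⟶
            ShortComplex.mk (d 0) (f ≫ kernel.ι (Projective.π N)) (by simp [reassoc_of% w]) :=
          { τ₁ := 𝟙 _, τ₂ := 𝟙 _, τ₃ := kernel.ι (Projective.π N) }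
        have : Epi φ.τ₁ := instEpiId _
        have : IsIso φ.τ₂ := IsIso.id _
        have : Mono φ.τ₃ := inferInstanceAs (Mono (kernel.ι (Projective.π N)))
        exact (ShortComplex.exact_iff_of_epi_of_isIso_of_mono φ).1 hw
      · exact hd i

variable {Λ : Type u} [Ring Λ] {M : ModuleCat.{u} Λ}

lemma exists_map_range_eq [IsNoetherianRing (End (op M))] (I : Ideal (End (op M))) :
    ∃ (n : ℕ) (β : (⨁ fun _ : Fin n => M) ⟶ M),
      (∀ x : M ⟶ ⨁ fun _ : Fin n => M, opEnd (x ≫ β) ∈ I) ∧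
        ∀ y ∈ I, ∃ x : M ⟶ ⨁ fun _ : Fin n => M, opEnd (x ≫ β) = y := by
  obtain ⟨n, a, ha⟩ := Submodule.fg_iff_exists_fin_generating_family.1
    (IsNoetherian.noetherian I)
  let β : (⨁ fun _ : Fin n => M) ⟶ M := biproduct.desc fun i => (a i).unop
  refine ⟨n, β, fun x => ?_, fun y hy => ?_⟩
  · rw [show β = _ from biproduct.desc_eq, Preadditive.comp_sum]
    refine Finset.sum_induction _ (fun z => opEnd z ∈ I) (fun _ _ => I.add_mem) I.zero_mem ?_
    intro i _
    rw [← Category.assoc]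
    exact I.mul_mem_left (opEnd (x ≫ biproduct.π _ i)) (ha ▸ Submodule.subset_span ⟨i, rfl⟩)
  · let R : Ideal (End (op M)) := LinearMap.range ((homFunctor M).map β).hom
    have h : Submodule.span (End (op M)) (Set.range a) ≤ R := by
      rw [Submodule.span_le]
      rintro _ ⟨i, rfl⟩
      refine ⟨(biproduct.ι (fun _ : Fin n => M) i).op, ?_⟩
      exact congrArg Quiver.Hom.op (biproduct.ι_desc (fun i => (a i).unop) i)
    obtain ⟨x, hx⟩ := h (ha ▸ hy)
    exact ⟨(show op (⨁ fun _ : Fin n => M) ⟶ op M from x).unop, hx⟩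

lemma hasProjectiveDimensionLT_quotient [IsNoetherianRing Λ] [IsNoetherianRing (End (op M))]
    [Module.Finite Λ M] {d : ℕ}
    (h : ∀ X : ModuleCat.{u} Λ, Module.Finite Λ X →
      HasProjectiveDimensionLT ((homFunctor M).obj X) d) (I : Ideal (End (op M))) :
    HasProjectiveDimensionLT (ModuleCat.of (End (op M)) (End (op M) ⧸ I)) (d + 2) := by
  obtain ⟨n, β, h1, h2⟩ := exists_map_range_eq I
  have : Module.Finite Λ (⨁ fun _ : Fin n => M : ModuleCat.{u} Λ) :=
    Module.Finite.equiv (ModuleCat.biproductIsoPi fun _ : Fin n => M).symm.toLinearEquiv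
  have hK : Module.Finite Λ (kernel β : ModuleCat.{u} Λ) :=
    Module.Finite.of_injective (kernel.ι β).hom ((ModuleCat.mono_iff_injective _).1 inferInstance)
  let q : (homFunctor M).obj (⨁ fun _ : Fin n => M) ⟶ ModuleCat.of (End (op M)) I :=
    ModuleCat.ofHom (LinearMap.codRestrict I ((homFunctor M).map β).hom fun x =>
      h1 (show op (⨁ fun _ : Fin n => M) ⟶ op M from x).unop)
  have hq : ∀ x : M ⟶ ⨁ fun _ : Fin n => M, (q.hom x.op : End (op M)) = opEnd (x ≫ β) :=
    fun _ => rfl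
  have hexact : Function.Exact ((homFunctor M).map (kernel.ι β)).hom q.hom := by
    intro y
    constructor
    · intro hy
      have hy' : (show op (⨁ fun _ : Fin n => M) ⟶ op M from y).unop ≫ β = 0 :=
        congrArg (fun z : I => (show op M ⟶ op M from z.1).unop) hy
      exact ⟨(kernel.lift β _ hy').op, congrArg Quiver.Hom.op (kernel.lift_ι β _ hy')⟩
    · rintro ⟨x, rfl⟩
      apply Subtype.ext
      refine congrArg Quiver.Hom.op (?_ :
        ((show op (kernel β) ⟶ op M from x).unop ≫ kernel.ι β) ≫ β = 0)
      rw [Category.assoc, kernel.condition, comp_zero]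
  have w : (homFunctor M).map (kernel.ι β) ≫ q = 0 := by
    apply ModuleCat.hom_ext
    ext x
    exact congrArg Subtype.val (hexact.apply_apply_eq_zero x)
  have hS : (ShortComplex.mk _ _ w).ShortExact :=
    ModuleCat.shortComplex_shortExact _ hexact (homFunctor_map_injective _) fun y => by
      obtain ⟨x, hx⟩ := h2 y.1 y.2
      exact ⟨x.op, Subtype.ext hx⟩
  have hP : ∀ P : ModuleCat.{u} (End (op M)), Projective P → ∀ m,
      HasProjectiveDimensionLT P (m + 1) := fun P hP m =>
    have := projective_iff_hasProjectiveDimensionLT_one.1 hP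
    hasProjectiveDimensionLT_of_ge P 1 (m + 1) (by omega)
  have hI := hS.hasProjectiveDimensionLT_X₃ d (h _ hK)
    (hP _ (projective_homFunctor_biproduct projective_homFunctor_self n) d)
  obtain ⟨w', hw'⟩ := shortExact_quotient I
  exact hw'.hasProjectiveDimensionLT_X₃ (d + 1) hI (hP _ projective_homFunctor_self (d + 1))

end GlobalDimension

/-- Corollary `coro-slice`: if `Λ` is a non-simple connected
self-injective algebra of finite representation type and `M` is a
generator-cogenerator such that `add M` contains a complete slice, then `End_Λ(M)`
has finite global dimension. -/
theorem statement10 (k : Type u) [Field k] (Λ : Type u) [Ring Λ] [Algebra k Λ]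
    [FiniteDimensional k Λ]
    (hconn : ∀ e : Λ, IsIdempotentElem e → e ∈ Set.center Λ → e = 0 ∨ e = 1)
    (hnonsimple : ¬ IsSemisimpleRing Λ)
    (hselfinj : Injective (ModuleCat.of Λ Λ))
    (hrepfin : ∃ (N : ℕ) (ind : Fin N → ModuleCat.{u} Λ),
      ∀ X : ModuleCat.{u} Λ, Module.Finite Λ X → Indec Λ X → ∃ i, Nonempty (X ≅ ind i))
    (M : ModuleCat.{u} Λ) (hMfin : Module.Finite Λ M) (hgc : IsGenCogen Λ M)
    (S : Set (ModuleCat.{u} Λ)) (hS : IsCompleteSlice Λ S)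
    (hSM : ∀ X ∈ S, InAdd Λ M X) :
    ∃ r : ℕ, GldimLE (End (op M)) r := by
  have : IsArtinianRing Λ := IsArtinianRing.of_finite k Λ
  have := isNoetherianRing_end M k
  obtain ⟨d, hd⟩ := exists_hasProjectiveDimensionLT_homFunctor k
    (isRepFinite_of_exists_fin hrepfin) hselfinj hgc.1 hS hSM
  exact ⟨d + 1, fun N => projDimLE_of_hasProjectiveDimensionLT (d + 1)
    (hasProjectiveDimensionLT_of_quotient (hasProjectiveDimensionLT_quotient hd) N)⟩

end Rigidity
end
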